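/- Let Ω be a bounded Lipschitz domain in ℝ^N (N ≥ 2), x₀ ∈ Ω, a > 0 and V ∈ 𝒱(Ω,a). If y₀ ∈ ∂Ω is a finely regular boundary point with respect to L_V, then K̃_{y₀}^V(x)/K_{y₀}(x) → 1 as x → y₀ nontangentially. More generally, if μ is a positive finite measure on ∂Ω, then for μ-almost all y in the set Reg_V(Ω) of finely regular points, the ratio K̃_μ^V(x)/K_μ(x) converges to 1 as x converges nontangentially to y, where K̃_μ^V(x) = ∫ K̃_y^V(x) dμ(y) and K_μ(x) = ∫ K_y(x) dμ(y). -/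

import Mathlib

open MeasureTheory Metric Set Filter Topology
open scoped ENNReal NNReal

noncomputable section

namespace Anc

abbrev ES (N : ℕ) := EuclideanSpace ℝ (Fin N)

/-- `δ_Ω(x)`: the distance from `x` to the complement of `Ω`. -/
def dista {N : ℕ} (Ω : Set (ES N)) (x : ES N) : ℝ := infDist x Ωᶜ

/-- Pointwise Laplacian (junk values where the derivatives do not exist). -/
def lap {N : ℕ} (u : ES N → ℝ) (x : ES N) : ℝ :=
  ∑ i : Fin N,
    fderiv ℝ (fun y => fderiv ℝ u y (EuclideanSpace.single i 1)) x (EuclideanSpace.single i 1)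

/-- Smooth compactly supported test functions in `Ω`. -/
def IsTestFun {N : ℕ} (Ω : Set (ES N)) (φ : ES N → ℝ) : Prop :=
  ContDiff ℝ (⊤ : ℕ∞) φ ∧ IsCompact (tsupport φ) ∧ tsupport φ ⊆ Ω

/-- `u` is a continuous weak solution of `Δu - V·u = 0` in `Ω` (i.e. `L_V`-harmonic). -/
def LVHarmonic {N : ℕ} (Ω : Set (ES N)) (V u : ES N → ℝ) : Prop :=
  ContinuousOn u Ω ∧ LocallyIntegrableOn u Ω ∧
    LocallyIntegrableOn (fun x => V x * u x) Ω ∧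
    ∀ φ, IsTestFun Ω φ → ∫ x in Ω, u x * lap φ x = ∫ x in Ω, V x * u x * φ x

/-- `s` is `L_V`-superharmonic in `Ω` (weakly, `Δs - V·s ≤ 0`, `s` l.s.c.). -/
def LVSuperharmonic {N : ℕ} (Ω : Set (ES N)) (V s : ES N → ℝ) : Prop :=
  LowerSemicontinuousOn s Ω ∧ LocallyIntegrableOn s Ω ∧
    LocallyIntegrableOn (fun x => V x * s x) Ω ∧
    ∀ φ, IsTestFun Ω φ → (∀ x, 0 ≤ φ x) →
      ∫ x in Ω, s x * lap φ x ≤ ∫ x in Ω, V x * s x * φ x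

/-- The class `𝒱(Ω,a)` of nonnegative Borel potentials with `V(x) ≤ a/δ_Ω(x)²`. -/
def VClass {N : ℕ} (Ω : Set (ES N)) (a : ℝ) (V : ES N → ℝ) : Prop :=
  Measurable V ∧ ∀ x ∈ Ω, 0 ≤ V x ∧ V x * dista Ω x ^ 2 ≤ a

/-- Lipschitz domain: open, connected, and near every boundary point, after an
orthogonal change of coordinates, the domain is the region above the graph of a
Lipschitz function. -/
def IsLipschitzDomain {N : ℕ} (Ω : Set (ES N)) : Prop :=
  IsOpen Ω ∧ IsConnected Ω ∧
    ∀ z ∈ frontier Ω, ∃ (g : ES N ≃ₗᵢ[ℝ] ES N) (i : Fin N) (f : ES N → ℝ)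
      (L : ℝ≥0) (ε : ℝ), 0 < ε ∧ LipschitzWith L f ∧
      (∀ x w : ES N, (∀ j, j ≠ i → x j = w j) → f x = f w) ∧
      ∀ x ∈ ball z ε, (x ∈ Ω ↔ f (g x) < g x i)

/-- `Ω` has a `C^{1,α}` boundary near `y`. -/
def IsC1AlphaNear {N : ℕ} (Ω : Set (ES N)) (α : ℝ) (y : ES N) : Prop :=
  ∃ (g : ES N ≃ₗᵢ[ℝ] ES N) (i : Fin N) (f : ES N → ℝ) (C : ℝ≥0) (ε : ℝ),
    0 < ε ∧ ContDiff ℝ 1 f ∧ HolderWith C α.toNNReal (fderiv ℝ f) ∧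
    (∀ x w : ES N, (∀ j, j ≠ i → x j = w j) → f x = f w) ∧
    ∀ x ∈ ball y ε, (x ∈ Ω ↔ f (g x) < g x i)

/-- `K` is the `L_V`-Martin kernel of `Ω` with pole `y ∈ ∂Ω`, normalized at `x₀`:
the unique positive `L_V`-harmonic function vanishing on `∂Ω ∖ {y}` with `K x₀ = 1`. -/
def IsMartinKernel {N : ℕ} (Ω : Set (ES N)) (V : ES N → ℝ) (x₀ y : ES N)
    (K : ES N → ℝ) : Prop :=
  LVHarmonic Ω V K ∧ (∀ x ∈ Ω, 0 < K x) ∧ K x₀ = 1 ∧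
    ∀ z ∈ frontier Ω, z ≠ y → Tendsto K (𝓝[Ω] z) (𝓝 0)

/-- `G` is the `L_V`-Green function of `Ω` with pole `y ∈ Ω`:
positive, vanishing at the boundary, and `L_V G = -δ_y` weakly. -/
def IsGreenFunction {N : ℕ} (Ω : Set (ES N)) (V : ES N → ℝ) (y : ES N)
    (G : ES N → ℝ) : Prop :=
  ContinuousOn G (Ω \ {y}) ∧ (∀ x ∈ Ω \ {y}, 0 < G x) ∧ LocallyIntegrableOn G Ω ∧
    (∀ z ∈ frontier Ω, Tendsto G (𝓝[Ω \ {y}] z) (𝓝 0)) ∧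
    ∀ φ, IsTestFun Ω φ → ∫ x in Ω, G x * (lap φ x - V x * φ x) = -φ y

/-- `y ∈ ∂Ω` is finely regular w.r.t. `V`, `Ky` being the classical Martin kernel at
`y`: the greatest `L_V`-harmonic minorant of `Ky` is positive, equivalently `Ky`
admits a positive `L_V`-harmonic minorant. -/
def FinelyRegular {N : ℕ} (Ω : Set (ES N)) (V Ky : ES N → ℝ) : Prop :=
  ∃ h, LVHarmonic Ω V h ∧ (∀ x ∈ Ω, 0 < h x) ∧ ∀ x ∈ Ω, h x ≤ Ky x

/-- `h` is the greatest nonnegative `L_V`-harmonic minorant of `w` in `Ω`. -/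
def IsGreatestLVHarmMinorant {N : ℕ} (Ω : Set (ES N)) (V w h : ES N → ℝ) : Prop :=
  LVHarmonic Ω V h ∧ (∀ x ∈ Ω, 0 ≤ h x ∧ h x ≤ w x) ∧
    ∀ g, LVHarmonic Ω V g → (∀ x ∈ Ω, 0 ≤ g x ∧ g x ≤ w x) → ∀ x ∈ Ω, g x ≤ h x

/-- Classical superharmonicity via the sub-mean value property. -/
def IsSuperharmonicOn {N : ℕ} (W : Set (ES N)) (s : ES N → ℝ) : Prop :=
  LowerSemicontinuousOn s W ∧ LocallyIntegrableOn s W ∧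
    ∀ x ∈ W, ∀ t > (0:ℝ), closedBall x t ⊆ W → ⨍ z in ball x t, s z ≤ s x

/-- The réduite of `w` over `A` in `W`: infimum of the nonnegative superharmonic
functions in `W` dominating `w` on `A`. -/
def reduite {N : ℕ} (W : Set (ES N)) (w : ES N → ℝ) (A : Set (ES N)) (x : ES N) : ℝ :=
  sInf {v | ∃ s : ES N → ℝ, IsSuperharmonicOn W s ∧ (∀ z ∈ W, 0 ≤ s z) ∧
    (∀ z ∈ A, w z ≤ s z) ∧ v = s x}

/-- The lower semicontinuous regularization `R̂` of the réduite. -/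
def reduiteReg {N : ℕ} (W : Set (ES N)) (w : ES N → ℝ) (A : Set (ES N)) (x : ES N) : ℝ :=
  liminf (reduite W w A) (𝓝[W] x)

/-- Nontangential approach region at `y` with aperture `κ`. -/
def ntRegion {N : ℕ} (Ω : Set (ES N)) (y : ES N) (κ : ℝ) : Set (ES N) :=
  {x | x ∈ Ω ∧ dist x y ≤ κ * dista Ω x}

/-- `g` tends to `l` nontangentially at `y`. -/
def TendstoNT {N : ℕ} (Ω : Set (ES N)) (g : ES N → ℝ) (y : ES N) (l : Filter ℝ) : Prop :=
  ∀ κ > (0:ℝ), Tendsto g (𝓝[ntRegion Ω y κ] y) l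

/-- Truncated cone `{y + t(ν+v) : 0 < t ≤ η, ‖v‖ ≤ η}` with vertex `y`. -/
def truncCone {N : ℕ} (y ν : ES N) (η : ℝ) : Set (ES N) :=
  {x | ∃ (t : ℝ) (v : ES N), 0 < t ∧ t ≤ η ∧ ‖v‖ ≤ η ∧ x = y + t • (ν + v)}

/-- Last coordinate of a point of `ℝ^{n+1}`. -/
def lastC {n : ℕ} (x : ES (n + 1)) : ℝ := x (Fin.last n)

/-- First `n` coordinates of a point of `ℝ^{n+1}`. -/
def firstC {n : ℕ} (x : ES (n + 1)) : ES n :=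
  (EuclideanSpace.equiv (Fin n) ℝ).symm fun i => x i.castSucc

/-- The region `U_f(r,ρ) = {(x',x_N) : |x'| < r, f(x') < x_N < ρ}`. -/
def Ucyl {n : ℕ} (f : ES n → ℝ) (r ρ : ℝ) : Set (ES (n + 1)) :=
  {x | ‖firstC x‖ < r ∧ f (firstC x) < lastC x ∧ lastC x < ρ}

/-- The cylinder `T(t) = B_{N-1}(0,tr) × (-tρ, tρ)`. -/
def Tcyl (n : ℕ) (r ρ t : ℝ) : Set (ES (n + 1)) :=
  {x | ‖firstC x‖ < t * r ∧ |lastC x| < t * ρ}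

/-- The graph part `∂_#U` of the boundary of `U_f(r,ρ)`. -/
def graphBdry {n : ℕ} (f : ES n → ℝ) (r ρ : ℝ) : Set (ES (n + 1)) :=
  frontier (Ucyl f r ρ) ∩ {x | ‖firstC x‖ < r ∧ lastC x = f (firstC x)}

section

def Mf (s : ℝ) : ℝ := expNegInvGlue (1 - s)
def kf (s : ℝ) : ℝ := 2 * deriv expNegInvGlue (1 - s)

lemma glue_smooth : ContDiff ℝ (⊤:ℕ∞) expNegInvGlue := expNegInvGlue.contDiff

lemma glue_deriv_pos {x : ℝ} (hx : 0 < x) : 0 < deriv expNegInvGlue x := by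
  have h : HasDerivAt expNegInvGlue (Real.exp (-x⁻¹) * (x^2)⁻¹) x := by
    have h1 : HasDerivAt (fun y : ℝ => Real.exp (-y⁻¹)) (Real.exp (-x⁻¹) * (x^2)⁻¹) x := by
      have := ((hasDerivAt_inv hx.ne').neg).exp
      simpa using this
    refine h1.congr_of_eventuallyEq ?_
    filter_upwards [lt_mem_nhds hx] with y hy
    simp [expNegInvGlue, not_le.2 hy]
  rw [h.deriv]; positivity

lemma glue_deriv_zero {x : ℝ} (hx : x ≤ 0) : deriv expNegInvGlue x = 0 := by
  rcases hx.lt_or_eq with h | rfl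
  · have : expNegInvGlue =ᶠ[𝓝 x] fun _ => 0 := by
      filter_upwards [gt_mem_nhds h] with y hy
      exact expNegInvGlue.zero_of_nonpos (le_of_lt hy)
    rw [this.deriv_eq]; simp
  · have hc : Continuous (deriv expNegInvGlue) :=
      (glue_smooth.continuous_deriv (by simp))
    have h1 : Tendsto (deriv expNegInvGlue) (𝓝[<] 0) (𝓝 (deriv expNegInvGlue 0)) :=
      hc.continuousAt.tendsto.mono_left nhdsWithin_le_nhds
    have h2 : Tendsto (deriv expNegInvGlue) (𝓝[<] 0) (𝓝 0) := by
      refine tendsto_const_nhds.congr' ?_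
      filter_upwards [self_mem_nhdsWithin] with y hy
      have : expNegInvGlue =ᶠ[𝓝 y] fun _ => 0 := by
        filter_upwards [gt_mem_nhds (show y < 0 from hy)] with z hz
        exact expNegInvGlue.zero_of_nonpos (le_of_lt hz)
      rw [this.deriv_eq]; simp
    exact tendsto_nhds_unique h1 h2

lemma glue_deriv_smooth : ContDiff ℝ (⊤:ℕ∞) (deriv expNegInvGlue) := by
  have := (contDiff_infty_iff_deriv (f := expNegInvGlue)).1 glue_smooth
  exact this.2

lemma kf_smooth : ContDiff ℝ (⊤:ℕ∞) kf :=
  contDiff_const.mul (glue_deriv_smooth.comp (contDiff_const.sub contDiff_id))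
lemma Mf_smooth : ContDiff ℝ (⊤:ℕ∞) Mf := glue_smooth.comp (contDiff_const.sub contDiff_id)
lemma kf_cont : Continuous kf := kf_smooth.continuous
lemma kf_pos {s : ℝ} (h : s < 1) : 0 < kf s := by
  have := glue_deriv_pos (x := 1 - s) (by linarith)
  unfold kf; linarith
lemma kf_zero {s : ℝ} (h : 1 ≤ s) : kf s = 0 := by
  unfold kf; rw [glue_deriv_zero (by linarith)]; simp
lemma kf_nonneg (s : ℝ) : 0 ≤ kf s := by
  rcases lt_or_ge s 1 with h | h
  · exact (kf_pos h).le
  · exact (kf_zero h).ge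
lemma Mf_zero {s : ℝ} (h : 1 ≤ s) : Mf s = 0 := expNegInvGlue.zero_of_nonpos (by linarith)
lemma Mf_nonneg (s : ℝ) : 0 ≤ Mf s := expNegInvGlue.nonneg _
lemma Mf_deriv (s : ℝ) : HasDerivAt Mf (-(kf s)/2) s := by
  have h1 : HasDerivAt expNegInvGlue (deriv expNegInvGlue (1-s)) (1-s) :=
    (glue_smooth.differentiable (by simp)).differentiableAt.hasDerivAt
  have := h1.comp s ((hasDerivAt_id s).const_sub 1)
  unfold Mf kf
  refine this.congr_deriv ?_
  ring
lemma deriv_Mf : deriv Mf = fun s => -(kf s)/2 := funext fun s => (Mf_deriv s).deriv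
lemma kf_deriv (s : ℝ) : HasDerivAt kf (deriv kf s) s :=
  (kf_smooth.differentiable (by simp)).differentiableAt.hasDerivAt
lemma kf_deriv_cont : Continuous (deriv kf) := kf_smooth.continuous_deriv (by simp)
lemma kf_deriv_zero {s : ℝ} (h : 1 < s) : deriv kf s = 0 := by
  have : kf =ᶠ[𝓝 s] fun _ => 0 := by
    filter_upwards [lt_mem_nhds h] with y hy
    exact kf_zero (le_of_lt hy)
  rw [this.deriv_eq]; simp

variable {N : ℕ}

lemma hasFDerivAt_radial {Φ Φ' : ℝ → ℝ} (h : ∀ s, HasDerivAt Φ (Φ' s) s) (x w : ES N) :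
    HasFDerivAt (fun w : ES N => Φ (‖w - x‖^2))
      (Φ' (‖w - x‖^2) • (2 • (innerSL ℝ (w - x)))) w := by
  have h1 : HasFDerivAt (fun w : ES N => ‖w - x‖^2) (2 • (innerSL ℝ (w - x))) w := by
    have := ((hasFDerivAt_id (𝕜 := ℝ) w).sub_const x).norm_sq
    simpa using this
  exact (h _).comp_hasFDerivAt w h1

lemma lap_radial {Φ Φ' Φ'' : ℝ → ℝ} (h : ∀ s, HasDerivAt Φ (Φ' s) s)
    (h' : ∀ s, HasDerivAt Φ' (Φ'' s) s) (x w : ES N) :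
    lap (fun w : ES N => Φ (‖w - x‖^2)) w
      = 2 * N * Φ' (‖w - x‖^2) + 4 * ‖w - x‖^2 * Φ'' (‖w - x‖^2) := by
  unfold lap
  have h1 : ∀ i : Fin N, (fun y : ES N => fderiv ℝ (fun w : ES N => Φ (‖w - x‖^2)) y
      (EuclideanSpace.single i 1)) = fun y => Φ' (‖y - x‖^2) * (2 * (y - x) i) := by
    intro i; funext y
    rw [(hasFDerivAt_radial h x y).fderiv]
    simp [EuclideanSpace.inner_single_right]
  have h2 : ∀ i : Fin N, fderiv ℝ (fun y : ES N => Φ' (‖y - x‖^2) * (2 * (y - x) i)) w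
      (EuclideanSpace.single i 1) = 2 * Φ' (‖w-x‖^2) + 4 * (w i - x i)^2 * Φ'' (‖w-x‖^2) := by
    intro i
    have hp : HasFDerivAt (fun y : ES N => 2 * (y - x) i)
        ((2:ℝ) • (EuclideanSpace.proj (𝕜 := ℝ) i : ES N →L[ℝ] ℝ)) w := by
      have := ((EuclideanSpace.proj (𝕜 := ℝ) i : ES N →L[ℝ] ℝ).hasFDerivAt (x := w)).sub_const (x i)
      have := this.const_mul 2
      simpa using this
    have hm := ((hasFDerivAt_radial h' x w).fun_mul hp).fderiv
    rw [hm]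
    simp [EuclideanSpace.inner_single_right]
    ring
  simp_rw [h1, h2]
  rw [Finset.sum_add_distrib]
  have : ‖w - x‖^2 = ∑ i, (w i - x i)^2 := by
    rw [EuclideanSpace.norm_sq_eq]; simp
  simp only [Finset.sum_const, Finset.card_univ, Fintype.card_fin, nsmul_eq_mul]
  rw [← Finset.sum_mul, ← Finset.mul_sum, ← this]
  ring

end

section

variable {N : ℕ}

def ck (N : ℕ) : ℝ := ∫ w : ES N, kf (‖w‖^2)
def kap (x : ES N) (t : ℝ) (w : ES N) : ℝ := (ck N)⁻¹ * (t^N)⁻¹ * kf (‖w - x‖^2 / t^2)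
def mt (x : ES N) (t : ℝ) (w : ES N) : ℝ := (ck N)⁻¹ * (t^N)⁻¹ * Mf (‖w - x‖^2 / t^2)
def Av (u : ES N → ℝ) (x : ES N) (t : ℝ) : ℝ := ∫ w, kap x t w * u w

lemma ck_pos : 0 < ck N := by
  have hc : Continuous (fun w : ES N => kf (‖w‖^2)) := kf_cont.comp (by fun_prop)
  have hs : HasCompactSupport (fun w : ES N => kf (‖w‖^2)) := by
    refine HasCompactSupport.intro (isCompact_closedBall (0 : ES N) 1) ?_
    intro w hw
    simp only [mem_closedBall, dist_zero_right, not_le] at hw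
    exact kf_zero (by nlinarith)
  refine hc.integral_pos_of_hasCompactSupport_nonneg_nonzero hs (fun w => kf_nonneg _) (x := 0) ?_
  simpa using (kf_pos (s := 0) (by norm_num)).ne'

lemma kap_nonneg {x : ES N} {t : ℝ} (ht : 0 ≤ t) (w : ES N) : 0 ≤ kap x t w := by
  have := ck_pos (N := N); have := kf_nonneg (‖w - x‖^2 / t^2)
  unfold kap; positivity

lemma mt_nonneg {x : ES N} {t : ℝ} (ht : 0 ≤ t) (w : ES N) : 0 ≤ mt x t w := by
  have := ck_pos (N := N); have := Mf_nonneg (‖w - x‖^2 / t^2)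
  unfold mt; positivity

lemma one_le_div_of_far {x w : ES N} {t : ℝ} (ht : 0 < t) (h : t ≤ dist w x) :
    1 ≤ ‖w - x‖^2 / t^2 := by
  rw [dist_eq_norm] at h
  rw [one_le_div (by positivity)]
  gcongr

lemma kap_zero {x w : ES N} {t : ℝ} (ht : 0 < t) (h : t ≤ dist w x) : kap x t w = 0 := by
  unfold kap; rw [kf_zero (one_le_div_of_far ht h), mul_zero]

lemma mt_zero {x w : ES N} {t : ℝ} (ht : 0 < t) (h : t ≤ dist w x) : mt x t w = 0 := by
  unfold mt; rw [Mf_zero (one_le_div_of_far ht h), mul_zero]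

lemma kap_cont (x : ES N) (t : ℝ) : Continuous (kap x t) := by
  unfold kap
  exact continuous_const.mul (kf_cont.comp (by fun_prop))

lemma kap_scale (x : ES N) {t : ℝ} (ht : 0 < t) (w : ES N) :
    kap x t w = (t^N)⁻¹ * kap 0 1 (t⁻¹ • (w - x)) := by
  unfold kap
  have : ‖t⁻¹ • (w - x) - 0‖^2 / 1^2 = ‖w - x‖^2 / t^2 := by
    rw [sub_zero, norm_smul, norm_inv, Real.norm_of_nonneg ht.le]; field_simp
  rw [this]; ring

lemma kap_scale2 (x x' : ES N) {t t' : ℝ} (ht : 0 < t) (w : ES N) :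
    kap x' t' w = (t^N)⁻¹ * kap (t⁻¹ • (x' - x)) (t⁻¹ * t') (t⁻¹ • (w - x)) := by
  unfold kap
  have : ‖t⁻¹ • (w - x) - t⁻¹ • (x' - x)‖^2 / (t⁻¹ * t')^2 = ‖w - x'‖^2 / t'^2 := by
    rw [← smul_sub, norm_smul, norm_inv, Real.norm_of_nonneg ht.le, sub_sub_sub_cancel_right]
    field_simp
  rw [this, mul_pow, inv_pow, mul_inv, inv_inv]
  field_simp

lemma integral_scale (f : ES N → ℝ) (x : ES N) {t : ℝ} (ht : 0 < t) :
    ∫ w, (t^N)⁻¹ * f (t⁻¹ • (w - x)) = ∫ w, f w := by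
  rw [integral_const_mul, integral_sub_right_eq_self (fun w => f (t⁻¹ • w)) x,
    Measure.integral_comp_inv_smul_of_nonneg _ _ ht.le]
  simp only [finrank_euclideanSpace, Fintype.card_fin, smul_eq_mul]
  field_simp

lemma kap_integral (x : ES N) {t : ℝ} (ht : 0 < t) : ∫ w, kap x t w = 1 := by
  simp_rw [kap_scale x ht]
  rw [integral_scale _ x ht]
  unfold kap
  rw [integral_const_mul]
  simp only [sub_zero, one_pow, div_one, inv_one, mul_one]
  exact inv_mul_cancel₀ ck_pos.ne'

lemma kap_bounds (N : ℕ) : ∃ c0 C0 : ℝ, 0 < c0 ∧ 0 < C0 ∧ ∀ (x : ES N) (t : ℝ) (w : ES N), 0 < t →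
    kap x t w ≤ C0 * (t^N)⁻¹ ∧ (dist w x ≤ 3/4 * t → c0 * (t^N)⁻¹ ≤ kap x t w) := by
  obtain ⟨s0, hs0, hmin⟩ := (isCompact_Icc (a := (0:ℝ)) (b := 9/16)).exists_isMinOn
    ⟨0, by norm_num⟩ kf_cont.continuousOn
  obtain ⟨s1, hs1, hmax⟩ := (isCompact_Icc (a := (0:ℝ)) (b := 1)).exists_isMaxOn
    ⟨0, by norm_num⟩ kf_cont.continuousOn
  have hk0 : 0 < kf s0 := kf_pos (by linarith [hs0.2])
  have hk1 : 0 < kf s1 := (kf_pos (s := 0) (by norm_num)).trans_le (hmax (by norm_num))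
  have := ck_pos (N := N)
  refine ⟨(ck N)⁻¹ * kf s0, (ck N)⁻¹ * kf s1, by positivity, by positivity, ?_⟩
  intro x t w ht
  constructor
  · unfold kap
    have : kf (‖w - x‖^2 / t^2) ≤ kf s1 := by
      rcases le_or_gt (‖w - x‖^2 / t^2) 1 with h | h
      · exact hmax ⟨by positivity, h⟩
      · rw [kf_zero h.le]; exact hk1.le
    calc _ ≤ (ck N)⁻¹ * (t^N)⁻¹ * kf s1 := by gcongr
      _ = _ := by ring
  · intro h
    unfold kap
    have : kf s0 ≤ kf (‖w - x‖^2 / t^2) := by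
      apply hmin
      refine ⟨by positivity, ?_⟩
      rw [div_le_iff₀ (by positivity)]
      rw [dist_eq_norm] at h
      calc _ ≤ (3/4*t)^2 := by gcongr
        _ = _ := by ring
    calc _ = (ck N)⁻¹ * (t^N)⁻¹ * kf s0 := by ring
      _ ≤ _ := by gcongr

lemma kap_integrable (x : ES N) {t : ℝ} (ht : 0 < t) : Integrable (kap x t) := by
  refine (kap_cont x t).integrable_of_hasCompactSupport ?_
  refine HasCompactSupport.intro (isCompact_closedBall x t) ?_
  intro w hw
  exact kap_zero ht (by simpa using (not_le.1 hw).le)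

lemma kap_mul_eq_indicator (x : ES N) {t : ℝ} (ht : 0 < t) (u : ES N → ℝ) :
    (fun w => kap x t w * u w) = (closedBall x t).indicator (fun w => kap x t w * u w) := by
  funext w
  by_cases h : w ∈ closedBall x t
  · rw [indicator_of_mem h]
  · rw [indicator_of_notMem h, kap_zero ht (by simpa using (not_le.1 h).le), zero_mul]

lemma kap_mul_integrable (x : ES N) {t : ℝ} (ht : 0 < t) {u : ES N → ℝ}
    (hu : IntegrableOn u (closedBall x t)) : Integrable (fun w => kap x t w * u w) := by
  rw [kap_mul_eq_indicator x ht, integrable_indicator_iff measurableSet_closedBall]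
  exact hu.continuousOn_mul (kap_cont x t).continuousOn (isCompact_closedBall x t)

lemma Av_mono {x : ES N} {t : ℝ} (ht : 0 < t) {u v : ES N → ℝ}
    (hu : IntegrableOn u (closedBall x t)) (hv : IntegrableOn v (closedBall x t))
    (h : ∀ w ∈ closedBall x t, u w ≤ v w) : Av u x t ≤ Av v x t := by
  refine integral_mono (kap_mul_integrable x ht hu) (kap_mul_integrable x ht hv) ?_
  intro w
  simp only
  by_cases hw : w ∈ closedBall x t
  · exact mul_le_mul_of_nonneg_left (h w hw) (kap_nonneg ht.le w)
  · rw [kap_zero ht (by simpa using (not_le.1 hw).le)]; simp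

lemma Av_congr {x : ES N} {t : ℝ} (ht : 0 < t) {u v : ES N → ℝ}
    (h : ∀ w ∈ closedBall x t, u w = v w) : Av u x t = Av v x t := by
  refine integral_congr_ae (Eventually.of_forall ?_)
  intro w
  simp only
  by_cases hw : w ∈ closedBall x t
  · rw [h w hw]
  · rw [kap_zero ht (by simpa using (not_le.1 hw).le)]; simp

lemma Av_const {x : ES N} {t : ℝ} (ht : 0 < t) (c : ℝ) : Av (fun _ => c) x t = c := by
  unfold Av; rw [integral_mul_const, kap_integral x ht, one_mul]

lemma Av_add {x : ES N} {t : ℝ} (ht : 0 < t) {u v : ES N → ℝ}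
    (hu : IntegrableOn u (closedBall x t)) (hv : IntegrableOn v (closedBall x t)) :
    Av (fun w => u w + v w) x t = Av u x t + Av v x t := by
  unfold Av
  rw [← integral_add (kap_mul_integrable x ht hu) (kap_mul_integrable x ht hv)]
  simp_rw [mul_add]

lemma Av_sub {x : ES N} {t : ℝ} (ht : 0 < t) {u v : ES N → ℝ}
    (hu : IntegrableOn u (closedBall x t)) (hv : IntegrableOn v (closedBall x t)) :
    Av (fun w => u w - v w) x t = Av u x t - Av v x t := by
  unfold Av
  rw [← integral_sub (kap_mul_integrable x ht hu) (kap_mul_integrable x ht hv)]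
  simp_rw [mul_sub]

lemma Av_smul {x : ES N} {t : ℝ} (c : ℝ) (u : ES N → ℝ) :
    Av (fun w => c * u w) x t = c * Av u x t := by
  unfold Av
  rw [← integral_const_mul]
  congr 1; funext w; ring

lemma kap_uncurry_cont {x : ES N} {t : ℝ} (ht : t ≠ 0) (w : ES N) :
    ContinuousAt (fun p : ES N × ℝ => kap p.1 p.2 w) (x, t) := by
  unfold kap
  refine ContinuousAt.mul (ContinuousAt.mul continuousAt_const ?_) ?_
  · refine ContinuousAt.inv₀ (by fun_prop) ?_
    exact pow_ne_zero _ ht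
  · refine kf_cont.continuousAt.comp ?_
    refine ContinuousAt.div (by fun_prop) (by fun_prop) ?_
    exact pow_ne_zero _ ht

/-- modulus of continuity of the kernels in `L¹` -/
lemma kap_modulus (N : ℕ) {ε : ℝ} (hε : 0 < ε) : ∃ η : ℝ, 0 < η ∧ η < 1/4 ∧
    ∀ (x x' : ES N) (t t' : ℝ), 0 < t → dist x x' ≤ η * t → |t - t'| ≤ η * t →
      ∫ w, |kap x t w - kap x' t' w| ≤ ε := by
  obtain ⟨c0, C0, hc0, hC0, hb⟩ := kap_bounds N
  have hG : ContinuousAt (fun p : ES N × ℝ => ∫ v, |kap 0 1 v - kap p.1 p.2 v|) (0, 1) := by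
    have hnear : ∀ᶠ p : ES N × ℝ in 𝓝 (0, 1), ‖p.1‖ < 1 ∧ 1/2 < p.2 ∧ p.2 < 2 := by
      have h1 : ∀ᶠ p : ES N × ℝ in 𝓝 (0, 1), ‖p.1‖ < 1 :=
        (continuous_fst.norm.continuousAt (x := ((0 : ES N), (1:ℝ)))).eventually_lt
          continuousAt_const (by simp)
      have h2 : ∀ᶠ p : ES N × ℝ in 𝓝 (0, 1), 1/2 < p.2 :=
        continuousAt_const.eventually_lt
          (continuous_snd.continuousAt (x := ((0 : ES N), (1:ℝ)))) (by norm_num)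
      have h3 : ∀ᶠ p : ES N × ℝ in 𝓝 (0, 1), p.2 < 2 :=
        (continuous_snd.continuousAt (x := ((0 : ES N), (1:ℝ)))).eventually_lt
          continuousAt_const (by norm_num)
      filter_upwards [h1, h2, h3] with p a b c using ⟨a, b, c⟩
    refine continuousAt_of_dominated (bound := (closedBall (0 : ES N) 3).indicator
      (fun _ => C0 + C0 * 2^N)) ?_ ?_ ?_ ?_
    · exact Eventually.of_forall fun p =>
        (((kap_cont 0 1).sub (kap_cont p.1 p.2)).abs).aestronglyMeasurable
    · filter_upwards [hnear] with p hp
      refine Eventually.of_forall fun v => ?_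
      rw [Real.norm_eq_abs, abs_abs]
      by_cases hv : v ∈ closedBall (0 : ES N) 3
      · rw [indicator_of_mem hv]
        have hp2 : 0 < p.2 := by linarith
        have e1 := (hb 0 1 v one_pos).1
        have e2 := (hb p.1 p.2 v hp2).1
        have e3 := kap_nonneg (x := (0 : ES N)) zero_le_one v
        have e4 := kap_nonneg (x := p.1) hp2.le v
        have e5 : (p.2^N)⁻¹ ≤ 2^N := by
          rw [← inv_pow]; gcongr
          rw [inv_le_comm₀ hp2 (by norm_num)]; linarith
        have e6 : C0 * (p.2^N)⁻¹ ≤ C0 * 2^N := by gcongr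
        simp only [one_pow, inv_one, mul_one] at e1
        rw [abs_le]; constructor <;> nlinarith
      · rw [indicator_of_notMem hv]
        have hv' : 3 < dist v 0 := by simpa using hv
        rw [dist_zero_right] at hv'
        rw [kap_zero one_pos (by simp; linarith), kap_zero (by linarith)]
        · simp
        · have := norm_sub_norm_le v p.1
          rw [dist_eq_norm]; linarith
    · rw [integrable_indicator_iff measurableSet_closedBall]
      exact integrableOn_const (measure_closedBall_lt_top.ne)
    · refine Eventually.of_forall fun v => ?_
      exact (continuousAt_const.sub (kap_uncurry_cont one_ne_zero v)).abs
  have h0 : (∫ v, |kap (0 : ES N) 1 v - kap 0 1 v|) = 0 := by simp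
  have hlt : ∀ᶠ p : ES N × ℝ in 𝓝 (0, 1), (∫ v, |kap 0 1 v - kap p.1 p.2 v|) < ε :=
    hG.eventually_lt continuousAt_const (by simpa using hε)
  rw [Metric.eventually_nhds_iff] at hlt
  obtain ⟨η, hη, hlt⟩ := hlt
  refine ⟨min (η/2) (1/8), by positivity, by
    have := min_le_right (η/2) (1/8:ℝ); linarith, ?_⟩
  intro x x' t t' ht hx htt
  have hm := min_le_left (η/2) (1/8:ℝ)
  have key : ∫ w, |kap x t w - kap x' t' w|
      = ∫ v, |kap 0 1 v - kap (t⁻¹ • (x' - x)) (t⁻¹ * t') v| := by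
    rw [← integral_scale (fun v => |kap 0 1 v - kap (t⁻¹ • (x' - x)) (t⁻¹ * t') v|) x ht]
    congr 1; funext w
    rw [kap_scale x ht w, kap_scale2 x x' (t' := t') ht w, ← mul_sub, abs_mul,
      abs_of_nonneg (by positivity : 0 ≤ (t^N)⁻¹)]
  rw [key]
  have hd : dist ((t⁻¹ • (x' - x), t⁻¹ * t') : ES N × ℝ) (0, 1) < η := by
    rw [Prod.dist_eq, max_lt_iff]
    constructor
    · simp only [dist_zero_right, norm_smul, norm_inv, Real.norm_of_nonneg ht.le]
      rw [dist_comm, dist_eq_norm] at hx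
      rw [inv_mul_lt_iff₀ ht]
      calc _ ≤ min (η/2) (1/8) * t := hx
        _ ≤ η/2 * t := by gcongr
        _ < t * η := by nlinarith
    · have : dist (t⁻¹ * t') 1 = t⁻¹ * |t - t'| := by
        rw [Real.dist_eq, ← abs_of_pos (inv_pos.2 ht), ← abs_mul, abs_of_pos (inv_pos.2 ht),
          abs_sub_comm]
        congr 1; field_simp
      simp only [this]
      rw [inv_mul_lt_iff₀ ht]
      calc _ ≤ min (η/2) (1/8) * t := htt
        _ ≤ η/2 * t := by gcongr
        _ < t * η := by nlinarith
  exact (hlt hd).le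

end

section

variable {N : ℕ}

def kapd (x : ES N) (t : ℝ) (w : ES N) : ℝ :=
  (ck N)⁻¹ * (-(N * (t^(N+1))⁻¹ * kf (‖w - x‖^2 / t^2))
    - 2 * ‖w - x‖^2 * (t^(N+3))⁻¹ * deriv kf (‖w - x‖^2 / t^2))

lemma kap_hasDerivAt (x w : ES N) {t : ℝ} (ht : 0 < t) :
    HasDerivAt (fun t => kap x t w) (kapd x t w) t := by
  have h1 : HasDerivAt (fun t : ℝ => ‖w - x‖^2 / t^2) (-(2 * ‖w-x‖^2 * (t^3)⁻¹)) t := by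
    have := ((hasDerivAt_pow 2 t).inv (pow_ne_zero 2 ht.ne')).const_mul (‖w - x‖^2)
    refine (this.congr_deriv ?_)
    field_simp
    norm_num
    ring
  have h2 : HasDerivAt (fun t : ℝ => (t^N)⁻¹) (-(N * (t^(N+1))⁻¹)) t := by
    have := ((hasDerivAt_pow N t).inv (pow_ne_zero N ht.ne'))
    refine (this.congr_deriv ?_)
    rcases N with _ | n
    · simp
    · simp only [Nat.add_sub_cancel]
      field_simp
      ring
  have h3 := ((h2.const_mul (ck N)⁻¹).fun_mul ((kf_deriv _).comp t h1))
  unfold kap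
  refine h3.congr_deriv ?_
  unfold kapd
  simp only [Function.comp]
  have : (t^(N+3))⁻¹ = (t^N)⁻¹ * (t^3)⁻¹ := by rw [pow_add, mul_inv]
  rw [this]; ring

lemma lap_mt (x w : ES N) {t : ℝ} (ht : 0 < t) : t * lap (mt x t) w = kapd x t w := by
  have e : mt x t = fun w => (fun s => (ck N)⁻¹ * (t^N)⁻¹ * Mf (s / t^2)) (‖w - x‖^2) := by
    funext w; rfl
  have h : ∀ s, HasDerivAt (fun s => (ck N)⁻¹ * (t^N)⁻¹ * Mf (s / t^2))
      ((ck N)⁻¹ * (t^N)⁻¹ * (-(kf (s/t^2))/2 * (1/t^2))) s := by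
    intro s
    have h0 : HasDerivAt (fun s : ℝ => s / t^2) (1/t^2) s := (hasDerivAt_id s).div_const _
    exact ((Mf_deriv _).comp s h0).const_mul _
  have h' : ∀ s, HasDerivAt (fun s => (ck N)⁻¹ * (t^N)⁻¹ * (-(kf (s/t^2))/2 * (1/t^2)))
      ((ck N)⁻¹ * (t^N)⁻¹ * (-(deriv kf (s/t^2) * (1/t^2))/2 * (1/t^2))) s := by
    intro s
    have h0 : HasDerivAt (fun s : ℝ => s / t^2) (1/t^2) s := (hasDerivAt_id s).div_const _
    exact (((((kf_deriv _).comp s h0).neg).div_const 2).mul_const _).const_mul _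
  rw [e, lap_radial h h']
  unfold kapd
  have : (t^(N+3))⁻¹ = (t^N)⁻¹ * (t^3)⁻¹ := by rw [pow_add, mul_inv]
  rw [this, pow_succ]
  field_simp
  ring

lemma mt_testfun {Ω : Set (ES N)} (x : ES N) {t : ℝ} (ht : 0 < t) (h : closedBall x t ⊆ Ω) :
    IsTestFun Ω (mt x t) := by
  have hs : tsupport (mt x t) ⊆ closedBall x t := by
    refine closure_minimal ?_ isClosed_closedBall
    intro w hw
    by_contra hc
    exact hw (mt_zero ht (by simpa using (not_le.1 hc).le))
  refine ⟨?_, (isCompact_closedBall x t).of_isClosed_subset (isClosed_tsupport _) hs, hs.trans h⟩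
  unfold mt
  refine contDiff_const.mul (Mf_smooth.comp ?_)
  exact ((contDiff_id.sub contDiff_const).norm_sq ℝ).div_const _

lemma kapd_cont (x : ES N) (t : ℝ) : Continuous (kapd x t) := by
  have h1 : Continuous (fun w : ES N => kf (‖w - x‖^2 / t^2)) := kf_cont.comp (by fun_prop)
  have h2 : Continuous (fun w : ES N => deriv kf (‖w - x‖^2 / t^2)) :=
    kf_deriv_cont.comp (by fun_prop)
  unfold kapd
  fun_prop

lemma kapd_zero {x w : ES N} {t : ℝ} (ht : 0 < t) (h : t < dist w x) : kapd x t w = 0 := by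
  have h1 : 1 < ‖w - x‖^2 / t^2 := by
    rw [dist_eq_norm] at h
    rw [one_lt_div (by positivity)]; gcongr
  unfold kapd
  rw [kf_zero h1.le, kf_deriv_zero h1]; simp

lemma kapd_bound (x : ES N) {a b : ℝ} (ha : 0 < a) : ∃ C, 0 ≤ C ∧ ∀ t ∈ Ioo a b, ∀ w,
    |kapd x t w| ≤ C := by
  obtain ⟨s1, hs1, h1⟩ := (isCompact_Icc (a := (0:ℝ)) (b := 1)).exists_isMaxOn
    ⟨0, by norm_num⟩ (kf_cont.abs).continuousOn
  obtain ⟨s2, hs2, h2⟩ := (isCompact_Icc (a := (0:ℝ)) (b := 1)).exists_isMaxOn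
    ⟨0, by norm_num⟩ (kf_deriv_cont.abs).continuousOn
  have hck := ck_pos (N := N)
  refine ⟨(ck N)⁻¹ * (N * (a^(N+1))⁻¹ * |kf s1| + 2 * b^2 * (a^(N+3))⁻¹ * |deriv kf s2|),
    by positivity, ?_⟩
  rintro t ⟨hat, htb⟩ w
  have ht : 0 < t := ha.trans hat
  rcases le_or_gt (dist w x) t with h | h
  · have hs : ‖w - x‖^2 / t^2 ∈ Icc (0:ℝ) 1 := by
      refine ⟨by positivity, ?_⟩
      rw [dist_eq_norm] at h
      rw [div_le_one (by positivity)]; gcongr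
    have e1 : |kf (‖w - x‖^2 / t^2)| ≤ |kf s1| := h1 hs
    have e2 : |deriv kf (‖w - x‖^2 / t^2)| ≤ |deriv kf s2| := h2 hs
    have e3 : ‖w - x‖^2 ≤ b^2 := by
      rw [dist_eq_norm] at h; gcongr; linarith
    have e4 : (t^(N+1))⁻¹ ≤ (a^(N+1))⁻¹ := by gcongr
    have e5 : (t^(N+3))⁻¹ ≤ (a^(N+3))⁻¹ := by gcongr
    unfold kapd
    rw [abs_mul, abs_of_pos (inv_pos.2 hck)]
    gcongr
    refine (abs_sub _ _).trans ?_
    rw [abs_neg, abs_mul, abs_mul _ (deriv kf _), abs_of_nonneg (by positivity : 0 ≤ (N:ℝ) * (t^(N+1))⁻¹),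
      abs_of_nonneg (by positivity : 0 ≤ 2 * ‖w - x‖^2 * (t^(N+3))⁻¹)]
    gcongr
  · rw [kapd_zero ht h, abs_zero]; positivity

lemma Av_hasDerivAt {x : ES N} {T t : ℝ} {u : ES N → ℝ} (hu : IntegrableOn u (closedBall x T))
    (ht : 0 < t) (htT : t < T) :
    HasDerivAt (fun t => Av u x t) (∫ w, kapd x t w * u w) t := by
  obtain ⟨C, hC, hb⟩ := kapd_bound x (a := t/2) (b := T) (by linarith)
  have hnb : Ioo (t/2) T ∈ 𝓝 t := Ioo_mem_nhds (by linarith) htT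
  have hinteg : ∀ τ ∈ Ioo (t/2) T, Integrable (fun w => kap x τ w * u w) := fun τ hτ =>
    kap_mul_integrable x (by linarith [hτ.1]) (hu.mono_set (closedBall_subset_closedBall hτ.2.le))
  have key := hasDerivAt_integral_of_dominated_loc_of_deriv_le (μ := volume)
    (F := fun τ w => kap x τ w * u w) (F' := fun τ w => kapd x τ w * u w) (x₀ := t)
    (s := Ioo (t/2) T) (bound := (closedBall x T).indicator (fun w => C * |u w|)) hnb ?_ ?_ ?_ ?_ ?_ ?_
  · exact key.2
  · filter_upwards [hnb] with τ hτ using (hinteg τ hτ).1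
  · exact hinteg t (mem_of_mem_nhds hnb)
  · have : (fun w => kapd x t w * u w) =
      (closedBall x T).indicator (fun w => kapd x t w * u w) := by
      funext w
      by_cases h : w ∈ closedBall x T
      · rw [indicator_of_mem h]
      · rw [indicator_of_notMem h, kapd_zero ht (htT.trans (by simpa using h)), zero_mul]
    rw [this]
    exact ((integrable_indicator_iff measurableSet_closedBall).2
      (hu.continuousOn_mul (kapd_cont x t).continuousOn (isCompact_closedBall x T))).1
  · refine Eventually.of_forall fun w τ hτ => ?_
    rw [norm_mul, Real.norm_eq_abs, Real.norm_eq_abs]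
    by_cases h : w ∈ closedBall x T
    · rw [indicator_of_mem h]
      gcongr; exact hb τ hτ w
    · rw [indicator_of_notMem h, kapd_zero (by linarith [hτ.1]) (hτ.2.trans (by simpa using h))]
      simp
  · rw [integrable_indicator_iff measurableSet_closedBall]
    exact (hu.abs).const_mul C
  · refine Eventually.of_forall fun w τ hτ => ?_
    exact (kap_hasDerivAt x w (by linarith [hτ.1])).mul_const _


lemma Av_tendsto {x : ES N} {T : ℝ} (hT : 0 < T) {u : ES N → ℝ}
    (hu : ContinuousOn u (closedBall x T)) :
    Tendsto (fun t => Av u x t) (𝓝[>] 0) (𝓝 (u x)) := by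
  have hi : IntegrableOn u (closedBall x T) := hu.integrableOn_compact (isCompact_closedBall x T)
  rw [Metric.tendsto_nhds]
  intro ε hε
  have hc : ContinuousAt u x := hu.continuousAt (closedBall_mem_nhds x hT)
  obtain ⟨d, hd, hdd⟩ := Metric.continuousAt_iff.1 hc (ε/2) (by linarith)
  have hm : Ioo 0 (min d T) ∈ 𝓝[>] (0:ℝ) := Ioo_mem_nhdsGT (by positivity)
  filter_upwards [hm] with t ht
  have ht0 : 0 < t := ht.1
  have htd : t < d := ht.2.trans_le (min_le_left _ _)
  have htT : t < T := ht.2.trans_le (min_le_right _ _)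
  have hit := hi.mono_set (closedBall_subset_closedBall (x := x) htT.le)
  have hcst : ∀ c : ℝ, IntegrableOn (fun _ : ES N => c) (closedBall x t) := fun c =>
    integrableOn_const (measure_closedBall_lt_top.ne)
  have h1 : Av u x t ≤ u x + ε/2 := by
    rw [← Av_const (x := x) ht0 (u x + ε/2)]
    refine Av_mono ht0 hit (hcst _) fun w hw => ?_
    have := hdd ((mem_closedBall.1 hw).trans_lt htd)
    rw [Real.dist_eq, abs_lt] at this; linarith
  have h2 : u x - ε/2 ≤ Av u x t := by
    rw [← Av_const (x := x) ht0 (u x - ε/2)]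
    refine Av_mono ht0 (hcst _) hit fun w hw => ?_
    have := hdd ((mem_closedBall.1 hw).trans_lt htd)
    rw [Real.dist_eq, abs_lt] at this; linarith
  rw [Real.dist_eq, abs_lt]; constructor <;> linarith

lemma mt_mul_integrable (x : ES N) {t : ℝ} (ht : 0 < t) {u : ES N → ℝ}
    (hu : IntegrableOn u (closedBall x t)) : Integrable (fun w => u w * mt x t w) := by
  have : (fun w => u w * mt x t w) = (closedBall x t).indicator (fun w => u w * mt x t w) := by
    funext w
    by_cases h : w ∈ closedBall x t
    · rw [indicator_of_mem h]
    · rw [indicator_of_notMem h, mt_zero ht (by simpa using (not_le.1 h).le), mul_zero]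
  rw [this, integrable_indicator_iff measurableSet_closedBall]
  exact hu.mul_continuousOn ((mt_testfun (Ω := univ) x ht (subset_univ _)).1.continuous).continuousOn
    (isCompact_closedBall x t)

lemma Av_hasDerivAt_LV {Ω : Set (ES N)} {V u : ES N → ℝ} (h : LVHarmonic Ω V u) {x : ES N} {t T : ℝ}
    (hT : closedBall x T ⊆ Ω) (ht : 0 < t) (htT : t < T) :
    HasDerivAt (fun t => Av u x t) (t * ∫ w, V w * u w * mt x t w) t := by
  have hi : IntegrableOn u (closedBall x T) :=
    (h.1.mono hT).integrableOn_compact (isCompact_closedBall x T)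
  have hd := Av_hasDerivAt hi ht htT
  refine hd.congr_deriv ?_
  have hsub : closedBall x t ⊆ Ω := (closedBall_subset_closedBall htT.le).trans hT
  have hw := h.2.2.2 (mt x t) (mt_testfun x ht hsub)
  have e1 : ∫ w in Ω, V w * u w * mt x t w = ∫ w, V w * u w * mt x t w := by
    refine setIntegral_eq_integral_of_forall_compl_eq_zero fun w hw => ?_
    rw [mt_zero ht, mul_zero]
    by_contra hc
    exact hw (hsub (by simpa using (not_le.1 hc).le))
  have e2 : ∫ w in Ω, u w * lap (mt x t) w = ∫ w, u w * lap (mt x t) w := by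
    refine setIntegral_eq_integral_of_forall_compl_eq_zero fun w hw => ?_
    have : lap (mt x t) w = 0 := by
      have h1 := lap_mt x w ht
      rw [kapd_zero ht] at h1
      · exact (mul_eq_zero.1 h1).resolve_left ht.ne'
      · by_contra hc
        exact hw (hsub (by simpa using (not_lt.1 hc)))
    rw [this, mul_zero]
  rw [← e1, ← hw, e2, ← integral_const_mul]
  congr 1; funext w
  rw [← lap_mt x w ht]; ring

lemma Av_eq_of_harmonic {Ω : Set (ES N)} {u : ES N → ℝ} (h : LVHarmonic Ω (fun _ => 0) u)
    {x : ES N} {t T : ℝ} (hT : closedBall x T ⊆ Ω) (ht : 0 < t) (htT : t < T) :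
    Av u x t = u x := by
  have hd : ∀ s ∈ Ioo 0 T, HasDerivAt (fun t => Av u x t) 0 s := by
    intro s hs
    have := Av_hasDerivAt_LV h hT hs.1 hs.2
    simpa using this
  have hconst : ∀ s ∈ Ioo 0 T, Av u x s = Av u x t := by
    intro s hs
    refine isOpen_Ioo.is_const_of_deriv_eq_zero isPreconnected_Ioo
      (f := fun t => Av u x t) (s := Ioo 0 T)
      (fun s hs => (hd s hs).differentiableAt.differentiableWithinAt)
      (fun s hs => (hd s hs).deriv) hs ⟨ht, htT⟩
  have h1 := Av_tendsto (ht.trans htT) (h.1.mono hT)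
  have h2 : Tendsto (fun t => Av u x t) (𝓝[>] 0) (𝓝 (Av u x t)) := by
    refine tendsto_const_nhds.congr' ?_
    filter_upwards [Ioo_mem_nhdsGT (ht.trans htT)] with s hs using (hconst s hs).symm
  exact tendsto_nhds_unique h2 h1

lemma Av_ge_of_LV {Ω : Set (ES N)} {V u : ES N → ℝ} (h : LVHarmonic Ω V u)
    (hV : ∀ x ∈ Ω, 0 ≤ V x) (hu : ∀ x ∈ Ω, 0 ≤ u x)
    {x : ES N} {t T : ℝ} (hT : closedBall x T ⊆ Ω) (ht : 0 < t) (htT : t < T) :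
    u x ≤ Av u x t := by
  have hd : ∀ s ∈ Ioo 0 T, HasDerivAt (fun t => Av u x t) (s * ∫ w, V w * u w * mt x s w) s := by
    intro s hs
    exact Av_hasDerivAt_LV h hT hs.1 hs.2
  have hm : MonotoneOn (fun t => Av u x t) (Ioo 0 T) := by
    refine monotoneOn_of_deriv_nonneg (convex_Ioo 0 T)
      (fun s hs => (hd s hs).continuousAt.continuousWithinAt)
      (fun s hs => ?_) (fun s hs => ?_)
    · rw [interior_Ioo] at hs
      exact (hd s hs).differentiableAt.differentiableWithinAt
    · rw [interior_Ioo] at hs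
      rw [(hd s hs).deriv]
      refine mul_nonneg hs.1.le (integral_nonneg fun w => ?_)
      by_cases hw : w ∈ Ω
      · exact mul_nonneg (mul_nonneg (hV w hw) (hu w hw)) (mt_nonneg hs.1.le w)
      · simp only [Pi.zero_apply]
        rw [mt_zero hs.1, mul_zero]
        by_contra hc
        exact hw (hT (mem_closedBall.2 ((not_le.1 hc).le.trans hs.2.le)))
  have h1 := Av_tendsto (ht.trans htT) (h.1.mono hT)
  refine le_of_tendsto h1 ?_
  filter_upwards [Ioo_mem_nhdsGT ht] with s hs
  exact hm ⟨hs.1, hs.2.trans htT⟩ ⟨ht, htT⟩ hs.2.le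

def cm (N : ℕ) : ℝ := ∫ w : ES N, mt 0 1 w
lemma cm_nonneg : 0 ≤ cm N := integral_nonneg fun w => mt_nonneg zero_le_one w
lemma mt_integral (x : ES N) {t : ℝ} (ht : 0 < t) : ∫ w, mt x t w = cm N := by
  unfold cm
  rw [← integral_scale (mt 0 1) x ht]
  congr 1; funext w
  unfold mt
  have : ‖t⁻¹ • (w - x) - 0‖^2 / 1^2 = ‖w - x‖^2 / t^2 := by
    rw [sub_zero, norm_smul, norm_inv, Real.norm_of_nonneg ht.le]; field_simp
  rw [this]; ring

lemma Av_le_of_LV {Ω : Set (ES N)} {V u : ES N → ℝ} (h : LVHarmonic Ω V u)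
    {x : ES N} {t T S : ℝ} (hS : ∀ w ∈ closedBall x T, V w * u w ≤ S)
    (hT : closedBall x T ⊆ Ω) (ht : 0 < t) (htT : t < T) :
    Av u x t ≤ u x + cm N * S * t^2 / 2 := by
  have hd : ∀ s ∈ Ioo 0 T, HasDerivAt (fun t => Av u x t - cm N * S * t^2 / 2)
      (s * (∫ w, V w * u w * mt x s w) - cm N * S * s) s := by
    intro s hs
    have h2 : HasDerivAt (fun t : ℝ => cm N * S * t^2 / 2) (cm N * S * s) s := by
      have := (((hasDerivAt_pow 2 s).const_mul (cm N * S)).div_const 2)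
      refine this.congr_deriv ?_
      norm_num; ring
    exact (Av_hasDerivAt_LV h hT hs.1 hs.2).sub h2
  have hm : AntitoneOn (fun t => Av u x t - cm N * S * t^2 / 2) (Ioo 0 T) := by
    refine antitoneOn_of_deriv_nonpos (convex_Ioo 0 T)
      (fun s hs => (hd s hs).continuousAt.continuousWithinAt)
      (fun s hs => ?_) (fun s hs => ?_)
    · rw [interior_Ioo] at hs
      exact (hd s hs).differentiableAt.differentiableWithinAt
    · rw [interior_Ioo] at hs
      rw [(hd s hs).deriv]
      have hsub := closedBall_subset_closedBall (x := x) hs.2.le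
      have hVu : IntegrableOn (fun w => V w * u w) (closedBall x s) :=
        (h.2.2.1.integrableOn_compact_subset (hsub.trans hT) (isCompact_closedBall x s))
      have e : ∫ w, V w * u w * mt x s w ≤ ∫ w, S * mt x s w := by
        refine integral_mono (mt_mul_integrable x hs.1 hVu)
          (mt_mul_integrable (u := fun _ => S) x hs.1
            (integrableOn_const (measure_closedBall_lt_top.ne))) ?_
        intro w
        by_cases hw : w ∈ closedBall x s
        · exact mul_le_mul_of_nonneg_right (hS w (hsub hw)) (mt_nonneg hs.1.le w)
        · simp only
          rw [mt_zero hs.1 (by simpa using (not_le.1 hw).le)]; simp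
      rw [integral_const_mul, mt_integral x hs.1] at e
      have := mul_le_mul_of_nonneg_left e hs.1.le
      linarith
  have h1 : Tendsto (fun t => Av u x t - cm N * S * t^2 / 2) (𝓝[>] 0) (𝓝 (u x - cm N * S * 0^2/2)) := by
    refine (Av_tendsto (ht.trans htT) (h.1.mono hT)).sub ?_
    have : Continuous fun t : ℝ => cm N * S * t^2 / 2 := by fun_prop
    exact this.continuousAt.tendsto.mono_left nhdsWithin_le_nhds
  have : Av u x t - cm N * S * t^2 / 2 ≤ u x - cm N * S * 0^2/2 := by
    refine ge_of_tendsto h1 ?_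
    filter_upwards [Ioo_mem_nhdsGT ht] with s hs
    exact hm ⟨hs.1, hs.2.trans htT⟩ ⟨ht, htT⟩ hs.2.le
  linarith

end

section

variable {N : ℕ}

lemma contDiff_dir {g : ES N → ℝ} (hg : ContDiff ℝ (⊤:ℕ∞) g) (v : ES N) :
    ContDiff ℝ (⊤:ℕ∞) (fun y => fderiv ℝ g y v) := by
  have := hg.fderiv_right (m := (⊤:ℕ∞)) (by simp)
  exact this.clm_apply contDiff_const

lemma hcs_dir {g : ES N → ℝ} (hg : HasCompactSupport g) (v : ES N) :
    HasCompactSupport (fun y => fderiv ℝ g y v) := hg.fderiv_apply ℝ v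

lemma ibp {g φ : ES N → ℝ} (hg : ContDiff ℝ (⊤:ℕ∞) g) (hφ : ContDiff ℝ (⊤:ℕ∞) φ)
    (hs : HasCompactSupport φ) : ∫ x, g x * lap φ x = ∫ x, lap g x * φ x := by
  unfold lap
  simp_rw [Finset.mul_sum, Finset.sum_mul]
  have hinteg : ∀ a b : ES N → ℝ, Continuous a → Continuous b → HasCompactSupport b →
      Integrable (fun x => a x * b x) := fun a b ha hb hsb =>
    (ha.mul hb).integrable_of_hasCompactSupport hsb.mul_left
  have hD : ∀ f : ES N → ℝ, ContDiff ℝ (⊤:ℕ∞) f → Differentiable ℝ f := fun f hf =>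
    hf.differentiable (by simp)
  rw [integral_finsetSum, integral_finsetSum]
  · refine Finset.sum_congr rfl fun i _ => ?_
    set v : ES N := EuclideanSpace.single i 1
    have g1 := contDiff_dir hg v
    have g2 := contDiff_dir g1 v
    have p1 := contDiff_dir hφ v
    have p2 := contDiff_dir p1 v
    have s1 := hcs_dir hs v
    have s2 := hcs_dir s1 v
    rw [integral_mul_fderiv_eq_neg_fderiv_mul_of_integrable (f := g)
      (g := fun y => fderiv ℝ φ y v) (v := v)
      (hinteg _ _ g1.continuous p1.continuous s1)
      (hinteg _ _ hg.continuous p2.continuous s2)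
      (hinteg _ _ hg.continuous p1.continuous s1) (fun x _ => hD _ hg x) (fun x _ => hD _ p1 x)]
    rw [integral_mul_fderiv_eq_neg_fderiv_mul_of_integrable (f := fun y => fderiv ℝ g y v)
      (g := φ) (v := v)
      (hinteg _ _ g2.continuous hφ.continuous hs)
      (hinteg _ _ g1.continuous p1.continuous s1)
      (hinteg _ _ g1.continuous hφ.continuous hs) (fun x _ => hD _ g1 x) (fun x _ => hD _ hφ x)]
    rw [neg_neg]
  · intro i _
    exact hinteg _ _ (contDiff_dir (contDiff_dir hg _) _).continuous hφ.continuous hs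
  · intro i _
    exact hinteg _ _ hg.continuous (contDiff_dir (contDiff_dir hφ _) _).continuous
      (hcs_dir (hcs_dir hs _) _)

lemma lap_cont {g : ES N → ℝ} (hg : ContDiff ℝ (⊤:ℕ∞) g) : Continuous (lap g) := by
  unfold lap
  exact continuous_finsetSum _ fun i _ => (contDiff_dir (contDiff_dir hg _) _).continuous

lemma lap_zero_of_notMem_tsupport {φ : ES N → ℝ} {x : ES N} (h : x ∉ tsupport φ) :
    lap φ x = 0 := by
  unfold lap
  refine Finset.sum_eq_zero fun i _ => ?_
  have h1 : (fun y => fderiv ℝ φ y (EuclideanSpace.single i 1)) =ᶠ[𝓝 x] fun _ => 0 := by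
    have : (tsupport φ)ᶜ ∈ 𝓝 x := (isClosed_tsupport φ).isOpen_compl.mem_nhds h
    filter_upwards [this] with y hy
    have h2 : φ =ᶠ[𝓝 y] fun _ => 0 := by
      filter_upwards [(isClosed_tsupport φ).isOpen_compl.mem_nhds hy] with z hz
      exact image_eq_zero_of_notMem_tsupport hz
    rw [h2.fderiv_eq]; simp
  rw [h1.fderiv_eq]; simp

/-- smooth positive function with `0 ≤ lap g` near `x` : sub-mean value inequality. -/
lemma Av_ge_of_lap_nonneg {g : ES N → ℝ} (hg : ContDiff ℝ (⊤:ℕ∞) g) (hpos : ∀ x, 0 < g x)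
    {x : ES N} {t T : ℝ} (hl : ∀ w ∈ closedBall x T, 0 ≤ lap g w) (ht : 0 < t) (htT : t < T) :
    g x ≤ Av g x t := by
  have hE : (fun w => lap g w / g w * g w) = lap g := by
    funext w; rw [div_mul_cancel₀ _ (hpos w).ne']
  have hLV : LVHarmonic (ball x T) (fun w => lap g w / g w) g := by
    refine ⟨hg.continuous.continuousOn, (hg.continuous.locallyIntegrable).locallyIntegrableOn _,
      ?_, ?_⟩
    · simp only [hE]; exact ((lap_cont hg).locallyIntegrable).locallyIntegrableOn _
    · intro φ hφ
      have e1 : ∫ w in ball x T, g w * lap φ w = ∫ w, g w * lap φ w := by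
        refine setIntegral_eq_integral_of_forall_compl_eq_zero fun w hw => ?_
        rw [lap_zero_of_notMem_tsupport (fun h => hw (hφ.2.2 h)), mul_zero]
      have e2 : ∫ w in ball x T, lap g w / g w * g w * φ w = ∫ w, lap g w * φ w := by
        rw [← setIntegral_eq_integral_of_forall_compl_eq_zero (s := ball x T) (f := fun w => lap g w * φ w)]
        · refine integral_congr_ae (Eventually.of_forall fun w => ?_)
          simp only
          rw [div_mul_cancel₀ _ (hpos w).ne']
        · intro w hw
          rw [image_eq_zero_of_notMem_tsupport (fun h => hw (hφ.2.2 h)), mul_zero]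
      rw [e1, e2]
      exact ibp hg hφ.1 hφ.2.1
  obtain ⟨T', h1, h2⟩ := exists_between htT
  exact Av_ge_of_LV hLV (fun w hw => div_nonneg (hl w (ball_subset_closedBall hw)) (hpos w).le)
    (fun w _ => (hpos w).le) (closedBall_subset_ball h2) ht h1

/-- Gaussian sub-mean value inequality -/
lemma gauss_sub {y x : ES N} {lam t T : ℝ} (hlam : 0 < lam) (ht : 0 < t) (htT : t < T)
    (hfar : ∀ w ∈ closedBall x T, (N:ℝ) ≤ 2 * lam * ‖w - y‖^2) :
    Real.exp (-lam * ‖x - y‖^2) ≤ Av (fun w => Real.exp (-lam * ‖w - y‖^2)) x t := by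
  have h : ∀ s : ℝ, HasDerivAt (fun s => Real.exp (-lam * s)) (-lam * Real.exp (-lam * s)) s := by
    intro s
    have := ((hasDerivAt_id s).const_mul (-lam)).exp
    refine this.congr_deriv ?_
    simp; ring
  have h' : ∀ s : ℝ, HasDerivAt (fun s => -lam * Real.exp (-lam * s))
      (-lam * (-lam * Real.exp (-lam * s))) s := fun s => (h s).const_mul _
  refine Av_ge_of_lap_nonneg (g := fun w => Real.exp (-lam * ‖w - y‖^2)) ?_ (fun w => Real.exp_pos _)
    (T := T) ?_ ht htT
  · refine Real.contDiff_exp.comp ?_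
    exact contDiff_const.mul ((contDiff_id.sub contDiff_const).norm_sq ℝ)
  · intro w hw
    rw [lap_radial (Φ := fun s => Real.exp (-lam * s)) h h' y w]
    have e := Real.exp_pos (-lam * ‖w - y‖^2)
    have := hfar w hw
    have h3 : 0 ≤ 2 * lam * Real.exp (-lam * ‖w - y‖^2) * (2 * lam * ‖w - y‖^2 - N) :=
      mul_nonneg (by positivity) (by linarith)
    nlinarith

end

section

variable {N : ℕ} {Ω : Set (ES N)}

structure Dom (Ω : Set (ES N)) : Prop where
  op : IsOpen Ω
  conn : IsConnected Ω
  bd : Bornology.IsBounded Ω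
  cne : Ωᶜ.Nonempty

def AA (Ω : Set (ES N)) (u : ES N → ℝ) (x : ES N) : ℝ := Av u x (dista Ω x / 2)

lemma dista_nonneg (x : ES N) : 0 ≤ dista Ω x := infDist_nonneg
lemma dista_lip (x x' : ES N) : dista Ω x ≤ dista Ω x' + dist x x' := infDist_le_infDist_add_dist
lemma dista_lip' (x x' : ES N) : dista Ω x ≤ dista Ω x' + dist x' x := by
  rw [dist_comm]; exact dista_lip x x'
lemma dista_abs (x x' : ES N) : |dista Ω x - dista Ω x'| ≤ dist x x' := by
  rw [abs_le]; constructor <;> linarith [dista_lip (Ω := Ω) x x', dista_lip' (Ω := Ω) x' x]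
lemma dista_cont : Continuous (dista Ω) := continuous_infDist_pt _
lemma Dom.dpos (hD : Dom Ω) {x : ES N} (hx : x ∈ Ω) : 0 < dista Ω x := by
  refine (hD.op.isClosed_compl.notMem_iff_infDist_pos hD.cne).1 ?_
  simpa using hx
lemma dista_zero {x : ES N} (hx : x ∉ Ω) : dista Ω x = 0 := infDist_zero_of_mem hx
lemma mem_of_dista {x : ES N} (hx : 0 < dista Ω x) : x ∈ Ω := by
  by_contra h; rw [dista_zero h] at hx; exact lt_irrefl _ hx
lemma mem_of_dist_lt {x w : ES N} (h : dist w x < dista Ω x) : w ∈ Ω := by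
  apply mem_of_dista
  linarith [dista_lip' (Ω := Ω) x w]
lemma cball_sub {x : ES N} {t : ℝ} (h : t < dista Ω x) : closedBall x t ⊆ Ω := fun _ hw =>
  mem_of_dist_lt ((mem_closedBall.1 hw).trans_lt h)
lemma Dom.half_sub (hD : Dom Ω) {x : ES N} (hx : x ∈ Ω) : closedBall x (dista Ω x / 2) ⊆ Ω :=
  cball_sub (by linarith [hD.dpos hx])
lemma Dom.exists_near (hD : Dom Ω) (x : ES N) : ∃ p ∉ Ω, dist x p = dista Ω x := by
  obtain ⟨p, hp, h⟩ := hD.op.isClosed_compl.exists_infDist_eq_dist hD.cne x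
  exact ⟨p, hp, h.symm⟩

/-- locally bounded, locally integrable -/
def LB (Ω : Set (ES N)) (f : ES N → ℝ) : Prop :=
  ∀ S ⊆ Ω, IsCompact S → IntegrableOn f S ∧ ∃ C, ∀ x ∈ S, |f x| ≤ C

lemma LB.of_cont {f : ES N → ℝ} (hf : ContinuousOn f Ω) : LB Ω f := by
  intro S hS hc
  refine ⟨(hf.mono hS).integrableOn_compact hc, ?_⟩
  obtain ⟨C, hC⟩ := hc.exists_bound_of_continuousOn (hf.mono hS)
  exact ⟨C, hC⟩

lemma LB.int {f : ES N → ℝ} (hf : LB Ω f) {x : ES N} {t : ℝ} (h : t < dista Ω x) :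
    IntegrableOn f (closedBall x t) := (hf _ (cball_sub h) (isCompact_closedBall x t)).1

lemma LB.inth (hD : Dom Ω) {f : ES N → ℝ} (hf : LB Ω f) {x : ES N} (hx : x ∈ Ω) :
    IntegrableOn f (closedBall x (dista Ω x / 2)) := hf.int (by linarith [hD.dpos hx])

lemma AA_mono (hD : Dom Ω) {u v : ES N → ℝ} (hu : LB Ω u) (hv : LB Ω v) {x : ES N} (hx : x ∈ Ω)
    (h : ∀ w ∈ closedBall x (dista Ω x / 2), u w ≤ v w) : AA Ω u x ≤ AA Ω v x :=
  Av_mono (by linarith [hD.dpos hx]) (hu.inth hD hx) (hv.inth hD hx) h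

lemma AA_add (hD : Dom Ω) {u v : ES N → ℝ} (hu : LB Ω u) (hv : LB Ω v) {x : ES N} (hx : x ∈ Ω) :
    AA Ω (fun w => u w + v w) x = AA Ω u x + AA Ω v x :=
  Av_add (by linarith [hD.dpos hx]) (hu.inth hD hx) (hv.inth hD hx)

lemma AA_sub (hD : Dom Ω) {u v : ES N → ℝ} (hu : LB Ω u) (hv : LB Ω v) {x : ES N} (hx : x ∈ Ω) :
    AA Ω (fun w => u w - v w) x = AA Ω u x - AA Ω v x :=
  Av_sub (by linarith [hD.dpos hx]) (hu.inth hD hx) (hv.inth hD hx)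

lemma AA_smul (c : ℝ) (u : ES N → ℝ) (x : ES N) : AA Ω (fun w => c * u w) x = c * AA Ω u x :=
  Av_smul c u

lemma AA_const (hD : Dom Ω) {x : ES N} (hx : x ∈ Ω) (c : ℝ) : AA Ω (fun _ => c) x = c :=
  Av_const (by linarith [hD.dpos hx]) c

lemma AA_congr (hD : Dom Ω) {u v : ES N → ℝ} {x : ES N} (hx : x ∈ Ω)
    (h : ∀ w ∈ closedBall x (dista Ω x / 2), u w = v w) : AA Ω u x = AA Ω v x :=
  Av_congr (by linarith [hD.dpos hx]) h

lemma AA_nonneg (hD : Dom Ω) {u : ES N → ℝ} (hu : ∀ x ∈ Ω, 0 ≤ u x) {x : ES N} (hx : x ∈ Ω) :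
    0 ≤ AA Ω u x := by
  have hd : 0 < dista Ω x / 2 := by linarith [hD.dpos hx]
  refine integral_nonneg fun w => ?_
  by_cases hw : w ∈ closedBall x (dista Ω x / 2)
  · exact mul_nonneg (kap_nonneg hd.le w) (hu w (hD.half_sub hx hw))
  · simp only [Pi.zero_apply]; rw [kap_zero hd (by simpa using (not_le.1 hw).le)]; simp

lemma Av_diff {x x' y : ES N} {t t' R C : ℝ} (ht : 0 < t) (ht' : 0 < t') {f : ES N → ℝ}
    (hf : IntegrableOn f (closedBall y R)) (hC : ∀ w ∈ closedBall y R, |f w| ≤ C)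
    (h1 : closedBall x t ⊆ closedBall y R) (h2 : closedBall x' t' ⊆ closedBall y R) :
    |Av f x t - Av f x' t'| ≤ C * ∫ w, |kap x t w - kap x' t' w| := by
  unfold Av
  rw [← integral_sub (kap_mul_integrable x ht (hf.mono_set h1))
    (kap_mul_integrable x' ht' (hf.mono_set h2)), ← integral_const_mul]
  refine (abs_integral_le_integral_abs).trans ?_
  refine integral_mono_of_nonneg (Eventually.of_forall fun w => abs_nonneg _) ?_
    (Eventually.of_forall fun w => ?_)
  · exact (((kap_integrable x ht).sub (kap_integrable x' ht')).abs).const_mul C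
  · simp only
    rw [← sub_mul, abs_mul, mul_comm]
    by_cases hw : w ∈ closedBall y R
    · exact mul_le_mul_of_nonneg_right (hC w hw) (abs_nonneg _)
    · rw [kap_zero ht, kap_zero ht']
      · simp
      · by_contra hc; exact hw (h2 (by simpa using (not_le.1 hc).le))
      · by_contra hc; exact hw (h1 (by simpa using (not_le.1 hc).le))

lemma AA_modulus (N : ℕ) {ε : ℝ} (hε : 0 < ε) : ∃ η : ℝ, 0 < η ∧ η < 1/8 ∧
    ∀ (Ω : Set (ES N)) (x x' : ES N) (f : ES N → ℝ) (C : ℝ), 0 < dista Ω x →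
      dist x x' ≤ η * dista Ω x → IntegrableOn f (closedBall x (3/4 * dista Ω x)) →
      (∀ w ∈ closedBall x (3/4 * dista Ω x), |f w| ≤ C) →
      |AA Ω f x - AA Ω f x'| ≤ ε * C := by
  obtain ⟨η, h0, h1, h⟩ := kap_modulus N hε
  refine ⟨η/2, by linarith, by linarith, ?_⟩
  intro Ω x x' f C hd hx hf hC
  have hC0 : 0 ≤ C := (abs_nonneg _).trans (hC x (mem_closedBall_self (by linarith)))
  have hl := dista_abs (Ω := Ω) x x'
  have hdx' : 7/8 * dista Ω x ≤ dista Ω x' := by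
    rw [abs_le] at hl; nlinarith
  have hdx2 : dista Ω x' ≤ 9/8 * dista Ω x := by
    rw [abs_le] at hl; nlinarith
  have := Av_diff (x := x) (x' := x') (t := dista Ω x / 2) (t' := dista Ω x' / 2)
    (by linarith) (by linarith) hf hC (closedBall_subset_closedBall (by linarith))
    (closedBall_subset_closedBall' (by rw [dist_comm]; nlinarith))
  refine this.trans ?_
  rw [mul_comm]
  gcongr
  refine h x x' _ _ (by linarith) (by linarith) ?_
  rw [← sub_div, abs_div, abs_two]
  nlinarith [mul_pos h0 hd]

lemma AA_cont (hD : Dom Ω) {f : ES N → ℝ} (hf : LB Ω f) : ContinuousOn (AA Ω f) Ω := by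
  intro x hx
  have hd := hD.dpos hx
  obtain ⟨hi, C, hC⟩ := hf (closedBall x (3/4 * dista Ω x)) (cball_sub (by linarith))
    (isCompact_closedBall _ _)
  refine ContinuousAt.continuousWithinAt ?_
  rw [Metric.continuousAt_iff]
  intro ε hε
  have hC0 : 0 ≤ C := (abs_nonneg _).trans (hC x (mem_closedBall_self (by linarith)))
  obtain ⟨η, h0, h1, h⟩ := AA_modulus N (ε := ε / (C+1)) (by positivity)
  refine ⟨η * dista Ω x, by positivity, fun {x'} hx' => ?_⟩
  have := h Ω x x' f C hd (by rw [dist_comm]; exact hx'.le) hi hC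
  rw [dist_comm, Real.dist_eq]
  refine this.trans_lt ?_
  rw [div_mul_eq_mul_div, div_lt_iff₀ (by positivity)]
  nlinarith

lemma AA_LB (hD : Dom Ω) {f : ES N → ℝ} (hf : LB Ω f) : LB Ω (AA Ω f) := LB.of_cont (AA_cont hD hf)

/-- strict part of the maximum principle -/
lemma eq_of_AA_max (hD : Dom Ω) {g : ES N → ℝ} (hg : ContinuousOn g Ω) {x : ES N} (hx : x ∈ Ω)
    {M : ℝ} (hM : ∀ w ∈ ball x (dista Ω x / 2), g w ≤ M) (hA : M ≤ AA Ω g x) :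
    ∀ w ∈ ball x (dista Ω x / 2), g w = M := by
  have hd := hD.dpos hx
  have ht : 0 < dista Ω x / 2 := by linarith
  set t := dista Ω x / 2
  have hgi : IntegrableOn g (closedBall x t) := (LB.of_cont hg).inth hD hx
  have hci : IntegrableOn (fun _ : ES N => M) (closedBall x t) :=
    integrableOn_const (measure_closedBall_lt_top.ne)
  have hnn : ∀ w, 0 ≤ kap x t w * (M - g w) := by
    intro w
    rcases lt_or_ge (dist w x) t with h | h
    · exact mul_nonneg (kap_nonneg ht.le w) (by linarith [hM w h])
    · rw [kap_zero ht h]; simp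
  have hinteg : Integrable (fun w => kap x t w * (M - g w)) :=
    kap_mul_integrable x ht (hci.sub hgi)
  have h0 : ∫ w, kap x t w * (M - g w) = 0 := by
    refine le_antisymm ?_ (integral_nonneg hnn)
    have := Av_sub (x := x) ht hci hgi
    rw [Av_const ht] at this
    unfold Av at this
    rw [this]
    unfold AA Av at hA
    linarith
  have hae := (integral_eq_zero_iff_of_nonneg hnn hinteg).1 h0
  have hsub : ball x t ⊆ Ω := ball_subset_closedBall.trans (hD.half_sub hx)
  have hE : EqOn (fun w => kap x t w * (M - g w)) (fun _ => 0) (ball x t) := by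
    refine Measure.eqOn_open_of_ae_eq (μ := volume) ?_ isOpen_ball ?_ continuousOn_const
    · exact ae_restrict_of_ae hae
    · exact (kap_cont x t).continuousOn.mul (continuousOn_const.sub (hg.mono hsub))
  intro w hw
  have h1 := hE hw
  simp only at h1
  have hk : 0 < kap x t w := by
    unfold kap
    have := ck_pos (N := N)
    have hk := kf_pos (s := ‖w - x‖^2 / t^2) (by
      rw [div_lt_one (by positivity)]
      rw [mem_ball, dist_eq_norm] at hw
      gcongr)
    positivity
  have := (mul_eq_zero.1 h1).resolve_left hk.ne'
  linarith

theorem maxPrinciple (hD : Dom Ω) {g : ES N → ℝ} (hg : ContinuousOn g Ω) {D : Set (ES N)}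
    (hDΩ : D ⊆ Ω) (hsub : ∀ x ∈ D, g x ≤ AA Ω g x)
    (hjump : ∀ x ∈ D, ∀ w ∈ closedBall x (dista Ω x / 2), w ∉ D → g w ≤ 0)
    (hbdry : ∀ y ∈ frontier Ω, ∀ ε > 0, ∀ᶠ x in 𝓝[D] y, g x < ε) :
    ∀ x ∈ D, g x ≤ 0 := by
  intro x1 hx1
  by_contra hpos
  push Not at hpos
  set m0 := g x1
  set S := {x | x ∈ D ∧ m0 ≤ g x} with hS
  have hSD : S ⊆ D := fun x hx => hx.1
  have hclΩ : closure S ⊆ Ω := by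
    intro y hy
    by_contra hyΩ
    have hyf : y ∈ frontier Ω := by
      rw [hD.op.frontier_eq]
      exact ⟨closure_mono (hSD.trans hDΩ) hy, hyΩ⟩
    have h1 := hbdry y hyf m0 hpos
    rw [eventually_nhdsWithin_iff] at h1
    obtain ⟨z, hz, hzS⟩ := mem_closure_iff_nhds.1 hy _ h1
    exact absurd (hz hzS.1) (not_lt.2 hzS.2)
  have hcomp : IsCompact (closure S) := (hD.bd.subset (hSD.trans hDΩ)).isCompact_closure
  have hAc := AA_cont hD (LB.of_cont hg)
  have hcl1 : ∀ x ∈ closure S, g x ≤ AA Ω g x := by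
    intro x hx
    refine closure_minimal (s := S) (t := {x | x ∈ closure S ∧ g x ≤ AA Ω g x}) ?_ ?_ hx |>.2
    · intro z hz; exact ⟨subset_closure hz, hsub z hz.1⟩
    · exact isClosed_closure.isClosed_le (hg.mono hclΩ) (hAc.mono hclΩ)
  have hcl2 : ∀ x ∈ closure S, ∀ w ∈ ball x (dista Ω x / 2), w ∉ D → g w ≤ 0 := by
    intro x hx w hw hwD
    have hev : ∀ᶠ z in 𝓝 x, dist w z < dista Ω z / 2 := by
      refine ContinuousAt.eventually_lt (by fun_prop) (dista_cont.continuousAt.div_const 2) hw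
    obtain ⟨z, hz, hzS⟩ := mem_closure_iff_nhds.1 hx _ hev
    exact hjump z hzS.1 w (mem_closedBall.2 (le_of_lt hz)) hwD
  obtain ⟨xs, hxs, hmax⟩ := hcomp.exists_isMaxOn ⟨x1, subset_closure ⟨hx1, le_rfl⟩⟩ (hg.mono hclΩ)
  have hM0 : m0 ≤ g xs := hmax (subset_closure ⟨hx1, le_rfl⟩)
  set M := g xs
  set T := {x | x ∈ closure S ∧ g x = M}
  have hTc : IsCompact T := by
    refine hcomp.of_isClosed_subset ?_ (fun x hx => hx.1)
    have : T = closure S ∩ g ⁻¹' {M} := by ext; simp [T]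
    rw [this]
    exact (hg.mono hclΩ).preimage_isClosed_of_isClosed isClosed_closure isClosed_singleton
  obtain ⟨x, hxT, hmin⟩ := hTc.exists_isMinOn ⟨xs, hxs, rfl⟩ (dista_cont (Ω := Ω)).continuousOn
  have hxΩ := hclΩ hxT.1
  have hd := hD.dpos hxΩ
  have hball : ∀ w ∈ ball x (dista Ω x / 2), g w ≤ M := by
    intro w hw
    by_cases hwD : w ∈ D
    · rcases le_or_gt m0 (g w) with h | h
      · exact hmax (subset_closure ⟨hwD, h⟩)
      · linarith
    · linarith [hcl2 x hxT.1 w hw hwD]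
  have hE := eq_of_AA_max hD hg hxΩ hball (by rw [← hxT.2]; exact hcl1 x hxT.1)
  obtain ⟨p, hp, hpd⟩ := hD.exists_near x
  set x' := x + (1/4 : ℝ) • (p - x)
  have e1 : dist x' x = dista Ω x / 4 := by
    rw [dist_eq_norm, add_sub_cancel_left, norm_smul, ← dist_eq_norm, dist_comm, hpd]
    norm_num; ring
  have e2 : dist x' p = 3/4 * dista Ω x := by
    have : x' - p = (3/4 : ℝ) • (x - p) := by simp only [x']; module
    rw [dist_eq_norm, this, norm_smul, ← dist_eq_norm, hpd]; norm_num
  have hx'b : x' ∈ ball x (dista Ω x / 2) := by rw [mem_ball, e1]; linarith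
  have hgx' := hE x' hx'b
  have hx'D : x' ∈ D := by
    by_contra hc
    linarith [hcl2 x hxT.1 x' hx'b hc]
  have h3 : dista Ω x ≤ dista Ω x' := hmin ⟨subset_closure ⟨hx'D, by linarith⟩, hgx'⟩
  have h4 := dista_lip (Ω := Ω) x' p
  rw [dista_zero hp, e2] at h4
  linarith

end

section

variable {N : ℕ} {Ω : Set (ES N)}

structure Sup (Ω : Set (ES N)) (s : ES N → ℝ) : Prop where
  cont : ContinuousOn s Ω
  nn : ∀ x ∈ Ω, 0 ≤ s x
  le : ∀ x ∈ Ω, AA Ω s x ≤ s x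

structure Harm (Ω : Set (ES N)) (u : ES N → ℝ) : Prop where
  cont : ContinuousOn u Ω
  nn : ∀ x ∈ Ω, 0 ≤ u x
  mv : ∀ x ∈ Ω, ∀ t, 0 < t → t < dista Ω x → Av u x t = u x

lemma Harm.AA_eq (hD : Dom Ω) {u : ES N → ℝ} (hu : Harm Ω u) {x : ES N} (hx : x ∈ Ω) :
    AA Ω u x = u x := by
  have := hD.dpos hx
  exact hu.mv x hx _ (by linarith) (by linarith)

lemma Harm.sup (hD : Dom Ω) {u : ES N → ℝ} (hu : Harm Ω u) : Sup Ω u :=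
  ⟨hu.cont, hu.nn, fun _ hx => (hu.AA_eq hD hx).le⟩

def PP (Ω : Set (ES N)) (s : ES N → ℝ) (x : ES N) (m : ℝ) : Prop :=
  ∀ w, dist w x ≤ dista Ω x / 16 → m ≤ s w

lemma vol_cball (x : ES N) {r : ℝ} (hr : 0 ≤ r) :
    volume.real (closedBall x r) = r^N * volume.real (ball (0 : ES N) 1) := by
  unfold Measure.real
  rw [Measure.addHaar_closedBall volume x hr, ENNReal.toReal_mul, ENNReal.toReal_ofReal (by positivity)]
  simp

lemma vol_ball_pos : 0 < volume.real (ball (0 : ES N) 1) :=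
  ENNReal.toReal_pos (measure_ball_pos _ _ one_pos).ne' measure_ball_lt_top.ne

/-- lower bound of an average by a ball -/
lemma AA_lower (N : ℕ) : ∃ c : ℝ, 0 < c ∧ ∀ (Ω : Set (ES N)) (_ : Dom Ω) (s : ES N → ℝ)
    (x p : ES N) (ρ m : ℝ), LB Ω s → (∀ x ∈ Ω, 0 ≤ s x) → x ∈ Ω → 0 ≤ m → 0 ≤ ρ →
    dist p x + ρ ≤ 3/8 * dista Ω x → (∀ w ∈ closedBall p ρ, m ≤ s w) →
    c * (ρ / dista Ω x)^N * m ≤ AA Ω s x := by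
  obtain ⟨c0, C0, hc0, hC0, hb⟩ := kap_bounds N
  refine ⟨c0 * 2^N * volume.real (ball (0 : ES N) 1), by have := vol_ball_pos (N := N); positivity, ?_⟩
  intro Ω hD s x p ρ m hs hnn hx hm hρ hd hmin
  have hdx := hD.dpos hx
  have ht : 0 < dista Ω x / 2 := by linarith
  have hinteg : Integrable (fun w => kap x (dista Ω x / 2) w * s w) :=
    kap_mul_integrable x ht (hs.inth hD hx)
  have h1 : ∫ w in closedBall p ρ, kap x (dista Ω x / 2) w * s w ≤ AA Ω s x := by
    refine setIntegral_le_integral hinteg (Eventually.of_forall fun w => ?_)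
    by_cases hw : w ∈ closedBall x (dista Ω x / 2)
    · exact mul_nonneg (kap_nonneg ht.le w) (hnn w (hD.half_sub hx hw))
    · simp only [Pi.zero_apply]; rw [kap_zero ht (by simpa using (not_le.1 hw).le)]; simp
  refine le_trans ?_ h1
  have h2 : ∫ w in closedBall p ρ, c0 * ((dista Ω x / 2)^N)⁻¹ * m
      ≤ ∫ w in closedBall p ρ, kap x (dista Ω x / 2) w * s w := by
    refine setIntegral_mono_on (integrableOn_const (measure_closedBall_lt_top.ne))
      hinteg.integrableOn measurableSet_closedBall ?_
    intro w hw
    have hwx : dist w x ≤ 3/4 * (dista Ω x / 2) := by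
      have := dist_triangle w p x
      have := mem_closedBall.1 hw
      linarith
    have := (hb x _ w ht).2 hwx
    have h3 := hmin w hw
    exact mul_le_mul this h3 hm (kap_nonneg ht.le w)
  refine le_trans (le_of_eq ?_) h2
  rw [setIntegral_const, vol_cball p hρ, smul_eq_mul, div_pow, div_pow]
  field_simp

lemma harnack_consts (N : ℕ) : ∃ c : ℝ, 0 < c ∧ c ≤ 1 ∧
    (∀ (Ω : Set (ES N)) (_ : Dom Ω) (s : ES N → ℝ) (x x' : ES N) (m : ℝ), Sup Ω s → x' ∈ Ω →
      0 ≤ m → dist x x' ≤ dista Ω x' / 8 → PP Ω s x' m → PP Ω s x (c * m)) ∧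
    (∀ (Ω : Set (ES N)) (_ : Dom Ω) (s : ES N → ℝ) (x : ES N) (m η : ℝ), Sup Ω s → x ∈ Ω →
      0 ≤ m → 0 < η → η ≤ 1/16 → (∀ w, dist w x ≤ η * dista Ω x → m ≤ s w) →
        PP Ω s x (c * η^N * m)) ∧
    (∀ (Ω : Set (ES N)) (_ : Dom Ω) (u : ES N → ℝ) (x : ES N), Harm Ω u → x ∈ Ω →
      PP Ω u x (c * u x)) := by
  obtain ⟨c1, hc1, hlow⟩ := AA_lower N
  obtain ⟨c0, C0, hc0, hC0, hb⟩ := kap_bounds N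
  set c := min 1 (min (c1 * (1/20)^N) (min (c1 * (1/2)^N) (c0 / C0 * (1/8)^N)))
  have hcpos : 0 < c := by positivity
  have hcA : c ≤ c1 * (1/20)^N := (min_le_right _ _).trans (min_le_left _ _)
  have hcB : c ≤ c1 * (1/2)^N :=
    (min_le_right _ _).trans ((min_le_right _ _).trans (min_le_left _ _))
  have hcC : c ≤ c0 / C0 * (1/8)^N :=
    (min_le_right _ _).trans ((min_le_right _ _).trans (min_le_right _ _))
  refine ⟨c, hcpos, min_le_left _ _, ?_, ?_, ?_⟩
  · intro Ω hD s x x' m hs hx' hm hd hP w hw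
    have hdx' := hD.dpos hx'
    have l1 := dista_lip (Ω := Ω) x x'
    have hwx' : dist w x' ≤ 0.2 * dista Ω x' := by
      have := dist_triangle w x x'; linarith
    have l2 := dista_lip (Ω := Ω) w x'
    have l3 := dista_lip' (Ω := Ω) x' w
    have hw' : w ∈ Ω := mem_of_dista (by linarith)
    have := hlow Ω hD s w x' (dista Ω x' / 16) m (LB.of_cont hs.cont) hs.nn hw' hm (by linarith)
      (by rw [dist_comm]; linarith) (fun v hv => hP v hv)
    refine le_trans ?_ (this.trans (hs.le w hw'))
    have hr : (1/20 : ℝ) ≤ dista Ω x' / 16 / dista Ω w := by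
      rw [le_div_iff₀ (by linarith)]; linarith
    calc c * m ≤ (c1 * (1/20)^N) * m := by gcongr
      _ ≤ _ := by gcongr
  · intro Ω hD s x m η hs hx hm hη hη1 hP w hw
    have hdx := hD.dpos hx
    have l2 := dista_lip (Ω := Ω) w x
    have l3 := dista_lip' (Ω := Ω) x w
    have hw' : w ∈ Ω := mem_of_dista (by linarith)
    have h16 : η * dista Ω x ≤ 1/16 * dista Ω x := by gcongr
    have := hlow Ω hD s w x (η * dista Ω x) m (LB.of_cont hs.cont) hs.nn hw' hm (by positivity)
      (by rw [dist_comm]; linarith) (fun v hv => hP v hv)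
    refine le_trans ?_ (this.trans (hs.le w hw'))
    have hr : (1/2 : ℝ) * η ≤ η * dista Ω x / dista Ω w := by
      rw [le_div_iff₀ (by linarith)]; nlinarith
    calc c * η^N * m ≤ (c1 * (1/2)^N) * η^N * m := by gcongr
      _ = c1 * (1/2 * η)^N * m := by rw [mul_pow]; ring
      _ ≤ _ := by gcongr
  · intro Ω hD u x hu hx w hw
    have hdx := hD.dpos hx
    have l2 := dista_lip (Ω := Ω) w x
    have l3 := dista_lip' (Ω := Ω) x w
    have hw' : w ∈ Ω := mem_of_dista (by linarith)
    have hdw := hD.dpos hw'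
    set I := ∫ v in closedBall x (dista Ω x / 8), u v
    have hLB := LB.of_cont hu.cont
    have hi : IntegrableOn u (closedBall x (dista Ω x / 8)) := hLB.int (by linarith)
    have hsubΩ : closedBall x (dista Ω x / 8) ⊆ Ω := cball_sub (by linarith)
    have hI0 : 0 ≤ I := setIntegral_nonneg measurableSet_closedBall fun v hv => hu.nn v (hsubΩ hv)
    have up : u x ≤ C0 * ((dista Ω x / 8)^N)⁻¹ * I := by
      rw [← hu.mv x hx (dista Ω x / 8) (by linarith) (by linarith)]
      unfold Av
      rw [kap_mul_eq_indicator x (by linarith), integral_indicator measurableSet_closedBall,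
        ← integral_const_mul]
      refine setIntegral_mono_on ?_ (hi.const_mul _) measurableSet_closedBall ?_
      · exact (kap_mul_integrable x (by linarith) hi).integrableOn
      · intro v hv
        exact mul_le_mul_of_nonneg_right (hb x _ v (by linarith)).1 (hu.nn v (hsubΩ hv))
    have low : c0 * ((dista Ω w / 2)^N)⁻¹ * I ≤ u w := by
      rw [← hu.mv w hw' (dista Ω w / 2) (by linarith) (by linarith)]
      unfold Av
      have hinteg : Integrable (fun v => kap w (dista Ω w / 2) v * u v) :=
        kap_mul_integrable w (by linarith) (hLB.inth hD hw')
      calc c0 * ((dista Ω w / 2)^N)⁻¹ * I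
          = ∫ v in closedBall x (dista Ω x / 8), c0 * ((dista Ω w / 2)^N)⁻¹ * u v := by
            rw [integral_const_mul]
        _ ≤ ∫ v in closedBall x (dista Ω x / 8), kap w (dista Ω w / 2) v * u v := by
            refine setIntegral_mono_on (hi.const_mul _) hinteg.integrableOn measurableSet_closedBall ?_
            intro v hv
            refine mul_le_mul_of_nonneg_right ((hb w _ v (by linarith)).2 ?_) (hu.nn v (hsubΩ hv))
            have := dist_triangle v x w
            have := mem_closedBall.1 hv
            rw [dist_comm x w] at *
            linarith
        _ ≤ _ := by
            refine setIntegral_le_integral hinteg (Eventually.of_forall fun v => ?_)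
            by_cases hv : v ∈ closedBall w (dista Ω w / 2)
            · exact mul_nonneg (kap_nonneg (by linarith) v) (hu.nn v (hD.half_sub hw' hv))
            · simp only [Pi.zero_apply]
              rw [kap_zero (by linarith) (by simpa using (not_le.1 hv).le)]; simp
    refine le_trans ?_ low
    have hux := hu.nn x hx
    calc c * u x ≤ (c0 / C0 * (1/8)^N) * (C0 * ((dista Ω x / 8)^N)⁻¹ * I) := by gcongr
      _ = c0 * ((dista Ω x)^N)⁻¹ * I := by
          rw [div_pow, div_pow]; field_simp; simp
      _ ≤ c0 * ((dista Ω w / 2)^N)⁻¹ * I := by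
          gcongr; linarith

def cH (N : ℕ) : ℝ := (harnack_consts N).choose
lemma cH_pos : 0 < cH N := (harnack_consts N).choose_spec.1
lemma cH_le : cH N ≤ 1 := (harnack_consts N).choose_spec.2.1
lemma PP_step (hD : Dom Ω) {s : ES N → ℝ} {x x' : ES N} {m : ℝ} (hs : Sup Ω s) (hx' : x' ∈ Ω)
    (hm : 0 ≤ m) (hd : dist x x' ≤ dista Ω x' / 8) (h : PP Ω s x' m) : PP Ω s x (cH N * m) :=
  (harnack_consts N).choose_spec.2.2.1 Ω hD s x x' m hs hx' hm hd h
lemma PP_small (hD : Dom Ω) {s : ES N → ℝ} {x : ES N} {m η : ℝ} (hs : Sup Ω s) (hx : x ∈ Ω)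
    (hm : 0 ≤ m) (hη : 0 < η) (hη1 : η ≤ 1/16) (h : ∀ w, dist w x ≤ η * dista Ω x → m ≤ s w) :
    PP Ω s x (cH N * η^N * m) :=
  (harnack_consts N).choose_spec.2.2.2.1 Ω hD s x m η hs hx hm hη hη1 h
lemma PP_harm (hD : Dom Ω) {u : ES N → ℝ} {x : ES N} (hu : Harm Ω u) (hx : x ∈ Ω) :
    PP Ω u x (cH N * u x) :=
  (harnack_consts N).choose_spec.2.2.2.2 Ω hD u x hu hx

lemma PP.at {s : ES N → ℝ} {x : ES N} {m : ℝ} (h : PP Ω s x m) : m ≤ s x :=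
  h x (by rw [dist_self]; linarith [dista_nonneg (Ω := Ω) x])

/-- Harnack along a segment -/
lemma PP_seg (hD : Dom Ω) {s : ES N → ℝ} {x x' : ES N} {m d0 : ℝ} (hs : Sup Ω s) (hm : 0 ≤ m)
    (n : ℕ) (hd0 : 0 < d0) (hseg : ∀ τ ∈ Icc (0:ℝ) 1, d0 ≤ dista Ω (x + τ • (x' - x)))
    (hlen : dist x x' ≤ n * d0 / 8) (h : PP Ω s x m) : PP Ω s x' (cH N ^ n * m) := by
  rcases Nat.eq_zero_or_pos n with rfl | hn
  · have : x = x' := by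
      rw [← dist_le_zero]; simpa using hlen
    subst this; simpa using h
  have hn' : (0:ℝ) < n := by exact_mod_cast hn
  have key : ∀ k : ℕ, k ≤ n → PP Ω s (x + ((k:ℝ)/n) • (x' - x)) (cH N ^ k * m) := by
    intro k
    induction k with
    | zero => intro _; simpa using h
    | succ k ih =>
      intro hk
      have hk' : (k:ℝ) + 1 ≤ n := by exact_mod_cast hk
      have hmem : (k:ℝ)/n ∈ Icc (0:ℝ) 1 := ⟨by positivity, by
        rw [div_le_one hn']; linarith⟩
      have hdk := hseg _ hmem
      have := PP_step hD hs (x := x + (((k+1 : ℕ):ℝ)/n) • (x' - x)) (mem_of_dista (hd0.trans_le hdk))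
        (mul_nonneg (pow_nonneg cH_pos.le k) hm) ?_ (ih (by omega))
      · rw [pow_succ, mul_comm (cH N ^ k), mul_assoc]; exact this
      · have e : (x + (((k+1 : ℕ):ℝ)/n) • (x' - x)) - (x + ((k:ℝ)/n) • (x' - x))
            = (1/(n:ℝ)) • (x' - x) := by
          push_cast; rw [add_div]; module
        rw [dist_eq_norm, e, norm_smul, ← dist_eq_norm, dist_comm x' x, Real.norm_of_nonneg (by positivity)]
        have : 1/(n:ℝ) * dist x x' ≤ 1/(n:ℝ) * (n * d0/8) := by gcongr
        have e2 : 1/(n:ℝ) * (n * d0/8) = d0/8 := by field_simp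
        linarith
  have := key n le_rfl
  rw [div_self hn'.ne', one_smul, add_sub_cancel] at this
  exact this

/-- global Harnack principle (constants depending on the two points) -/
lemma global_PP (hD : Dom Ω) {x x' : ES N} (hx : x ∈ Ω) (hx' : x' ∈ Ω) :
    ∃ c : ℝ, 0 < c ∧ ∀ s m, Sup Ω s → 0 ≤ m → PP Ω s x m → PP Ω s x' (c * m) := by
  refine hD.conn.isPreconnected.induction₂'
    (fun x x' => ∃ c : ℝ, 0 < c ∧ ∀ s m, Sup Ω s → 0 ≤ m → PP Ω s x m → PP Ω s x' (c * m))
    ?_ ?_ hx hx'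
  · intro y hy
    have hd := hD.dpos hy
    have hn : ball y (dista Ω y / 16) ∈ 𝓝[Ω] y :=
      mem_nhdsWithin_of_mem_nhds (ball_mem_nhds y (by linarith))
    filter_upwards [hn] with z hz
    have hz' := mem_ball.1 hz
    have l := dista_lip' (Ω := Ω) y z
    have l2 := dista_lip' (Ω := Ω) z y
    refine ⟨⟨cH N, cH_pos, fun s m hs hm h => PP_step hD hs hy hm (by linarith) h⟩,
      ⟨cH N, cH_pos, fun s m hs hm h => PP_step hD hs (mem_of_dista (by linarith)) hm
        (by rw [dist_comm]; linarith) h⟩⟩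
  · rintro a b d - - - ⟨c1, h1, h1'⟩ ⟨c2, h2, h2'⟩
    exact ⟨c2 * c1, by positivity, fun s m hs hm h => by
      rw [mul_assoc]; exact h2' s _ hs (by positivity) (h1' s m hs hm h)⟩

lemma global_harnack (hD : Dom Ω) {x x' : ES N} (hx : x ∈ Ω) (hx' : x' ∈ Ω) :
    ∃ C : ℝ, 0 < C ∧ ∀ u, Harm Ω u → u x ≤ C * u x' := by
  obtain ⟨c, hc, h⟩ := global_PP hD hx hx'
  have := cH_pos (N := N)
  refine ⟨(c * cH N)⁻¹, by positivity, fun u hu => ?_⟩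
  have := (h u _ (hu.sup hD) (mul_nonneg cH_pos.le (hu.nn x hx)) (PP_harm hD hu hx)).at
  rw [inv_mul_eq_div, le_div_iff₀ (by positivity)]
  linarith

end

section

variable {N : ℕ} {Ω : Set (ES N)}

structure Chart (Ω : Set (ES N)) (z0 e : ES N) (H : ES N → ℝ) (Λ R : ℝ) : Prop where
  R0 : 0 < R
  L1 : 1 ≤ Λ
  e1 : ‖e‖ = 1
  lip : ∀ x x', |H x - H x'| ≤ Λ * dist x x'
  up : ∀ x t, H (x + t • e) = H x + t
  mem : ∀ x ∈ ball z0 R, (x ∈ Ω ↔ 0 < H x)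
  dl : ∀ x ∈ ball z0 R, x ∈ Ω → H x ≤ Λ * dista Ω x
  du : ∀ x ∈ ball z0 R, x ∈ Ω → dista Ω x ≤ H x

/-- vanishing from above at a boundary point -/
def Van (Ω : Set (ES N)) (f : ES N → ℝ) (y : ES N) : Prop := ∀ ε > 0, ∀ᶠ x in 𝓝[Ω] y, f x < ε

lemma exists_chart (hD : Dom Ω) (hΩ : IsLipschitzDomain Ω) {z0 : ES N} (hz : z0 ∈ frontier Ω) :
    ∃ e H Λ R, Chart Ω z0 e H Λ R := by
  obtain ⟨g, i, f, L, ε, hε, hL, hf, hmem⟩ := hΩ.2.2 z0 hz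
  set Λ : ℝ := 1 + L with hΛ
  have hΛ1 : 1 ≤ Λ := by rw [hΛ]; linarith [L.coe_nonneg]
  set H : ES N → ℝ := fun x => g x i - f (g x) with hH
  set e : ES N := g.symm (EuclideanSpace.single i 1) with he
  have hlip : ∀ x x', |H x - H x'| ≤ Λ * dist x x' := by
    intro x x'
    have h1 : |f (g x) - f (g x')| ≤ L * dist x x' := by
      have := hL.dist_le_mul (g x) (g x')
      rwa [Real.dist_eq, g.dist_map] at this
    have h2 : |g x i - g x' i| ≤ dist x x' := by
      have := EuclideanSpace.norm_eq (g x - g x')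
      have h3 := PiLp.norm_apply_le (g x - g x') i
      rw [← dist_eq_norm, g.dist_map] at h3
      simpa using h3
    have e : H x - H x' = (g x i - g x' i) - (f (g x) - f (g x')) := by simp only [hH]; ring
    rw [e, hΛ, add_mul, one_mul]
    exact (abs_sub _ _).trans (add_le_add h2 h1)
  have hup : ∀ x t, H (x + t • e) = H x + t := by
    intro x t
    have h1 : g (x + t • e) = g x + t • EuclideanSpace.single i 1 := by
      rw [map_add, map_smul, he, g.apply_symm_apply]
    have h2 : f (g (x + t • e)) = f (g x) := by
      apply hf
      intro j hj
      rw [h1]; simp [hj]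
    simp only [hH]
    rw [h2, h1]; simp; ring
  have he1 : ‖e‖ = 1 := by rw [he, g.symm.norm_map]; simp
  have hmem' : ∀ x ∈ ball z0 ε, (x ∈ Ω ↔ 0 < H x) := by
    intro x hx; rw [hmem x hx]; simp only [hH]; constructor <;> intro h <;> linarith
  have hz0 : z0 ∉ Ω := by
    have := hD.op.frontier_eq ▸ hz
    exact this.2
  have hHz : H z0 ≤ 0 := by
    by_contra hc
    exact hz0 ((hmem' z0 (mem_ball_self hε)).2 (not_le.1 hc))
  refine ⟨e, H, Λ, ε / (4 * Λ), ?_⟩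
  have hR : ε / (4*Λ) ≤ ε/4 := by
    apply div_le_div_of_nonneg_left hε.le (by norm_num); linarith
  have hΛR : Λ * (ε/(4*Λ)) = ε/4 := by field_simp
  refine ⟨by positivity, hΛ1, he1, hlip, hup, ?_, ?_, ?_⟩
  · intro x hx
    exact hmem' x (ball_subset_ball (by linarith) hx)
  · intro x hx hxΩ
    obtain ⟨p, hp, hd⟩ := hD.exists_near x
    have h1 : dista Ω x ≤ dist x z0 := infDist_le_dist_of_mem hz0
    have hx' := mem_ball.1 hx
    have hpH : H p ≤ 0 := by
      by_contra hc
      refine hp ((hmem' p ?_).2 (not_le.1 hc))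
      rw [mem_ball]
      have := dist_triangle p x z0
      rw [dist_comm p x] at this
      linarith
    have := (abs_le.1 (hlip x p)).2
    rw [hd] at this; linarith
  · intro x hx hxΩ
    have hx' := mem_ball.1 hx
    have hHx : 0 < H x := (hmem' x (ball_subset_ball (by linarith) hx)).1 hxΩ
    have h1 : H x ≤ ε/4 := by
      have := (abs_le.1 (hlip x z0)).2
      have : Λ * dist x z0 ≤ ε/4 := by rw [← hΛR]; gcongr
      linarith
    have hd : dist x (x + (-H x) • e) = H x := by
      rw [dist_eq_norm, sub_add_cancel_left, norm_neg, norm_smul, he1]; simp [hHx.le]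
    have hp : x + (-H x) • e ∉ Ω := by
      intro hc
      rw [hmem' _ _, hup] at hc
      · linarith
      · rw [mem_ball]
        have := dist_triangle (x + (-H x) • e) x z0
        rw [dist_comm _ x, hd] at this
        linarith
    rw [← hd]
    exact infDist_le_dist_of_mem hp

section
variable {z0 e : ES N} {H : ES N → ℝ} {Λ R : ℝ}

lemma Chart.L0 (hC : Chart Ω z0 e H Λ R) : 0 < Λ := by linarith [hC.L1]

lemma Chart.dist_up (hC : Chart Ω z0 e H Λ R) (x : ES N) (t : ℝ) : dist (x + t • e) x = |t| := by
  rw [dist_eq_norm, add_sub_cancel_left, norm_smul, hC.e1]; simp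

lemma Chart.Hcont (hC : Chart Ω z0 e H Λ R) : Continuous H := by
  have : LipschitzWith ⟨Λ, hC.L0.le⟩ H := LipschitzWith.of_dist_le_mul fun x x' => by
    rw [Real.dist_eq]; exact hC.lip x x'
  exact this.continuous

lemma Chart.Hle (hC : Chart Ω z0 e H Λ R) (x y : ES N) : H x ≤ H y + Λ * dist x y := by
  linarith [(abs_le.1 (hC.lip x y)).2]

lemma Chart.notMem (hC : Chart Ω z0 e H Λ R) {y : ES N} (hy : H y = 0) (hyR : dist y z0 < R) :
    y ∉ Ω := by
  rw [hC.mem y (mem_ball.2 hyR), hy]; exact lt_irrefl _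

lemma Chart.d_le (hC : Chart Ω z0 e H Λ R) {y : ES N} (hy : H y = 0) (hyR : dist y z0 < R) (x : ES N) :
    dista Ω x ≤ dist x y := infDist_le_dist_of_mem (hC.notMem hy hyR)

lemma Chart.frontier_zero (hD : Dom Ω) (hC : Chart Ω z0 e H Λ R) {y : ES N} (hy : y ∈ frontier Ω) (hyR : dist y z0 < R) :
    H y = 0 := by
  rw [hD.op.frontier_eq] at hy
  have h1 : ¬ 0 < H y := fun h => hy.2 ((hC.mem y (mem_ball.2 hyR)).2 h)
  refine le_antisymm (not_lt.1 h1) ?_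
  by_contra hc
  have hU : IsOpen ({x | H x < 0} ∩ ball z0 R) := (isOpen_lt hC.Hcont continuous_const).inter isOpen_ball
  obtain ⟨w, hw, hwΩ⟩ := mem_closure_iff.1 hy.1 _ hU ⟨not_le.1 hc, mem_ball.2 hyR⟩
  have := (hC.mem w hw.2).1 hwΩ
  exact lt_asymm this hw.1

lemma Chart.zero_frontier (hD : Dom Ω) (hC : Chart Ω z0 e H Λ R) {y : ES N} (hy : H y = 0) (hyR : dist y z0 < R) :
    y ∈ frontier Ω := by
  rw [hD.op.frontier_eq]
  refine ⟨?_, hC.notMem hy hyR⟩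
  rw [Metric.mem_closure_iff]
  intro ε hε
  set t := min (ε/2) ((R - dist y z0)/2)
  have ht : 0 < t := lt_min (by linarith) (by linarith)
  refine ⟨y + t • e, (hC.mem _ ?_).2 (by rw [hC.up, hy]; linarith), ?_⟩
  · rw [mem_ball]
    have := dist_triangle (y + t • e) y z0
    rw [hC.dist_up, abs_of_pos ht] at this
    linarith [min_le_right (ε/2) ((R - dist y z0)/2)]
  · rw [dist_comm, hC.dist_up, abs_of_pos ht]
    linarith [min_le_left (ε/2) ((R - dist y z0)/2)]

/-- one step of decay near the boundary -/
lemma decay1 (hD : Dom Ω) (hC : Chart Ω z0 e H Λ R) : ∃ θ : ℝ, 0 < θ ∧ θ < 1 ∧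
    ∀ (y : ES N) (r m : ℝ) (f : ES N → ℝ), H y = 0 → 0 < r → dist y z0 + 2 * r ≤ R → 0 ≤ m →
      ContinuousOn f Ω → (∀ x ∈ Ω, dist x y < r → f x ≤ AA Ω f x) →
      (∀ x ∈ Ω, dist x y < 2 * r → f x ≤ m) →
      (∀ y' ∈ frontier Ω, dist y' y < 2 * r → Van Ω f y') →
      ∀ x ∈ Ω, dist x y < r / 4 → f x ≤ θ * m := by
  have hL := hC.L0
  have hL1 := hC.L1
  set c : ℝ := 1/(4*Λ) with hc
  have hc0 : 0 < c := by positivity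
  have hc4 : c ≤ 1/4 := by
    rw [hc]; apply div_le_div_of_nonneg_left <;> linarith
  set ν : ℝ := (N+1)/(2*c^2) with hν
  have hν0 : 0 < ν := by positivity
  set b1 : ℝ := 1 - Real.exp (-ν*(9/16 - c^2)) with hb1
  set b2 : ℝ := 1 - Real.exp (-ν*(1/4 - c^2)) with hb2
  have hb2p : 0 < b2 := by
    rw [hb2, sub_pos, Real.exp_lt_one_iff]
    have h1 : 0 < 1/4 - c^2 := by nlinarith
    have := mul_pos hν0 h1
    linarith
  have hb21 : b2 < b1 := by
    rw [hb1, hb2]; apply sub_lt_sub_left; rw [Real.exp_lt_exp]; nlinarith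
  have hb1p : 0 < b1 := hb2p.trans hb21
  refine ⟨b2/b1, by positivity, (div_lt_one hb1p).2 hb21, ?_⟩
  intro y r m f hy hr hR hm hf hsub hfm hvan
  have hyR : dist y z0 < R := by linarith
  set y' : ES N := y + (-(r/4)) • e with hy'
  have hyy' : dist y' y = r/4 := by rw [hy', hC.dist_up, abs_neg, abs_of_pos (by linarith)]
  have hHy' : H y' = -(r/4) := by rw [hy', hC.up, hy]; ring
  set lam : ℝ := ν/r^2 with hlam
  have hlam0 : 0 < lam := by positivity
  have hlr : lam * r^2 = ν := by rw [hlam]; field_simp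
  set b : ES N → ℝ := fun x => 1 - Real.exp (lam*(c^2*r^2)) * Real.exp (-lam * ‖x - y'‖^2) with hb
  have hbe : ∀ x, b x = 1 - Real.exp (lam*(c^2*r^2) - lam * ‖x - y'‖^2) := by
    intro x; simp only [hb]; rw [← Real.exp_add]; ring_nf
  have hbc : Continuous b := by
    simp only [hb]; fun_prop
  have hfar : ∀ x ∈ Ω, dist x y < 2*r → c * r ≤ ‖x - y'‖ := by
    intro x hx hxy
    have hx2 : 0 < H x := (hC.mem x (mem_ball.2 (by linarith [dist_triangle x y z0]))).1 hx
    have := hC.Hle x y'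
    rw [hHy'] at this
    rw [← dist_eq_norm, hc]
    have : r/4 ≤ Λ * dist x y' := by linarith
    rw [div_mul_eq_mul_div, one_mul, div_le_iff₀ (by positivity)]; linarith
  have hb0 : ∀ x ∈ Ω, dist x y < 2*r → 0 ≤ b x := by
    intro x hx hxy
    have h1 := hfar x hx hxy
    have h2 : (c*r)^2 ≤ ‖x-y'‖^2 := by gcongr
    rw [hbe, sub_nonneg, Real.exp_le_one_iff, sub_nonpos]
    apply mul_le_mul_of_nonneg_left _ hlam0.le
    rw [← mul_pow]; exact h2
  have hbsup : ∀ x ∈ Ω, dist x y < r → AA Ω b x ≤ b x := by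
    intro x hx hxy
    have hd := hD.dpos hx
    have hdr : dista Ω x < r := (hC.d_le hy hyR x).trans_lt hxy
    have hg := gauss_sub (y := y') (x := x) (t := dista Ω x / 2) (T := 3/4 * dista Ω x) hlam0 (by linarith)
      (by linarith) ?_
    · have hc1 : Continuous (fun w : ES N => Real.exp (-lam * ‖w - y'‖^2)) := by fun_prop
      have h1 : LB Ω (fun w : ES N => Real.exp (-lam * ‖w - y'‖^2)) := LB.of_cont hc1.continuousOn
      have h2 : AA Ω b x = 1 - Real.exp (lam*(c^2*r^2)) * AA Ω (fun w => Real.exp (-lam * ‖w - y'‖^2)) x := by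
        rw [← AA_smul, hb, AA_sub hD (LB.of_cont continuousOn_const)
          (LB.of_cont (hc1.const_mul _).continuousOn) hx, AA_const hD hx]
      rw [h2]
      simp only [hb]
      have := mul_le_mul_of_nonneg_left hg (Real.exp_pos (lam*(c^2*r^2))).le
      unfold AA
      linarith
    · intro w hw
      have hwx := mem_closedBall.1 hw
      have h1 := hfar w (cball_sub (by linarith) hw) (by linarith [dist_triangle w x y])
      have h2 : (c*r)^2 ≤ ‖w-y'‖^2 := by gcongr
      have h3 : 2 * lam * (c*r)^2 = N+1 := by
        have e1 : 2 * lam * (c*r)^2 = 2 * (lam * r^2) * c^2 := by ring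
        rw [e1, hlr, hν]; field_simp
      nlinarith
  have hb_far : ∀ x, r ≤ dist x y → b1 ≤ b x := by
    intro x hx
    rw [hbe, hb1]
    apply sub_le_sub_left
    rw [Real.exp_le_exp]
    have h1 : 3/4 * r ≤ ‖x - y'‖ := by
      rw [← dist_eq_norm]
      have := dist_triangle x y' y
      linarith
    have h2 : (3/4*r)^2 ≤ ‖x-y'‖^2 := by gcongr
    have h3 : lam * (3/4*r)^2 ≤ lam * ‖x-y'‖^2 := by gcongr
    rw [← hlr]; nlinarith
  have hb_near : ∀ x, dist x y < r/4 → b x ≤ b2 := by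
    intro x hx
    rw [hbe, hb2]
    apply sub_le_sub_left
    rw [Real.exp_le_exp]
    have h1 : ‖x - y'‖ ≤ 1/2 * r := by
      rw [← dist_eq_norm]
      have := dist_triangle x y y'
      rw [dist_comm y y'] at this
      linarith
    have h2 : ‖x-y'‖^2 ≤ (1/2*r)^2 := by gcongr
    have h3 : lam * ‖x-y'‖^2 ≤ lam * (1/2*r)^2 := by gcongr
    rw [← hlr]; nlinarith
  have hmp := maxPrinciple hD (g := fun x => f x - m/b1 * b x) (D := {x | x ∈ Ω ∧ dist x y < r})
    (hf.sub (hbc.continuousOn.const_mul _ |>.congr fun _ _ => rfl)) (fun x hx => hx.1) ?_ ?_ ?_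
  · intro x hx hxr
    have h1 := hmp x ⟨hx, by linarith⟩
    have h2 := hb_near x hxr
    have h3 : m/b1 * b x ≤ m/b1 * b2 := by gcongr
    have e1 : b2/b1*m = m/b1*b2 := by ring
    linarith
  · rintro x ⟨hx, hxr⟩
    rw [AA_sub hD (LB.of_cont hf) (LB.of_cont (hbc.const_mul _).continuousOn) hx, AA_smul]
    have h1 := hsub x hx hxr
    have h2 := mul_le_mul_of_nonneg_left (hbsup x hx hxr) (div_nonneg hm hb1p.le)
    linarith
  · rintro x ⟨hx, hxr⟩ w hw hwD
    have hwΩ := hD.half_sub hx hw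
    have hwx := mem_closedBall.1 hw
    have hdr : dista Ω x < r := (hC.d_le hy hyR x).trans_lt hxr
    have hwr : r ≤ dist w y := by
      by_contra hcon; exact hwD ⟨hwΩ, not_le.1 hcon⟩
    have h1 := hfm w hwΩ (by linarith [dist_triangle w x y])
    have h2 := mul_le_mul_of_nonneg_left (hb_far w hwr) (div_nonneg hm hb1p.le)
    have e1 : m/b1*b1 = m := by field_simp
    linarith
  · intro y1 hy1 ε hε
    by_cases h : dist y1 y < 2 * r
    · have h1 := hvan y1 hy1 h ε hε
      have h2 : ∀ᶠ x in 𝓝[{x | x ∈ Ω ∧ dist x y < r}] y1, f x < ε :=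
        h1.filter_mono (nhdsWithin_mono _ fun x hx => hx.1)
      filter_upwards [h2, self_mem_nhdsWithin] with x hx hx2
      have := hb0 x hx2.1 (by linarith [hx2.2])
      have h3 : 0 ≤ m/b1 * b x := by positivity
      linarith
    · have : ∀ᶠ x in 𝓝 y1, r < dist x y := by
        apply (continuous_id.dist continuous_const).continuousAt.eventually_const_lt
        simp only [id]; linarith
      filter_upwards [nhdsWithin_le_nhds this, self_mem_nhdsWithin] with x hx hx2
      linarith [hx2.2]

lemma decayn (hD : Dom Ω) (hC : Chart Ω z0 e H Λ R) : ∃ θ : ℝ, 0 < θ ∧ θ < 1 ∧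
    ∀ (y : ES N) (r m : ℝ) (f : ES N → ℝ), H y = 0 → 0 < r → dist y z0 + r ≤ R → 0 ≤ m →
      ContinuousOn f Ω → (∀ x ∈ Ω, dist x y < r → f x ≤ AA Ω f x) →
      (∀ x ∈ Ω, dist x y < r → f x ≤ m) →
      (∀ y' ∈ frontier Ω, dist y' y < r → Van Ω f y') →
      ∀ n : ℕ, ∀ x ∈ Ω, dist x y < r / 8^n → f x ≤ θ^n * m := by
  obtain ⟨θ, h0, h1, h⟩ := decay1 hD hC
  refine ⟨θ, h0, h1, ?_⟩
  intro y r m f hy hr hR hm hf hsub hfm hvan n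
  induction n with
  | zero => intro x hx hxr; simpa using hfm x hx (by simpa using hxr)
  | succ n ih =>
    intro x hx hxr
    have hp : r / 8^n ≤ r := div_le_self hr.le (one_le_pow₀ (by norm_num))
    have hp0 : 0 < r/8^n := by positivity
    have e1 : r / 8^(n+1) = r/8^n/8 := by rw [pow_succ]; field_simp
    rw [e1] at hxr
    rw [pow_succ, mul_comm (θ^n), mul_assoc]
    refine h y (r/8^n/2) _ f hy (by positivity) (by linarith) (by positivity) hf ?_ ?_ ?_ x hx (by linarith)
    · intro x hx hxr; exact hsub x hx (by linarith)
    · intro x hx hxr; exact ih x hx (by linarith)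
    · intro x hx hxr; exact hvan x hx (by linarith)

/-- decay for functions which are nonpositive away from a thin layer -/
lemma thin (hD : Dom Ω) (hC : Chart Ω z0 e H Λ R) : ∃ θ : ℝ, 0 < θ ∧ θ < 1 ∧
    ∀ (y : ES N) (r h m : ℝ) (f : ES N → ℝ), 0 < h → dist y z0 + r ≤ R → 0 ≤ m →
      ContinuousOn f Ω → (∀ x ∈ Ω, dist x y < r → f x ≤ AA Ω f x) →
      (∀ x ∈ Ω, dist x y < r → f x ≤ m) →
      (∀ x ∈ Ω, dist x y < r → h ≤ H x → f x ≤ 0) →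
      (∀ y' ∈ frontier Ω, dist y' y < r → Van Ω f y') →
      ∀ n : ℕ, ∀ x ∈ Ω, dist x y < r - 9*n*h → f x ≤ θ^n * m := by
  obtain ⟨θ, h0, h1, hθ⟩ := decay1 hD hC
  refine ⟨θ, h0, h1, ?_⟩
  intro y r h m f hh hR hm hf hsub hfm hH hvan n
  induction n with
  | zero => intro x hx hxr; simpa using hfm x hx (by simpa using hxr)
  | succ n ih =>
    intro x hx hxr
    push_cast at hxr
    have hnh : 0 ≤ 9*(n:ℝ)*h := by positivity
    by_cases hHx : h ≤ H x
    · exact (hH x hx (by linarith) hHx).trans (by positivity)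
    push Not at hHx
    have hHx0 : 0 < H x := (hC.mem x (mem_ball.2 (by linarith [dist_triangle x y z0]))).1 hx
    set y2 := x + (-H x) • e with hy2
    have hd : dist y2 x = H x := by rw [hy2, hC.dist_up]; simp [hHx0.le]
    have hd2 : dist y2 y ≤ H x + dist x y := by linarith [dist_triangle y2 x y]
    rw [pow_succ, mul_comm (θ^n), mul_assoc]
    refine hθ y2 (4*h) _ f (by rw [hy2, hC.up]; ring) (by positivity) (by linarith [dist_triangle y2 y z0])
      (by positivity) hf ?_ ?_ ?_ x hx (by rw [dist_comm, hd]; linarith)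
    · intro w hw hwr; exact hsub w hw (by linarith [dist_triangle w y2 y])
    · intro w hw hwr; exact ih w hw (by linarith [dist_triangle w y2 y])
    · intro w hw hwr; exact hvan w hw (by linarith [dist_triangle w y2 y])

end

end

section

variable {N : ℕ} {Ω : Set (ES N)}
variable {z0 e : ES N} {H : ES N → ℝ} {Λ R : ℝ}

lemma Chart.inball (hC : Chart Ω z0 e H Λ R) {x : ES N} (hx : dist x z0 < R) (h : 0 < H x) : x ∈ Ω :=
  (hC.mem x (mem_ball.2 hx)).2 h

lemma Chart.Hpos (hC : Chart Ω z0 e H Λ R) {x : ES N} (hx : dist x z0 < R) (h : x ∈ Ω) : 0 < H x :=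
  (hC.mem x (mem_ball.2 hx)).1 h

lemma Chart.dlow (hC : Chart Ω z0 e H Λ R) {x : ES N} {t : ℝ} (hx : dist x z0 < R) (ht : 0 < t) (h : t ≤ H x) :
    t / Λ ≤ dista Ω x := by
  have h1 := hC.dl x (mem_ball.2 hx) (hC.inball hx (ht.trans_le h))
  rw [div_le_iff₀ hC.L0]; linarith

lemma chain (hD : Dom Ω) (hC : Chart Ω z0 e H Λ R) {τ C : ℝ} (hτ : 0 < τ) (hC0 : 0 ≤ C) :
    ∃ c : ℝ, 0 < c ∧ c ≤ 1 ∧ ∀ (s : ES N → ℝ) (x x' : ES N) (r m : ℝ), Sup Ω s → 0 ≤ m → 0 < r →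
      τ * r ≤ H x → τ * r ≤ H x' → dist x x' ≤ C * r → dist x z0 + (Λ+2) * C * r < R →
      PP Ω s x m → PP Ω s x' (c * m) := by
  have hL := hC.L0
  have hL1 := hC.L1
  obtain ⟨n, hn⟩ := exists_nat_ge (8*Λ*(Λ*C)/τ)
  rw [div_le_iff₀ hτ] at hn
  refine ⟨cH N^(3*n), pow_pos cH_pos _, pow_le_one₀ cH_pos.le cH_le, ?_⟩
  intro s x x' r m hs hm hr hx hx' hd hR h
  set T := Λ*C*r with hT
  have hCr : 0 ≤ C*r := by positivity
  have hT0 : 0 ≤ T := by positivity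
  have hTC : C*r ≤ T := by rw [hT]; nlinarith
  have hR' : dist x z0 + T + 2*(C*r) < R := by rw [hT]; nlinarith
  have hd0 : 0 < τ*r/Λ := by positivity
  have hnT : T ≤ n * (τ*r/Λ)/8 := by
    rw [hT, mul_div_assoc', div_div, le_div_iff₀ (by positivity)]; nlinarith
  have up : ∀ τ' ∈ Icc (0:ℝ) 1, |τ' * T| ≤ T := by
    intro t ht; rw [abs_of_nonneg (mul_nonneg ht.1 hT0)]; nlinarith [ht.2]
  have h1 : PP Ω s (x + T • e) (cH N^n*m) := by
    refine PP_seg hD hs hm n hd0 ?_ ?_ h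
    · intro t ht
      rw [add_sub_cancel_left, smul_smul]
      refine hC.dlow ?_ (by positivity) ?_
      · have := dist_triangle (x + (t*T) • e) x z0
        rw [hC.dist_up] at this
        linarith [up t ht]
      · rw [hC.up]; linarith [mul_nonneg ht.1 hT0]
    · rw [dist_comm, hC.dist_up, abs_of_nonneg hT0]; exact hnT
  have h2 : PP Ω s (x' + T • e) (cH N^n*(cH N^n*m)) := by
    refine PP_seg hD hs (by have := cH_pos (N := N); positivity) n hd0 ?_ ?_ h1
    · intro t ht
      rw [add_sub_add_right_eq_sub]
      have e1 : x + T • e + t • (x' - x) = (x + t • (x' - x)) + T • e := by abel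
      have e2 : dist (x + t • (x' - x)) x ≤ C*r := by
        rw [dist_eq_norm, add_sub_cancel_left, norm_smul, ← dist_eq_norm, dist_comm, Real.norm_of_nonneg ht.1]
        nlinarith [ht.2, dist_nonneg (x := x) (y := x'), ht.1]
      rw [e1]
      refine hC.dlow ?_ (by positivity) ?_
      · have := dist_triangle ((x + t • (x' - x)) + T • e) (x + t • (x' - x)) z0
        rw [hC.dist_up, abs_of_nonneg hT0] at this
        linarith [dist_triangle (x + t • (x' - x)) x z0]
      · rw [hC.up]
        have := hC.Hle x (x + t • (x' - x))
        rw [dist_comm] at this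
        have h3 : Λ * dist (x + t • (x' - x)) x ≤ Λ * (C*r) := by gcongr
        rw [hT]; linarith
    · rw [dist_add_right]; linarith
  have h3 : PP Ω s x' (cH N^n*(cH N^n*(cH N^n*m))) := by
    refine PP_seg hD hs (by have := cH_pos (N := N); positivity) n hd0 ?_ ?_ h2
    · intro t ht
      have e1 : x' + T • e + t • (x' - (x' + T • e)) = x' + ((1-t)*T) • e := by
        module
      rw [e1]
      have hd' : dist x' x ≤ C*r := by rwa [dist_comm]
      have ht' : 1 - t ∈ Icc (0:ℝ) 1 := ⟨by linarith [ht.2], by linarith [ht.1]⟩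
      refine hC.dlow ?_ (by positivity) ?_
      · have := dist_triangle (x' + ((1-t)*T) • e) x' z0
        rw [hC.dist_up] at this
        linarith [up _ ht', dist_triangle x' x z0]
      · rw [hC.up]; linarith [mul_nonneg ht'.1 hT0]
    · rw [hC.dist_up, abs_of_nonneg hT0]; exact hnT
  have e3 : cH N^(3*n)*m = cH N^n*(cH N^n*(cH N^n*m)) := by
    rw [show 3*n = n+n+n by ring, pow_add, pow_add]; ring
  rw [e3]; exact h3

set_option maxHeartbeats 2000000 in
/-- local boundary comparison (De Silva - Savin iteration) -/
lemma bhlocal (hD : Dom Ω) (hC : Chart Ω z0 e H Λ R) : ∃ ε M : ℝ, 0 < ε ∧ ε < 1 ∧ 0 < M ∧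
    ∀ (y : ES N) (r : ℝ) (f s : ES N → ℝ), H y = 0 → 0 < r → dist y z0 + r ≤ R →
      ContinuousOn f Ω → (∀ x ∈ Ω, dist x y < r → f x ≤ AA Ω f x) →
      (∀ x ∈ Ω, dist x y < r → f x ≤ 1) →
      (∀ y' ∈ frontier Ω, dist y' y < r → Van Ω f y') →
      Sup Ω s → (∀ x ∈ Ω, dist x y < r → ε * r ≤ H x → 1 ≤ s x) →
      ∀ t, 0 < t → t < r → f (y + t • e) ≤ M * s (y + t • e) := by
  obtain ⟨θ, hθ0, hθ1, hthin⟩ := thin hD hC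
  obtain ⟨c0, hc0, hlow⟩ := AA_lower N
  have hL := hC.L0
  have hL1 := hC.L1
  set c1 : ℝ := min (c0 * (1/(16*Λ))^N) 1 with hc1
  have hc1p : 0 < c1 := lt_min (by positivity) one_pos
  have hc1le : c1 ≤ c0 * (1/(16*Λ))^N := min_le_left _ _
  have hc1le1 : c1 ≤ 1 := min_le_right _ _
  set a : ℝ := c1/2 with ha
  have ha0 : 0 < a := by positivity
  have ha1 : a ≤ 1 := by linarith
  set L : ℝ := 2/c1 with hLdef
  have hL0 : 0 < L := by positivity
  have hLc : L * c1 = 2 := by rw [hLdef]; field_simp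
  obtain ⟨n, hn⟩ := exists_pow_lt_of_lt_one ha0 hθ1
  set lam : ℝ := (1 + 1/(16*Λ))⁻¹ with hlam
  have hlam0 : 0 < lam := by positivity
  have hlam1 : lam < 1 := by
    rw [hlam]; apply inv_lt_one_of_one_lt₀; have : 0 < 1/(16*Λ) := by positivity
    linarith
  have hlaminv : lam * (1 + 1/(16*Λ)) = 1 := by rw [hlam]; field_simp
  set ε : ℝ := min ((1-lam)/(9*n+1)) (lam/2) with hε
  have h1l : 0 < 1 - lam := by linarith
  have hε0 : 0 < ε := lt_min (by positivity) (by positivity)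
  have hε1 : ε < lam := (min_le_right _ _).trans_lt (by linarith)
  have hε2 : ε * (9*n+1) ≤ 1 - lam := by
    rw [← le_div_iff₀ (by positivity)]; exact min_le_left _ _
  have hn0 : (0:ℝ) ≤ n := Nat.cast_nonneg n
  have hε3 : ε ≤ 1 - lam := by
    have : 0 ≤ ε * (9*n) := by positivity
    linarith
  refine ⟨ε, L+1, hε0, by linarith, by linarith, ?_⟩
  intro y r f s hy hr hR hf hsub hf1 hvan hs hs1 t ht0 htr
  set g : ES N → ℝ := fun x => f x - (L+1) * s x with hg
  have hgc : ContinuousOn g Ω := hf.sub (hs.cont.const_mul _ |>.congr fun _ _ => rfl)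
  have hgA : ∀ x ∈ Ω, dist x y < r → g x ≤ AA Ω g x := by
    intro x hx hxr
    have e1 : AA Ω g x = AA Ω f x - (L+1) * AA Ω s x := by
      rw [← AA_smul]
      exact AA_sub hD (LB.of_cont hf) (LB.of_cont (hs.cont.const_mul _ |>.congr fun _ _ => rfl)) hx
    rw [e1]
    have h1 := hsub x hx hxr
    have h2 := mul_le_mul_of_nonneg_left (hs.le x hx) (by linarith : (0:ℝ) ≤ L+1)
    simp only [hg]; linarith
  have hgvan : ∀ y' ∈ frontier Ω, dist y' y < r → Van Ω g y' := by
    intro y' hy' hd ε' hε'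
    filter_upwards [hvan y' hy' hd ε' hε', self_mem_nhdsWithin] with x hx hx2
    have := mul_nonneg (by linarith : (0:ℝ) ≤ L+1) (hs.nn x hx2)
    simp only [hg]; linarith
  have key : ∀ k : ℕ, (∀ x ∈ Ω, dist x y < lam^k*r → g x ≤ a^k) ∧
      (∀ x ∈ Ω, dist x y < lam^k*r → ε * (lam^k*r) ≤ H x → g x ≤ - (L*a^k)) := by
    intro k
    induction k with
    | zero =>
      simp only [pow_zero, one_mul, mul_one]
      refine ⟨fun x hx hxr => ?_, fun x hx hxr hHx => ?_⟩
      · have := mul_nonneg (by linarith : (0:ℝ) ≤ L+1) (hs.nn x hx)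
        have := hf1 x hx hxr
        simp only [hg]; linarith
      · have := mul_le_mul_of_nonneg_left (hs1 x hx hxr hHx) (by linarith : (0:ℝ) ≤ L+1)
        have := hf1 x hx hxr
        simp only [hg]; linarith
    | succ k ih =>
      obtain ⟨ih1, ih2⟩ := ih
      set rk := lam^k*r with hrk
      have hrk0 : 0 < rk := by positivity
      have hrkr : rk ≤ r := by
        rw [hrk]; have := pow_le_one₀ (n := k) hlam0.le hlam1.le; nlinarith
      have hak : 0 < a^k := by positivity
      have hlrk : lam * rk ≤ rk := mul_le_of_le_one_left hrk0.le hlam1.le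
      have e1 : lam^(k+1)*r = lam*rk := by rw [hrk, pow_succ]; ring
      rw [e1, pow_succ]
      refine ⟨fun x hx hxr => ?_, fun x hx hxr hHx => ?_⟩
      · have := hthin y rk (ε*rk) (a^k) g (by positivity) (by linarith) hak.le hgc
          (fun x hx hxr => hgA x hx (by linarith)) ih1
          (fun x hx hxr hHx => (ih2 x hx hxr hHx).trans (by
            have : 0 ≤ L * a^k := by positivity
            linarith)) (fun x hx hxr => hgvan x hx (by linarith)) n x hx ?_
        · refine this.trans ?_
          rw [mul_comm]; gcongr
        · refine hxr.trans_le ?_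
          have := mul_le_mul_of_nonneg_right hε2 hrk0.le
          have h2 : 0 < ε*rk := by positivity
          linarith
      · by_cases hHk : ε * rk ≤ H x
        · have := ih2 x hx (hxr.trans_le hlrk) hHk
          refine this.trans ?_
          have : L * (a^k*a) ≤ L * (a^k * 1) := by gcongr
          linarith
        push Not at hHk
        have hxr' : dist x y < r := by linarith
        have hxb : x ∈ ball z0 R := mem_ball.2 (by linarith [dist_triangle x y z0])
        have hd := hD.dpos hx
        have hdu := hC.du x hxb hx
        have hdl := hC.dl x hxb hx
        set v : ES N → ℝ := fun w => max (a^k - g w) 0 with hv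
        have hvc : ContinuousOn v Ω := (continuousOn_const.sub hgc).sup continuousOn_const
        have hjump : ∀ w ∈ closedBall x (dista Ω x / 2), dist w y < rk := by
          intro w hw
          have := mem_closedBall.1 hw
          have h2 := dist_triangle w x y
          have h3 := mul_le_mul_of_nonneg_right hε3 hrk0.le
          linarith
        have hAA : AA Ω v x = a^k - AA Ω g x := by
          rw [← AA_const hD hx (a^k), ← AA_sub hD (LB.of_cont continuousOn_const) (LB.of_cont hgc) hx]
          apply AA_congr hD hx
          intro w hw
          have := ih1 w (hD.half_sub hx hw) (hjump w hw)
          simp only [hv]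
          exact max_eq_left (by linarith)
        have hlo := hlow Ω hD v x (x + (dista Ω x/8) • e) (dista Ω x/(16*Λ)) ((L+1)*a^k) (LB.of_cont hvc)
          (fun w _ => le_max_right _ _) hx (by positivity) (by positivity) ?_ ?_
        · rw [hAA] at hlo
          have h3 := hgA x hx hxr'
          have e2 : dista Ω x / (16*Λ) / dista Ω x = 1/(16*Λ) := by field_simp
          rw [e2] at hlo
          have h4 : c1 * ((L+1)*a^k) ≤ c0 * (1/(16*Λ))^N * ((L+1)*a^k) := by gcongr
          have h5 : c1 * ((L+1)*a^k) = 2*a^k + c1*a^k := by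
            calc c1 * ((L+1)*a^k) = (L*c1)*a^k + c1*a^k := by ring
              _ = _ := by rw [hLc]
          have h6 : L * (a^k*a) = a^k := by
            calc L * (a^k*a) = (L*c1)/2*a^k := by rw [ha]; ring
              _ = a^k := by rw [hLc]; ring
          have h7 : 0 < c1*a^k := by positivity
          rw [h6]; linarith
        · rw [hC.dist_up, abs_of_pos (by linarith)]
          have : dista Ω x/(16*Λ) ≤ dista Ω x / 16 := by
            apply div_le_div_of_nonneg_left hd.le (by norm_num); linarith
          linarith
        · intro w hw
          have hw' := mem_closedBall.1 hw
          have hwx : dist w x ≤ dista Ω x/2 := by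
            have h1 := dist_triangle w (x + (dista Ω x/8) • e) x
            rw [hC.dist_up, abs_of_pos (by linarith)] at h1
            have : dista Ω x/(16*Λ) ≤ dista Ω x / 16 := by
              apply div_le_div_of_nonneg_left hd.le (by norm_num); linarith
            linarith
          have hwΩ := hD.half_sub hx (mem_closedBall.2 hwx)
          have hHw : ε * rk ≤ H w := by
            have h1 := hC.Hle (x + (dista Ω x/8) • e) w
            rw [hC.up, dist_comm] at h1
            have h2 : Λ * dist w (x + (dista Ω x/8) • e) ≤ Λ * (dista Ω x/(16*Λ)) := by gcongr
            have h3 : Λ * (dista Ω x/(16*Λ)) = dista Ω x/16 := by field_simp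
            have h4 : H x / (16*Λ) ≤ dista Ω x/16 := by
              rw [div_le_iff₀ (by positivity)]; linarith
            have h5 : H x * (1 + 1/(16*Λ)) ≤ H w := by
              have : H x * (1 + 1/(16*Λ)) = H x + H x/(16*Λ) := by ring
              linarith
            have h6 : ε*(lam*rk) * (1+1/(16*Λ)) ≤ H x * (1 + 1/(16*Λ)) := by gcongr
            have h7 : ε*(lam*rk) * (1+1/(16*Λ)) = ε*rk := by
              calc ε*(lam*rk) * (1+1/(16*Λ)) = ε*rk*(lam * (1+1/(16*Λ))) := by ring
                _ = _ := by rw [hlaminv]; ring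
            linarith
          have h8 := ih2 w hwΩ (hjump w (mem_closedBall.2 hwx)) hHw
          refine le_trans ?_ (le_max_left _ _)
          linarith
  obtain ⟨k, hk1, hk2⟩ := exists_nat_pow_near_of_lt_one (x := t/r) (y := lam) (by positivity)
    ((div_le_one hr).2 htr.le) hlam0 hlam1
  have hk3 : lam^(k+1)*r < t := by rwa [← lt_div_iff₀ hr]
  have hk4 : t ≤ lam^k*r := by rwa [← div_le_iff₀ hr]
  have main : ∃ j : ℕ, t < lam^j*r ∧ lam^(j+1)*r ≤ t := by
    rcases hk4.lt_or_eq with h | h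
    · exact ⟨k, h, hk3.le⟩
    · rcases k with _ | j
      · simp at h; linarith
      · refine ⟨j, ?_, h.ge⟩
        rw [h, pow_succ]
        have : 0 < lam^j*r := by positivity
        nlinarith
  obtain ⟨j, hj1, hj2⟩ := main
  have htb : dist (y + t • e) y = t := by rw [hC.dist_up, abs_of_pos ht0]
  have hHt : H (y + t • e) = t := by rw [hC.up, hy, zero_add]
  have hmem : y + t • e ∈ Ω := hC.inball (by linarith [dist_triangle (y + t • e) y z0]) (by rw [hHt]; exact ht0)
  have := (key j).2 _ hmem (by rw [htb]; exact hj1) (by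
    rw [hHt]
    refine le_trans ?_ hj2
    rw [pow_succ]
    have : 0 < lam^j*r := by positivity
    nlinarith)
  have h9 : 0 < L*a^j := by positivity
  simp only [hg] at this
  linarith

/-- boundary comparison away from a boundary point -/
lemma bhshell (hD : Dom Ω) (hC : Chart Ω z0 e H Λ R) : ∃ C : ℝ, 0 < C ∧
    ∀ (z : ES N) (r : ℝ) (f s : ES N → ℝ), H z = 0 → 0 < r → dist z z0 + (8*Λ+20)*r ≤ R →
      ContinuousOn f Ω → (∀ x ∈ Ω, r ≤ dist x z → f x ≤ AA Ω f x) →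
      (∀ x ∈ Ω, r ≤ dist x z → dist x z ≤ 5*r → f x ≤ 1) →
      (∀ y' ∈ frontier Ω, r < dist y' z → Van Ω f y') →
      Sup Ω s → PP Ω s (z + r • e) 1 →
      ∀ x ∈ Ω, 2*r ≤ dist x z → f x ≤ C * s x := by
  obtain ⟨ε, M, hε, hε1, hM, hloc⟩ := bhlocal hD hC
  have hL := hC.L0
  have hL1 := hC.L1
  obtain ⟨c, hc, hc1, hch⟩ := chain hD hC (τ := ε/8) (C := 6) (by linarith) (by norm_num)
  refine ⟨(M+1)/c, by positivity, ?_⟩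
  intro z r f s hz hr hR hf hsub hf1 hvan hs hPP
  have hzR : dist z z0 < R := by nlinarith
  have hrd : dist (z + r • e) z = r := by rw [hC.dist_up, abs_of_pos hr]
  have hlow : ∀ x ∈ Ω, dist x z ≤ 5*r → ε/8*r ≤ H x → c ≤ s x := by
    intro x hx hxz hH
    have := hch s (z + r • e) x r 1 hs zero_le_one hr (by rw [hC.up, hz]; nlinarith) hH ?_ ?_ hPP
    · simpa using this.at
    · have := dist_triangle (z + r • e) z x
      rw [dist_comm z x] at this; linarith
    · have := dist_triangle (z + r • e) z z0
      nlinarith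
  have hmid : ∀ x ∈ Ω, 2*r ≤ dist x z → dist x z ≤ 4*r → f x ≤ (M+1)/c * s x := by
    intro x hx h1 h2
    have hsn := hs.nn x hx
    have hxR : dist x z0 < R := by nlinarith [dist_triangle x z z0]
    have hHx := hC.Hpos hxR hx
    by_cases hH : r/8 ≤ H x
    · have h3 := hlow x hx (by linarith) (by nlinarith)
      have h4 := hf1 x hx (by linarith) (by linarith)
      refine h4.trans ?_
      rw [div_mul_eq_mul_div, le_div_iff₀ hc]
      nlinarith
    · push Not at hH
      set y := x + (-H x) • e with hy
      have hyx : dist y x = H x := by rw [hy, hC.dist_up, abs_neg, abs_of_pos hHx]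
      have hx' : y + H x • e = x := by rw [hy]; module
      have g1 := dist_triangle y x z
      have g2 := dist_triangle x y z
      rw [dist_comm x y] at g2
      have := hloc y (r/2) f (fun w => c⁻¹ * s w) (by rw [hy, hC.up]; ring) (by positivity) ?_ hf ?_ ?_ ?_ ?_ ?_ (H x) hHx
        (by linarith)
      · rw [hx'] at this
        refine this.trans ?_
        have e1 : M * (c⁻¹ * s x) = M/c * s x := by ring
        rw [e1]
        gcongr; linarith
      · have := dist_triangle y z z0
        nlinarith
      · intro w hw hwy
        have := dist_triangle y w z
        rw [dist_comm y w] at this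
        exact hsub w hw (by linarith)
      · intro w hw hwy
        have := dist_triangle y w z
        rw [dist_comm y w] at this
        exact hf1 w hw (by linarith) (by linarith [dist_triangle w y z])
      · intro w hw hwy
        have := dist_triangle y w z
        rw [dist_comm y w] at this
        exact hvan w hw (by linarith)
      · refine ⟨hs.cont.const_mul _ |>.congr fun _ _ => rfl, fun x hx => mul_nonneg (inv_nonneg.2 hc.le) (hs.nn x hx), fun x hx => ?_⟩
        rw [AA_smul]
        exact mul_le_mul_of_nonneg_left (hs.le x hx) (inv_nonneg.2 hc.le)
      · intro w hw hwy hHw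
        have := hlow w hw (by linarith [dist_triangle w y z]) (by nlinarith)
        rw [inv_mul_eq_div, le_div_iff₀ hc]; linarith
  have hCn : 0 ≤ (M+1)/c := by positivity
  have hmp := maxPrinciple hD (g := fun x => f x - (M+1)/c * s x) (D := {x | x ∈ Ω ∧ 4*r < dist x z})
    (hf.sub (hs.cont.const_mul _ |>.congr fun _ _ => rfl)) (fun x hx => hx.1) ?_ ?_ ?_
  · intro x hx hxr
    by_cases h : dist x z ≤ 4*r
    · exact hmid x hx hxr h
    · have := hmp x ⟨hx, not_le.1 h⟩
      linarith
  · rintro x ⟨hx, hxr⟩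
    rw [AA_sub hD (LB.of_cont hf) (LB.of_cont (hs.cont.const_mul _ |>.congr fun _ _ => rfl)) hx, AA_smul]
    have h1 := hsub x hx (by linarith)
    have h2 := mul_le_mul_of_nonneg_left (hs.le x hx) hCn
    linarith
  · rintro x ⟨hx, hxr⟩ w hw hwD
    have hwΩ := hD.half_sub hx hw
    have hwx := mem_closedBall.1 hw
    have hdr := hC.d_le hz hzR x
    have hwr : dist w z ≤ 4*r := by
      by_contra hcon; exact hwD ⟨hwΩ, not_le.1 hcon⟩
    have := dist_triangle x w z
    rw [dist_comm x w] at this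
    have := hmid w hwΩ (by linarith) hwr
    linarith
  · intro y1 hy1 ε' hε'
    by_cases h : r < dist y1 z
    · have h2 : ∀ᶠ x in 𝓝[{x | x ∈ Ω ∧ 4*r < dist x z}] y1, f x < ε' :=
        (hvan y1 hy1 h ε' hε').filter_mono (nhdsWithin_mono _ fun x hx => hx.1)
      filter_upwards [h2, self_mem_nhdsWithin] with x hx hx2
      have := mul_nonneg hCn (hs.nn x hx2.1)
      linarith
    · have : ∀ᶠ x in 𝓝 y1, dist x z < 4*r := by
        apply (continuous_id.dist continuous_const).continuousAt.eventually_lt_const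
        simp only [id]; linarith
      filter_upwards [nhdsWithin_le_nhds this, self_mem_nhdsWithin] with x hx hx2
      linarith [hx2.2]

end

section

variable {N : ℕ} {Ω : Set (ES N)}
variable {z0 e : ES N} {H : ES N → ℝ} {Λ R : ℝ}

lemma carl_pow (hD : Dom Ω) (hC : Chart Ω z0 e H Λ R) : ∃ (C0 : ℝ) (γ : ℕ), 0 < C0 ∧ γ ≠ 0 ∧
    ∀ (u : ES N → ℝ) (y x : ES N) (r : ℝ), Harm Ω u → H y = 0 → 0 < r →
      dist y z0 + (4*Λ+20)*r ≤ R → x ∈ Ω → dist x y < 2*r →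
      u x * (H x / r)^γ ≤ C0 * u (y + r • e) := by
  have hL := hC.L0
  have hL1 := hC.L1
  have hcH := cH_pos (N := N)
  obtain ⟨c3, hc3, hc31, hch⟩ := chain hD hC (τ := 1/2) (C := 4) (by norm_num) (by norm_num)
  obtain ⟨n0, hn0⟩ := exists_nat_ge (8*Λ)
  set c2 : ℝ := cH N^n0 with hc2
  have hc2p : 0 < c2 := by positivity
  obtain ⟨γ, hγ⟩ := exists_pow_lt_of_lt_one hc2p (by norm_num : (1/2:ℝ) < 1)
  have hγ' : (1/2:ℝ)^(γ+1) ≤ c2 := by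
    rw [pow_succ]; have : (0:ℝ) < (1/2)^γ := by positivity
    linarith
  refine ⟨(2*Λ)^(γ+1)/(c3*cH N), γ+1, by positivity, by simp, ?_⟩
  intro u y x r hu hy hr hR hx hxy
  have hΛr : r ≤ Λ * r := by nlinarith
  have hyR : dist y z0 < R := by nlinarith
  have hxR : dist x z0 < R := by nlinarith [dist_triangle x y z0]
  have ht0 := hC.Hpos hxR hx
  set t := H x with ht
  have ht2 : t ≤ 2*Λ*r := by
    have := hC.Hle x y
    rw [hy] at this
    nlinarith
  have hux := hu.nn x hx
  have hyre : dist (y + r • e) y = r := by rw [hC.dist_up, abs_of_pos hr]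
  have hHr : H (y + r • e) = r := by rw [hC.up, hy, zero_add]
  rw [div_mul_eq_mul_div, le_div_iff₀ (by positivity)]
  by_cases hrt : r ≤ t
  · have := (hch u x (y + r • e) r (cH N * u x) (hu.sup hD) (by positivity) hr (by linarith) (by linarith)
      (by have := dist_triangle_right x (y + r • e) y; linarith)
      (by linarith [dist_triangle x y z0]) (PP_harm hD hu hx)).at
    have h1 : (t/r)^(γ+1) ≤ (2*Λ)^(γ+1) := by
      gcongr; rw [div_le_iff₀ hr]; exact ht2
    calc u x * (t/r)^(γ+1) * (c3*cH N) = (t/r)^(γ+1) * (c3*(cH N*u x)) := by ring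
      _ ≤ (2*Λ)^(γ+1) * u (y + r • e) := by gcongr
  push Not at hrt
  have key : ∀ j : ℕ, 2^j*t ≤ r → PP Ω u (x + ((2^j-1)*t) • e) (c2^j*(cH N * u x)) := by
    intro j
    induction j with
    | zero => intro _; simpa using PP_harm hD hu hx
    | succ j ih =>
      intro hj
      rw [pow_succ] at hj
      have hp : (1:ℝ) ≤ 2^j := one_le_pow₀ (by norm_num)
      have hpt : 0 < 2^j*t := by positivity
      have h1 := ih (by linarith)
      have := PP_seg hD (hu.sup hD) (x' := x + ((2^(j+1)-1)*t) • e) (by positivity) n0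
        (d0 := 2^j*t/Λ) (by positivity) ?_ ?_ h1
      · rw [pow_succ c2, mul_comm (c2^j), mul_assoc]; exact this
      · intro τ hτ
        have e1 : x + ((2^j-1)*t) • e + τ • (x + ((2^(j+1)-1)*t) • e - (x + ((2^j-1)*t) • e))
          = x + (((2^j-1)*t) + τ*(2^j*t)) • e := by rw [pow_succ]; module
        rw [e1]
        have g1 : 0 ≤ τ*(2^j*t) := mul_nonneg hτ.1 hpt.le
        have g2 : τ*(2^j*t) ≤ 2^j*t := mul_le_of_le_one_left hpt.le hτ.2
        refine hC.dlow ?_ hpt ?_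
        · have := dist_triangle (x + (((2^j-1)*t) + τ*(2^j*t)) • e) x z0
          rw [hC.dist_up, abs_of_nonneg (by nlinarith)] at this
          linarith [dist_triangle x y z0]
        · rw [hC.up]; linarith
      · have e1 : x + ((2^(j+1)-1)*t) • e = (x + ((2^j-1)*t) • e) + (2^j*t) • e := by rw [pow_succ]; module
        rw [e1, dist_comm, hC.dist_up, abs_of_pos hpt]
        rw [mul_div_assoc', div_div, le_div_iff₀ (by positivity)]
        nlinarith
  obtain ⟨k, hk1, hk2⟩ := exists_nat_pow_near (x := r/t) (y := 2) ((one_le_div ht0).2 hrt.le) (by norm_num)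
  rw [le_div_iff₀ ht0] at hk1
  rw [div_lt_iff₀ ht0, pow_succ] at hk2
  have h1 := key k hk1
  have hp : (1:ℝ) ≤ 2^k := one_le_pow₀ (by norm_num)
  have hdk : dist (x + ((2^k-1)*t) • e) x ≤ r := by
    rw [hC.dist_up, abs_of_nonneg (by nlinarith)]; linarith
  have := (hch u _ (y + r • e) r _ (hu.sup hD) (by positivity) hr (by rw [hC.up]; linarith) (by linarith)
      (by have := dist_triangle_right (x + ((2^k-1)*t) • e) (y + r • e) y
          have := dist_triangle (x + ((2^k-1)*t) • e) x y
          linarith)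
      (by linarith [dist_triangle x y z0, dist_triangle (x + ((2^k-1)*t) • e) x z0]) h1).at
  have h2 : (t/r)^(γ+1) ≤ c2^k := by
    have g1 : t/r ≤ (1/2)^k := by
      rw [div_le_iff₀ hr, one_div, inv_pow, inv_mul_eq_div, le_div_iff₀ (by positivity)]; linarith
    calc (t/r)^(γ+1) ≤ ((1/2)^k)^(γ+1) := by gcongr
      _ = ((1/2)^(γ+1))^k := by rw [← pow_mul, ← pow_mul, mul_comm]
      _ ≤ c2^k := by gcongr
  have h3 : (1:ℝ) ≤ (2*Λ)^(γ+1) := one_le_pow₀ (by linarith)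
  have hu' : 0 ≤ u (y + r • e) := le_trans (by positivity) this
  calc u x * (t/r)^(γ+1) * (c3*cH N) = (t/r)^(γ+1) * (c3*(cH N*u x)) := by ring
      _ ≤ c2^k * (c3*(cH N*u x)) := by gcongr
      _ = c3 * (c2^k*(cH N*u x)) := by ring
      _ ≤ 1 * u (y + r • e) := by rw [one_mul]; exact this
      _ ≤ _ := by gcongr

lemma ext_cont (hD : Dom Ω) {u : ES N → ℝ} (hu : Harm Ω u) {S : Set (ES N)}
    (hvan : ∀ y' ∈ frontier Ω, y' ∈ S → Van Ω u y') : ContinuousOn (Ω.indicator u) S := by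
  intro p hp
  refine ContinuousAt.continuousWithinAt ?_
  by_cases h1 : p ∈ Ω
  · refine (hu.cont.continuousAt (hD.op.mem_nhds h1)).congr ?_
    filter_upwards [hD.op.mem_nhds h1] with w hw
    rw [indicator_of_mem hw]
  by_cases h2 : p ∈ closure Ω
  · have hf : p ∈ frontier Ω := by rw [hD.op.frontier_eq]; exact ⟨h2, h1⟩
    rw [Metric.continuousAt_iff']
    intro ε hε
    have := hvan p hf hp ε hε
    rw [eventually_nhdsWithin_iff] at this
    filter_upwards [this] with w hw
    rw [indicator_of_notMem h1, Real.dist_eq, sub_zero]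
    by_cases hwΩ : w ∈ Ω
    · rw [indicator_of_mem hwΩ, abs_of_nonneg (hu.nn w hwΩ)]; exact hw hwΩ
    · rw [indicator_of_notMem hwΩ]; simpa using hε
  · have : (fun _ => (0:ℝ)) =ᶠ[𝓝 p] Ω.indicator u := by
      filter_upwards [isClosed_closure.isOpen_compl.mem_nhds h2] with w hw
      rw [indicator_of_notMem]; exact fun hc => hw (subset_closure hc)
    exact continuousAt_const.congr this

lemma carleson (hD : Dom Ω) (hC : Chart Ω z0 e H Λ R) : ∃ C : ℝ, 0 < C ∧
    ∀ (u : ES N → ℝ) (y : ES N) (r : ℝ), Harm Ω u → H y = 0 → 0 < r →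
      dist y z0 + (4*Λ+20)*r ≤ R → (∀ y' ∈ frontier Ω, dist y' y ≤ 3*r → Van Ω u y') →
      ∀ x ∈ Ω, dist x y < r → u x ≤ C * u (y + r • e) := by
  obtain ⟨C0, γ, hC0, hγ, hpow⟩ := carl_pow hD hC
  obtain ⟨θ, hθ0, hθ1, hdec⟩ := decayn hD hC
  have hL := hC.L0
  have hL1 := hC.L1
  obtain ⟨n, hn⟩ := exists_pow_lt_of_lt_one (by positivity : (0:ℝ) < 1/2/2^γ) hθ1
  set ε : ℝ := 1/(4*8^n) with hε
  have hε0 : 0 < ε := by positivity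
  have hε4 : ε ≤ 1/4 := by
    rw [hε]; apply div_le_div_of_nonneg_left (by norm_num) (by norm_num)
    have : (1:ℝ) ≤ 8^n := one_le_pow₀ (by norm_num)
    linarith
  refine ⟨C0/ε^γ, by positivity, ?_⟩
  intro u y r hu hy hr hR hvan x hx hxr
  have hΛr : r ≤ Λ * r := by nlinarith
  have hure : 0 ≤ u (y + r • e) := by
    apply hu.nn; refine hC.inball ?_ ?_
    · have := dist_triangle (y + r • e) y z0
      rw [hC.dist_up, abs_of_pos hr] at this; linarith
    · rw [hC.up, hy]; linarith
  set G : ES N → ℝ := fun w => Ω.indicator u w * (2*r - dist w y)^γ with hG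
  have hGc : ContinuousOn G (closedBall y (2*r)) := by
    refine (ext_cont hD hu fun y' h1 h2 => hvan y' h1 (by linarith [mem_closedBall.1 h2])).mul ?_
    fun_prop
  obtain ⟨p, hp, hmax⟩ := (isCompact_closedBall y (2*r)).exists_isMaxOn ⟨y, mem_closedBall_self (by linarith)⟩ hGc
  have hGx : G x = u x * (2*r - dist x y)^γ := by simp only [hG]; rw [indicator_of_mem hx]
  have hGxp : G x ≤ G p := hmax (mem_closedBall.2 (by linarith))
  have hrx : r^γ ≤ (2*r - dist x y)^γ := by gcongr; linarith
  have hux := hu.nn x hx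
  have h1 : u x * r^γ ≤ G p := by
    refine le_trans ?_ hGxp
    rw [hGx]; gcongr
  have hp' := mem_closedBall.1 hp
  by_cases hGp : G p ≤ 0
  · have : u x * r^γ ≤ 0 := h1.trans hGp
    have : u x ≤ 0 := by
      by_contra hcon
      have := mul_pos (not_le.1 hcon) (pow_pos hr γ)
      linarith
    exact this.trans (by positivity)
  push Not at hGp
  have hpΩ : p ∈ Ω := by
    by_contra hcon
    simp only [hG] at hGp
    rw [indicator_of_notMem hcon, zero_mul] at hGp; exact lt_irrefl _ hGp
  have hGpe : G p = u p * (2*r - dist p y)^γ := by simp only [hG]; rw [indicator_of_mem hpΩ]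
  set D := 2*r - dist p y with hDdef
  have hD0 : 0 < D := by
    rcases (sub_nonneg.2 hp').lt_or_eq with h | h
    · exact h
    · exfalso
      rw [hGpe, hDdef, ← h, zero_pow hγ, mul_zero] at hGp; exact lt_irrefl _ hGp
  have hup : 0 < u p := by
    rw [hGpe] at hGp
    exact pos_of_mul_pos_left hGp (by positivity)
  have hpR : dist p z0 < R := by linarith [dist_triangle p y z0]
  have hHp := hC.Hpos hpR hpΩ
  by_cases hcase : ε * D ≤ H p
  · have h2 := hpow u y p r hu hy hr hR hpΩ (by linarith)
    have h3 : u p * (ε*D/r)^γ ≤ C0 * u (y + r • e) := by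
      refine le_trans ?_ h2; gcongr
    have h4 : u p * (ε*D/r)^γ = G p * ε^γ / r^γ := by
      rw [hGpe, div_pow, mul_pow]; ring
    rw [h4, div_le_iff₀ (by positivity)] at h3
    rw [div_mul_eq_mul_div, le_div_iff₀ (by positivity)]
    have h5 : (u x * ε^γ) * r^γ ≤ (C0 * u (y + r • e)) * r^γ := by
      refine le_trans ?_ h3
      calc (u x * ε^γ) * r^γ = (u x * r^γ) * ε^γ := by ring
        _ ≤ _ := by gcongr
    exact le_of_mul_le_mul_right h5 (by positivity)
  exfalso
  push Not at hcase
  set y2 := p + (-H p) • e with hy2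
  have hd2 : dist y2 p = H p := by rw [hy2, hC.dist_up, abs_neg, abs_of_pos hHp]
  have hD2 : D ≤ 2*r := by rw [hDdef]; linarith [dist_nonneg (x := p) (y := y)]
  have hεD : ε*D ≤ 1/4*D := by gcongr
  have g3 := dist_triangle y2 p y
  have := hdec y2 (D/4) (2^γ * u p) u (by rw [hy2, hC.up]; ring) (by positivity)
    (by linarith [dist_triangle y2 y z0]) (by positivity) hu.cont
    (fun w hw _ => (hu.AA_eq hD hw).ge) ?_ (fun w hw hwd => hvan w hw ?_) n p hpΩ ?_
  · have h6 : θ^n * (2^γ*u p) < u p := by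
      have : θ^n * 2^γ < 1 := by
        rw [lt_div_iff₀ (by positivity)] at hn; linarith
      calc θ^n * (2^γ*u p) = (θ^n*2^γ)*u p := by ring
        _ < 1 * u p := by gcongr
        _ = u p := one_mul _
    linarith
  · intro w hw hwd
    have g1 := dist_triangle w y2 p
    have g2 := dist_triangle w p y
    have hwb : w ∈ closedBall y (2*r) := mem_closedBall.2 (by linarith)
    have hGw : G w ≤ G p := hmax hwb
    have hGwe : G w = u w * (2*r - dist w y)^γ := by simp only [hG]; rw [indicator_of_mem hw]
    rw [hGwe, hGpe] at hGw
    have h7 : (D/2)^γ ≤ (2*r - dist w y)^γ := by gcongr; linarith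
    have huw := hu.nn w hw
    have h8 : u w * (D/2)^γ ≤ u p * D^γ := le_trans (by gcongr) hGw
    rw [div_pow, mul_div_assoc', div_le_iff₀ (by positivity)] at h8
    have h9 : u w * D^γ ≤ (2^γ*u p)*D^γ := by linarith
    exact le_of_mul_le_mul_right h9 (by positivity)
  · linarith [dist_triangle w y2 y]
  · rw [dist_comm, hd2]
    have : ε * D = D/4/8^n := by rw [hε]; field_simp
    linarith

end

section

variable {N : ℕ} {Ω : Set (ES N)}
variable {z0 e : ES N} {H : ES N → ℝ} {Λ R : ℝ}

lemma Sup.smul {s : ES N → ℝ} (hs : Sup Ω s) {c : ℝ} (hc : 0 ≤ c) : Sup Ω (fun x => c * s x) := by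
  refine ⟨hs.cont.const_mul _ |>.congr fun _ _ => rfl, fun x hx => mul_nonneg hc (hs.nn x hx), fun x hx => ?_⟩
  rw [AA_smul]
  exact mul_le_mul_of_nonneg_left (hs.le x hx) hc

lemma PP.smul {s : ES N → ℝ} {x : ES N} {m c : ℝ} (hc : 0 ≤ c) (h : PP Ω s x m) :
    PP Ω (fun x => c * s x) x (c * m) := fun w hw => mul_le_mul_of_nonneg_left (h w hw) hc

lemma bhshell' (hD : Dom Ω) (hC : Chart Ω z0 e H Λ R) : ∃ C : ℝ, 0 < C ∧
    ∀ (z : ES N) (r m m' : ℝ) (f s : ES N → ℝ), H z = 0 → 0 < r → dist z z0 + (8*Λ+20)*r ≤ R →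
      0 < m → 0 < m' →
      ContinuousOn f Ω → (∀ x ∈ Ω, r ≤ dist x z → f x ≤ AA Ω f x) →
      (∀ x ∈ Ω, r ≤ dist x z → dist x z ≤ 5*r → f x ≤ m) →
      (∀ y' ∈ frontier Ω, r < dist y' z → Van Ω f y') →
      Sup Ω s → PP Ω s (z + r • e) m' →
      ∀ x ∈ Ω, 2*r ≤ dist x z → f x ≤ C * (m / m') * s x := by
  obtain ⟨C, hC0, h⟩ := bhshell hD hC
  refine ⟨C, hC0, ?_⟩
  intro z r m m' f s hz hr hR hm hm' hf hsub hf1 hvan hs hPP x hx hxr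
  have := h z r (fun x => m⁻¹ * f x) (fun x => m'⁻¹ * s x) hz hr hR
    (hf.const_mul _ |>.congr fun _ _ => rfl) ?_ ?_ ?_ (hs.smul (by positivity)) ?_ x hx hxr
  · rw [inv_mul_le_iff₀ hm] at this
    refine this.trans (le_of_eq ?_)
    field_simp
  · intro x hx hxr
    rw [AA_smul]
    exact mul_le_mul_of_nonneg_left (hsub x hx hxr) (by positivity)
  · intro x hx h1 h2
    rw [inv_mul_le_iff₀ hm, mul_one]; exact hf1 x hx h1 h2
  · intro y' hy' hd ε hε
    filter_upwards [hvan y' hy' hd (m*ε) (by positivity)] with w hw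
    rwa [inv_mul_lt_iff₀ hm]
  · have := hPP.smul (inv_nonneg.2 hm'.le)
    rwa [inv_mul_cancel₀ hm'.ne'] at this

lemma shellbd (hD : Dom Ω) (hC : Chart Ω z0 e H Λ R) : ∃ C : ℝ, 0 < C ∧
    ∀ (u : ES N → ℝ) (z : ES N) (r : ℝ), Harm Ω u → H z = 0 → 0 < r → dist z z0 + (8*Λ+40)*r ≤ R →
      (∀ y' ∈ frontier Ω, y' ≠ z → Van Ω u y') →
      ∀ x ∈ Ω, r/2 ≤ dist x z → dist x z ≤ 6*r → u x ≤ C * u (z + r • e) := by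
  obtain ⟨C1, hC1, hcar⟩ := carleson hD hC
  obtain ⟨c, hc, hc1, hch⟩ := chain hD hC (τ := 1/16) (C := 8) (by norm_num) (by norm_num)
  have hcH := cH_pos (N := N)
  have hL := hC.L0
  refine ⟨(C1+1)/(c*cH N), by positivity, ?_⟩
  intro u z r hu hz hr hR hvan x hx h1 h2
  have hΛr : 0 < Λ*r := by positivity
  have hzre : dist (z + r • e) z = r := by rw [hC.dist_up, abs_of_pos hr]
  have hHr : H (z + r • e) = r := by rw [hC.up, hz, zero_add]
  have hxR : dist x z0 < R := by linarith [dist_triangle x z z0]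
  have key : ∀ w, 1/16*r ≤ H w → dist w z ≤ 7*r → u w ≤ (c*cH N)⁻¹ * u (z + r • e) := by
    intro w hw1 hw2
    have hwz := dist_triangle w z z0
    have hwΩ : w ∈ Ω := hC.inball (by linarith) (by linarith)
    have huw := hu.nn w hwΩ
    have := (hch u w (z + r • e) r (cH N * u w) (hu.sup hD) (by positivity) hr hw1 (by linarith)
      (by have := dist_triangle_right w (z + r • e) z; linarith)
      (by linarith) (PP_harm hD hu hwΩ)).at
    rw [inv_mul_eq_div, le_div_iff₀ (by positivity)]; linarith
  have hure : 0 ≤ u (z + r • e) := hu.nn _ (hC.inball (by linarith [dist_triangle (z + r • e) z z0]) (by linarith))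
  have e1 : (C1+1)/(c*cH N) = (C1+1) * (c*cH N)⁻¹ := by ring
  have hcc : 0 ≤ (c*cH N)⁻¹ * u (z + r • e) := by positivity
  rw [e1, mul_assoc]
  by_cases hH : 1/16*r ≤ H x
  · have := key x hH (by linarith)
    nlinarith
  push Not at hH
  have hHx := hC.Hpos hxR hx
  set y := x + (-H x) • e with hy
  have hyx : dist y x = H x := by rw [hy, hC.dist_up, abs_neg, abs_of_pos hHx]
  have g1 := dist_triangle y x z
  have g2 := dist_triangle x y z
  rw [dist_comm x y] at g2
  have hHy : H y = 0 := by rw [hy, hC.up]; ring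
  have h3 := hcar u y (r/8) hu hHy (by positivity)
    (by linarith [dist_triangle y z z0]) (fun y' hy' hd => hvan y' hy' (by
      rintro rfl
      rw [dist_comm] at hd; linarith)) x hx (by rw [dist_comm, hyx]; linarith)
  have h4 := key (y + (r/8) • e) (by rw [hC.up, hHy]; linarith) (by
    have := dist_triangle (y + (r/8) • e) y z
    rw [hC.dist_up, abs_of_pos (by linarith)] at this
    linarith)
  calc u x ≤ C1 * u (y + (r/8) • e) := h3
    _ ≤ C1 * ((c*cH N)⁻¹ * u (z + r • e)) := by gcongr
    _ ≤ _ := by linarith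

lemma harnack34 (hD : Dom Ω) {u : ES N → ℝ} (hu : Harm Ω u) {x w : ES N} (hx : x ∈ Ω)
    (hw : dist w x ≤ 3/4 * dista Ω x) : u w ≤ (cH N^25)⁻¹ * u x := by
  have hd := hD.dpos hx
  have hcH := cH_pos (N := N)
  have hwΩ : w ∈ Ω := mem_of_dist_lt (by linarith)
  have huw := hu.nn w hwΩ
  have := (PP_seg hD (hu.sup hD) (x := w) (x' := x) (m := cH N * u w) (by positivity) 24
    (d0 := dista Ω x / 4) (by positivity) ?_ (by push_cast; linarith) (PP_harm hD hu hwΩ)).at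
  · rw [inv_mul_eq_div, le_div_iff₀ (by positivity)]
    rw [pow_succ]; linarith
  · intro τ hτ
    have h1 : dist (w + τ • (x - w)) x ≤ 3/4 * dista Ω x := by
      have e1 : w + τ • (x - w) - x = (1-τ) • (w - x) := by module
      rw [dist_eq_norm, e1, norm_smul, Real.norm_of_nonneg (by linarith [hτ.2]), ← dist_eq_norm]
      nlinarith [hτ.1, hτ.2, dist_nonneg (x := w) (y := x)]
    linarith [dista_lip' (Ω := Ω) x (w + τ • (x - w))]

structure Ker (Ω : Set (ES N)) (x0 z : ES N) (K : ES N → ℝ) : Prop where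
  harm : Harm Ω K
  pos : ∀ x ∈ Ω, 0 < K x
  one : K x0 = 1
  van : ∀ y ∈ frontier Ω, y ≠ z → Van Ω K y

lemma Ker.of_martin (hD : Dom Ω) {x0 z : ES N} {K : ES N → ℝ}
    (h : IsMartinKernel Ω (fun _ => 0) x0 z K) : Ker Ω x0 z K := by
  refine ⟨⟨h.1.1, fun x hx => (h.2.1 x hx).le, fun x hx t ht htd => ?_⟩, h.2.1, h.2.2.1, ?_⟩
  · exact Av_eq_of_harmonic h.1 (T := (t + dista Ω x)/2) (cball_sub (by linarith)) ht (by linarith)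
  · intro y hy hyz ε hε
    exact (h.2.2.2 y hy hyz).eventually_lt_const hε

/-- uniform vanishing of kernels at boundary points -/
lemma unif_van (hD : Dom Ω) (hΩ : IsLipschitzDomain Ω) {x0 y : ES N} (hx0 : x0 ∈ Ω)
    (hy : y ∈ frontier Ω) {τ ε : ℝ} (hτ : 0 < τ) (hε : 0 < ε) :
    ∃ ρ : ℝ, 0 < ρ ∧ ∀ z K, Ker Ω x0 z K → τ ≤ dist z y → ∀ x ∈ Ω, dist x y < ρ → K x ≤ ε := by
  obtain ⟨e, H, Λ, R, hC⟩ := exists_chart hD hΩ hy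
  obtain ⟨C1, hC1, hcar⟩ := carleson hD hC
  obtain ⟨θ, hθ0, hθ1, hdec⟩ := decayn hD hC
  have hL := hC.L0
  have hR := hC.R0
  set r := min (R/(4*Λ+20)) (τ/4) with hr
  have hr0 : 0 < r := lt_min (by positivity) (by positivity)
  have hrR : (4*Λ+20)*r ≤ R := by
    have : r ≤ R/(4*Λ+20) := min_le_left _ _
    rw [le_div_iff₀ (by positivity)] at this; linarith
  have hrτ : r ≤ τ/4 := min_le_right _ _
  have hHy : H y = 0 := hC.frontier_zero hD hy (by simpa using hR)
  have hrr : r < R := by nlinarith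
  have hp : y + r • e ∈ Ω := hC.inball (by rw [hC.dist_up, abs_of_pos hr0]; exact hrr) (by rw [hC.up, hHy]; linarith)
  obtain ⟨C2, hC2, hgl⟩ := global_harnack hD hp hx0
  obtain ⟨n, hn⟩ := exists_pow_lt_of_lt_one (by positivity : (0:ℝ) < ε/(C1*C2)) hθ1
  refine ⟨r/8^n, by positivity, ?_⟩
  intro z K hK hz x hx hxr
  have hv : ∀ y' ∈ frontier Ω, dist y' y ≤ 3*r → Van Ω K y' := fun y' hy' hd => hK.van y' hy' (by
    rintro rfl; linarith)
  have h1 := hdec y r (C1*C2) K hHy hr0 (by simpa using hrr.le) (by positivity) hK.harm.cont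
    (fun w hw _ => (hK.harm.AA_eq hD hw).ge) ?_ (fun y' hy' hd => hv y' hy' (by linarith)) n x hx hxr
  · refine h1.trans ?_
    rw [lt_div_iff₀ (by positivity)] at hn
    linarith
  · intro w hw hwd
    have h2 := hcar K y r hK.harm hHy hr0 (by simpa using hrR) hv w hw hwd
    have h3 := hgl K hK.harm
    rw [hK.one, mul_one] at h3
    exact h2.trans (by gcongr)

end

section

variable {N : ℕ} {Ω : Set (ES N)}
variable {z0 e : ES N} {H : ES N → ℝ} {Λ R : ℝ}

/-- `A`-invariant functions dominated by a harmonic one -/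
structure QK (Ω : Set (ES N)) (K q : ES N → ℝ) (C : ℝ) : Prop where
  cont : ContinuousOn q Ω
  nn : ∀ x ∈ Ω, 0 ≤ q x
  eq : ∀ x ∈ Ω, AA Ω q x = q x
  le : ∀ x ∈ Ω, q x ≤ C * K x

lemma QK.sup {K q : ES N → ℝ} {C : ℝ} (h : QK Ω K q C) : Sup Ω q := ⟨h.cont, h.nn, fun x hx => (h.eq x hx).le⟩

lemma AA_modulus' (hD : Dom Ω) {ε : ℝ} (hε : 0 < ε) : ∃ η : ℝ, 0 < η ∧ η ≤ 1/16 ∧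
    ∀ (K f : ES N → ℝ) (C : ℝ), 0 ≤ C → Harm Ω K → LB Ω f → (∀ x ∈ Ω, |f x| ≤ C * K x) →
      ∀ x ∈ Ω, ∀ x', dist x' x ≤ η * dista Ω x → |AA Ω f x - AA Ω f x'| ≤ ε * C * K x := by
  have hcH := cH_pos (N := N)
  obtain ⟨η, h0, h1, h⟩ := AA_modulus N (ε := ε * cH N ^ 25) (by positivity)
  refine ⟨η/2, by positivity, by linarith, ?_⟩
  intro K f C hC hK hf hfK x hx x' hxx
  have hd := hD.dpos hx
  have := h Ω x x' f (C * ((cH N^25)⁻¹ * K x)) hd (by rw [dist_comm]; nlinarith) (hf.int (by linarith)) ?_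
  · calc _ ≤ _ := this
      _ = _ := by field_simp
  · intro w hw
    have hw' := mem_closedBall.1 hw
    exact (hfK w (mem_of_dist_lt (by linarith))).trans
      (mul_le_mul_of_nonneg_left (harnack34 hD hK hx hw') hC)

lemma lemA (hD : Dom Ω) (hC : Chart Ω z0 e H Λ R) {τ ε C0 : ℝ} (hτ : 0 < τ) (hτ1 : τ ≤ 1) (hε : 0 < ε)
    (hC0 : 0 < C0) :
    ∃ C : ℝ, 0 < C ∧ ∀ (K q : ES N → ℝ) (z : ES N) (r : ℝ), Harm Ω K → (∀ x ∈ Ω, 0 < K x) →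
      H z = 0 → 0 < r → dist z z0 + (8*Λ+40)*r ≤ R →
      (∀ y' ∈ frontier Ω, y' ≠ z → Van Ω K y') → QK Ω K q C0 →
      (∃ x ∈ Ω, dist x z ≤ 5*r ∧ τ*r ≤ H x ∧ ε * K x ≤ q x) →
      ∀ x ∈ Ω, 2*r ≤ dist x z → K x ≤ C * q x := by
  obtain ⟨η, h0, h1, hmod⟩ := AA_modulus' hD (ε := ε/(2*C0)) (by positivity)
  obtain ⟨Cb, hCb, hbh⟩ := bhshell' hD hC
  obtain ⟨Cs, hCs, hsh⟩ := shellbd hD hC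
  obtain ⟨c, hc, hc1, hch⟩ := chain hD hC (τ := τ) (C := 6) hτ (by norm_num)
  have hcH := cH_pos (N := N)
  have hL := hC.L0
  refine ⟨Cb * (Cs / (c * (cH N * η^N * (ε/2 * (c * cH N))))), by positivity, ?_⟩
  rintro K q z r hK hKp hz hr hR hvan hq ⟨x, hx, hxr, hHx, hxq⟩ w hw hwr
  have hd := hD.dpos hx
  have hΛr : 0 < Λ*r := by positivity
  have hHr : H (z + r • e) = r := by rw [hC.up, hz, zero_add]
  have hzre : dist (z + r • e) z = r := by rw [hC.dist_up, abs_of_pos hr]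
  have hp : z + r • e ∈ Ω := hC.inball (by linarith [dist_triangle (z + r • e) z z0]) (by linarith)
  have hKr := hKp _ hp
  have hKx := hKp _ hx
  have hτr : τ * r ≤ r := by nlinarith
  have e1 : PP Ω q x (cH N * η^N * (ε/2 * K x)) := by
    refine PP_small hD hq.sup hx (by positivity) h0 h1 fun w hw => ?_
    have hwΩ : w ∈ Ω := mem_of_dist_lt (by nlinarith)
    have := hmod K q C0 hC0.le hK (LB.of_cont hq.cont) (fun x hx => by
      rw [abs_of_nonneg (hq.nn x hx)]; exact hq.le x hx) x hx w hw
    rw [hq.eq x hx, hq.eq w hwΩ] at this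
    have e2 : ε/(2*C0)*C0*K x = ε/2*K x := by field_simp
    rw [e2] at this
    linarith [(abs_le.1 this).2]
  have hdx : dist x (z + r • e) ≤ 6*r := by
    have := dist_triangle_right x (z + r • e) z; linarith
  have hxz := dist_triangle x z z0
  have hcH' := hch K (z + r • e) x r (cH N * K (z + r • e)) (hK.sup hD) (by positivity) hr (by linarith) hHx
    (by rw [dist_comm]; exact hdx) (by linarith [dist_triangle (z + r • e) z z0]) (PP_harm hD hK hp) |>.at
  have e3 : PP Ω q (z + r • e) (c * (cH N * η^N * (ε/2 * K x))) :=
    hch q x (z + r • e) r _ hq.sup (by positivity) hr hHx (by linarith) hdx (by linarith) e1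
  have e4 : PP Ω q (z + r • e) (c * (cH N * η^N * (ε/2 * (c * cH N))) * K (z + r • e)) := by
    intro w hw
    refine le_trans ?_ (e3 w hw)
    calc c * (cH N * η^N * (ε/2 * (c * cH N))) * K (z + r • e)
        = c * (cH N * η^N * (ε/2 * (c * (cH N * K (z + r • e))))) := by ring
      _ ≤ _ := by gcongr
  have := hbh z r (Cs * K (z + r • e)) (c * (cH N * η^N * (ε/2 * (c * cH N))) * K (z + r • e)) K q hz hr
    (by linarith) (by positivity) (by positivity) hK.cont (fun x hx _ => (hK.AA_eq hD hx).ge)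
    (fun x hx h1 h2 => hsh K z r hK hz hr hR hvan x hx (by linarith) (by linarith))
    (fun y' hy' hd => hvan y' hy' (by rintro rfl; simp at hd; linarith)) hq.sup e4 w hw hwr
  rwa [mul_div_mul_right _ _ hKr.ne'] at this

lemma lemB (hD : Dom Ω) (hC : Chart Ω z0 e H Λ R) :
    ∃ C : ℝ, 0 < C ∧ ∀ ε C0 : ℝ, 0 < ε → 0 < C0 → ∃ τ : ℝ, 0 < τ ∧ τ ≤ 1 ∧
      ∀ (K q : ES N → ℝ) (z : ES N) (r : ℝ), Harm Ω K → (∀ x ∈ Ω, 0 < K x) →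
      H z = 0 → 0 < r → dist z z0 + (8*Λ+40)*r ≤ R →
      (∀ y' ∈ frontier Ω, y' ≠ z → Van Ω K y') → QK Ω K q C0 →
      (∀ x ∈ Ω, r ≤ dist x z → dist x z ≤ 5*r → τ*r ≤ H x → q x ≤ ε * K x) →
      ∀ x ∈ Ω, 2*r ≤ dist x z → q x ≤ C * ε * K x := by
  obtain ⟨Cb, hCb, hbh⟩ := bhshell' hD hC
  obtain ⟨Cs, hCs, hsh⟩ := shellbd hD hC
  obtain ⟨θ, hθ0, hθ1, hdec⟩ := decayn hD hC
  have hcH := cH_pos (N := N)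
  have hL := hC.L0
  refine ⟨Cb * (Cs / cH N), by positivity, ?_⟩
  intro ε C0 hε hC0
  obtain ⟨n, hn⟩ := exists_pow_lt_of_lt_one (show 0 < ε / C0 by positivity) hθ1
  rw [lt_div_iff₀ hC0] at hn
  refine ⟨1/(4*8^n)/2, by positivity, ?_, ?_⟩
  · have : (1:ℝ) ≤ 8^n := one_le_pow₀ (by norm_num)
    rw [div_div, div_le_one (by positivity)]; linarith
  intro K q z r hK hKp hz hr hR hvan hq hA w hw hwr
  have hΛr : 0 < Λ*r := by positivity
  have hHr : H (z + r • e) = r := by rw [hC.up, hz, zero_add]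
  have hzre : dist (z + r • e) z = r := by rw [hC.dist_up, abs_of_pos hr]
  have hp : z + r • e ∈ Ω := hC.inball (by linarith [dist_triangle (z + r • e) z z0]) (by linarith)
  have hKr := hKp _ hp
  have hshell := hsh K z r hK hz hr hR hvan
  have h8 : (1:ℝ)/(4*8^n) ≤ 1/4 := by
    have : (1:ℝ) ≤ 8^n := one_le_pow₀ (by norm_num)
    apply one_div_le_one_div_of_le <;> linarith
  have hvq : ∀ y' ∈ frontier Ω, y' ≠ z → Van Ω q y' := by
    intro y' hy' hne δ hδ
    filter_upwards [hvan y' hy' hne (δ/C0) (by positivity), self_mem_nhdsWithin] with x hx hxΩ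
    rw [lt_div_iff₀ hC0] at hx
    linarith [hq.le x hxΩ]
  have hbd : ∀ x ∈ Ω, r ≤ dist x z → dist x z ≤ 5*r → q x ≤ ε * (Cs * K (z + r • e)) := by
    intro x hx h1 h2
    by_cases hH : 1/(4*8^n)/2*r ≤ H x
    · exact (hA x hx h1 h2 hH).trans (mul_le_mul_of_nonneg_left (hshell x hx (by linarith) (by linarith)) hε.le)
    push Not at hH
    have hxz := dist_triangle x z z0
    have hHx := hC.Hpos (by linarith) hx
    set y := x + (-H x) • e with hy
    have hyx : dist y x = H x := by rw [hy, hC.dist_up, abs_neg, abs_of_pos hHx]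
    have hHy : H y = 0 := by rw [hy, hC.up]; ring
    have hHr' : H x < r/4/8^n := by
      have e1 : 1/(4*8^n)/2*r = r/4/8^n/2 := by field_simp
      have : 0 < r/4/8^n := by positivity
      linarith
    have hH4 : H x < r/8 := by
      have : 1/(4*8^n)/2*r ≤ 1/4/2*r := by gcongr
      linarith
    have g1 := dist_triangle y x z
    have g2 := dist_triangle x y z
    rw [dist_comm x y] at g2
    have := hdec y (r/4) (C0 * (Cs * K (z + r • e))) q hHy (by positivity)
      (by linarith [dist_triangle y z z0]) (by positivity) hq.cont (fun x hx _ => (hq.eq x hx).ge)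
      (fun x' hx' hd => (hq.le x' hx').trans (by
        gcongr
        have g3 := dist_triangle x' y z
        have g4 := dist_triangle_left y z x'
        exact hshell x' hx' (by linarith) (by linarith)))
      (fun y' hy' hd => hvq y' hy' (by
        rintro rfl
        rw [dist_comm] at hd; linarith)) n x hx (by rw [dist_comm, hyx]; exact hHr')
    calc q x ≤ _ := this
      _ = θ^n * C0 * (Cs * K (z + r • e)) := by ring
      _ ≤ _ := by gcongr
  have := hbh z r (ε * (Cs * K (z + r • e))) (cH N * K (z + r • e)) q K hz hr
    (by linarith) (by positivity) (by positivity) hq.cont (fun x hx _ => (hq.eq x hx).ge)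
    hbd (fun y' hy' hd => hvq y' hy' (by rintro rfl; simp at hd; linarith)) (hK.sup hD)
    (PP_harm hD hK hp) w hw hwr
  calc q w ≤ _ := this
    _ = _ := by field_simp

lemma dist_pos_of_frontier (hD : Dom Ω) {x z : ES N} (hx : x ∈ Ω) (hz : z ∈ frontier Ω) : 0 < dist x z := by
  rw [dist_pos]; rintro rfl
  rw [hD.op.frontier_eq] at hz; exact hz.2 hx

lemma UQ (hD : Dom Ω) (hΩ : IsLipschitzDomain Ω) {z : ES N} (hz : z ∈ frontier Ω) {K q : ES N → ℝ} {C : ℝ}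
    (hCp : 0 < C)
    (hK : Harm Ω K) (hKp : ∀ x ∈ Ω, 0 < K x) (hvan : ∀ y' ∈ frontier Ω, y' ≠ z → Van Ω K y')
    (hq : QK Ω K q C) : ∃ c, 0 ≤ c ∧ ∀ x ∈ Ω, q x = c * K x := by
  obtain ⟨e, H, Λ, R, hC⟩ := exists_chart hD hΩ hz
  have hHz : H z = 0 := hC.frontier_zero hD hz (by simpa using hC.R0)
  have hL := hC.L0
  have hR := hC.R0
  obtain ⟨x1, hx1⟩ := hD.conn.nonempty
  have hK1 := hKp x1 hx1
  set S := {c : ℝ | 0 ≤ c ∧ ∀ x ∈ Ω, c * K x ≤ q x} with hS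
  have hS0 : (0:ℝ) ∈ S := ⟨le_rfl, fun x hx => by simpa using hq.nn x hx⟩
  have hSb : BddAbove S := ⟨C, fun c hc => by
    have := (hc.2 x1 hx1).trans (hq.le x1 hx1)
    exact le_of_mul_le_mul_right this hK1⟩
  set c := sSup S with hcdef
  have hc0 : 0 ≤ c := le_csSup hSb hS0
  have hcS : ∀ x ∈ Ω, c * K x ≤ q x := by
    intro x hx
    rw [← le_div_iff₀ (hKp x hx)]
    exact csSup_le ⟨0, hS0⟩ fun d hd => by rw [le_div_iff₀ (hKp x hx)]; exact hd.2 x hx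
  refine ⟨c, hc0, ?_⟩
  have hq' : QK Ω K (fun x => q x - c * K x) C := by
    refine ⟨hq.cont.sub (hK.cont.const_mul _ |>.congr fun _ _ => rfl), fun x hx => by linarith [hcS x hx],
      fun x hx => ?_, fun x hx => ?_⟩
    · rw [AA_sub hD (LB.of_cont hq.cont) (LB.of_cont (hK.cont.const_mul _ |>.congr fun _ _ => rfl)) hx,
        AA_smul, hq.eq x hx, hK.AA_eq hD hx]
    · have := hq.le x hx
      have := mul_nonneg hc0 (hKp x hx).le
      linarith
  have hno : ∀ d > 0, ¬ ∀ x ∈ Ω, K x ≤ d * (q x - c * K x) := by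
    intro d hd h
    have : c + d⁻¹ ∈ S := ⟨by positivity, fun x hx => by
      have := h x hx
      rw [← div_le_iff₀' hd] at this
      rw [div_eq_inv_mul] at this
      linarith⟩
    have := le_csSup hSb this
    have : 0 < d⁻¹ := by positivity
    linarith
  obtain ⟨C6, hC6, hB⟩ := lemB hD hC
  set q' := fun x => q x - c * K x with hq'def
  have main : ∀ ε > 0, ∀ x ∈ Ω, q' x ≤ C6 * ε * K x := by
    intro ε hε
    obtain ⟨τ, hτ, hτ1, hB'⟩ := hB ε C hε hCp
    obtain ⟨C5, hC5, hA⟩ := lemA hD hC hτ hτ1 hε hCp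
    by_cases hcase : ∀ ρ > 0, ∃ r, 0 < r ∧ r < ρ ∧ ∃ x ∈ Ω, dist x z ≤ 5*r ∧ τ*r ≤ H x ∧ ε * K x ≤ q' x
    · exfalso
      refine hno C5 hC5 fun x hx => ?_
      have hdx := dist_pos_of_frontier hD hx hz
      obtain ⟨r, hr0, hr, h⟩ := hcase (min (R/(8*Λ+40)) (dist x z/2)) (by positivity)
      have h1 := hr.trans_le (min_le_left _ _)
      have h2 := hr.trans_le (min_le_right _ _)
      rw [lt_div_iff₀ (by positivity)] at h1
      exact hA K q' z r hK hKp hHz hr0 (by rw [dist_self]; linarith) hvan hq' h x hx (by linarith)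
    · push Not at hcase
      obtain ⟨ρ, hρ, h⟩ := hcase
      intro x hx
      have hdx := dist_pos_of_frontier hD hx hz
      set r := min (ρ/2) (min (R/(8*Λ+40)) (dist x z/2)) with hr
      have hr0 : 0 < r := by positivity
      have h1 : r ≤ R/(8*Λ+40) := (min_le_right _ _).trans (min_le_left _ _)
      have h2 : r ≤ dist x z/2 := (min_le_right _ _).trans (min_le_right _ _)
      have h3 : r ≤ ρ/2 := min_le_left _ _
      rw [le_div_iff₀ (by positivity)] at h1
      exact hB' K q' z r hK hKp hHz hr0 (by rw [dist_self]; linarith) hvan hq'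
        (fun w hw _ hw2 hw3 => (h r hr0 (by linarith) w hw hw2 hw3).le) x hx (by linarith)
  intro x hx
  have hKx := hKp x hx
  have : q' x ≤ 0 := by
    refine le_of_forall_pos_le_add fun δ hδ => ?_
    have := main (δ/(C6 * K x)) (by positivity) x hx
    have e1 : C6 * (δ/(C6 * K x)) * K x = δ := by field_simp
    linarith
  have h2 := hq'.nn x hx
  simp only [hq'def] at this h2
  linarith

lemma kcmp (hD : Dom Ω) (hΩ : IsLipschitzDomain Ω) {z x0 : ES N} (hz : z ∈ frontier Ω) (hx0 : x0 ∈ Ω)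
    {K K' : ES N → ℝ} (hK : Ker Ω x0 z K) (hK' : Ker Ω x0 z K') : ∃ C, 0 < C ∧ ∀ x ∈ Ω, K x ≤ C * K' x := by
  obtain ⟨e, H, Λ, R, hC⟩ := exists_chart hD hΩ hz
  have hHz : H z = 0 := hC.frontier_zero hD hz (by simpa using hC.R0)
  have hL := hC.L0
  have hR := hC.R0
  obtain ⟨Cb, hCb, hbh⟩ := bhshell' hD hC
  obtain ⟨Cs, hCs, hsh⟩ := shellbd hD hC
  have hcH := cH_pos (N := N)
  have key : ∀ K K' : ES N → ℝ, Ker Ω x0 z K → Ker Ω x0 z K' → ∀ r, 0 < r → (8*Λ+40)*r ≤ R →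
      z + r • e ∈ Ω ∧ ∀ x ∈ Ω, 2*r ≤ dist x z → K x * K' (z + r • e) ≤ Cb * (Cs / cH N) * (K (z + r • e)) * K' x := by
    intro K K' hK hK' r hr hrR
    have hΛr : 0 < Λ*r := by positivity
    have hHr : H (z + r • e) = r := by rw [hC.up, hHz, zero_add]
    have hzre : dist (z + r • e) z = r := by rw [hC.dist_up, abs_of_pos hr]
    have hp : z + r • e ∈ Ω := hC.inball (by linarith) (by linarith)
    have hKr := hK.pos _ hp
    have hKr' := hK'.pos _ hp
    refine ⟨hp, fun w hw hwr => ?_⟩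
    have := hbh z r (Cs * K (z + r • e)) (cH N * K' (z + r • e)) K K' hHz hr
      (by rw [dist_self]; linarith) (by positivity) (by positivity) hK.harm.cont (fun x hx _ => (hK.harm.AA_eq hD hx).ge)
      (fun x hx h1 h2 => hsh K z r hK.harm hHz hr (by rw [dist_self]; linarith) hK.van x hx (by linarith) (by linarith))
      (fun y' hy' hd => hK.van y' hy' (by rintro rfl; simp at hd; linarith)) (hK'.harm.sup hD)
      (PP_harm hD hK'.harm hp) w hw hwr
    calc K w * K' (z + r • e) ≤ (Cb * (Cs * K (z + r • e) / (cH N * K' (z + r • e))) * K' w) * K' (z + r • e) := by gcongr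
      _ = _ := by field_simp
  set C8 := Cb * (Cs / cH N) with hC8
  have hC8p : 0 < C8 := by positivity
  refine ⟨C8 * C8, by positivity, fun x hx => ?_⟩
  have hdx := dist_pos_of_frontier hD hx hz
  have hdx0 := dist_pos_of_frontier hD hx0 hz
  set r := min (R/(8*Λ+40)) (min (dist x0 z/2) (dist x z/2)) with hr
  have hr0 : 0 < r := by positivity
  have h1 : r ≤ R/(8*Λ+40) := min_le_left _ _
  have h2 : r ≤ dist x z/2 := (min_le_right _ _).trans (min_le_right _ _)
  have h3 : r ≤ dist x0 z/2 := (min_le_right _ _).trans (min_le_left _ _)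
  rw [le_div_iff₀ (by positivity)] at h1
  obtain ⟨hp, k1⟩ := key K K' hK hK' r hr0 (by linarith)
  obtain ⟨-, k2⟩ := key K' K hK' hK r hr0 (by linarith)
  have k1 := k1 x hx (by linarith)
  have k2 := k2 x0 hx0 (by linarith)
  rw [hK.one, hK'.one, one_mul, mul_one] at k2
  have hKr' := hK'.pos _ hp
  have hx' := hK'.pos x hx
  refine le_of_mul_le_mul_right ?_ hKr'
  calc _ ≤ _ := k1
    _ ≤ C8 * (C8 * K' (z + r • e)) * K' x := by gcongr
    _ = _ := by ring

lemma ker_unique (hD : Dom Ω) (hΩ : IsLipschitzDomain Ω) {z x0 : ES N} (hz : z ∈ frontier Ω) (hx0 : x0 ∈ Ω)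
    {K K' : ES N → ℝ} (hK : Ker Ω x0 z K) (hK' : Ker Ω x0 z K') : ∀ x ∈ Ω, K x = K' x := by
  obtain ⟨C, hC, h⟩ := kcmp hD hΩ hz hx0 hK hK'
  obtain ⟨c, -, hc⟩ := UQ hD hΩ hz hC hK'.harm hK'.pos hK'.van
    ⟨hK.harm.cont, hK.harm.nn, fun x hx => hK.harm.AA_eq hD hx, h⟩
  have := hc x0 hx0
  rw [hK.one, hK'.one] at this
  intro x hx
  rw [hc x hx, ← mul_one c, ← this, one_mul]

end

section

variable {N : ℕ} {Ω : Set (ES N)}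

lemma LVmod (hD : Dom Ω) {a : ℝ} (ha : 0 < a) {ε : ℝ} (hε : 0 < ε) : ∃ η : ℝ, 0 < η ∧ η ≤ 1/16 ∧
    ∀ (V K u : ES N → ℝ), VClass Ω a V → Harm Ω K → LVHarmonic Ω V u → (∀ x ∈ Ω, 0 ≤ u x ∧ u x ≤ K x) →
      ∀ x ∈ Ω, ∀ x', dist x' x ≤ η * dista Ω x → |u x - u x'| ≤ ε * K x := by
  have hcH := cH_pos (N := N)
  have hcm := cm_nonneg (N := N)
  set C1 := (cH N^25)⁻¹ with hC1
  have hC1p : 0 < C1 := by positivity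
  obtain ⟨η, h0, h1, hη⟩ := kap_modulus N (ε := ε/(2*C1)) (by positivity)
  set σ := min (1/16) (ε/(16*(cm N*a*C1+1))) with hσ
  have hσ0 : 0 < σ := by positivity
  have hσ1 : σ ≤ 1/16 := min_le_left _ _
  have hσ2 : σ ≤ ε/(16*(cm N*a*C1+1)) := min_le_right _ _
  have hσ3 : 8 * (cm N * a * C1) * σ^2 ≤ ε/2 := by
    rw [le_div_iff₀ (by positivity)] at hσ2
    have : σ^2 ≤ σ := by nlinarith
    have h3 : 0 ≤ cm N * a * C1 := by positivity
    nlinarith [mul_le_mul_of_nonneg_left this h3]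
  have hησ : η*σ ≤ 1/64 := by nlinarith
  refine ⟨η*σ, by positivity, by linarith, ?_⟩
  intro V K u hV hK hu huK x hx x' hxx
  have hd := hD.dpos hx
  have hKx := hK.nn x hx
  have hxx2 : dist x' x ≤ 1/64 * dista Ω x := hxx.trans (by gcongr)
  have hfar : ∀ w, dist w x ≤ 3/4 * dista Ω x → w ∈ Ω ∧ u w ≤ C1 * K x ∧ V w * u w ≤ 16*a/dista Ω x^2 * (C1 * K x) := by
    intro w hw
    have hwΩ : w ∈ Ω := mem_of_dist_lt (by linarith)
    have hu1 := (huK w hwΩ).2.trans (harnack34 hD hK hx hw)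
    refine ⟨hwΩ, hu1, ?_⟩
    have hdw : dista Ω x / 4 ≤ dista Ω w := by linarith [dista_lip' (Ω := Ω) x w]
    have hVw := hV.2 w hwΩ
    have : V w ≤ 16*a/dista Ω x^2 := by
      rw [le_div_iff₀ (by positivity)]
      have : V w * (dista Ω x/4)^2 ≤ a := le_trans (mul_le_mul_of_nonneg_left (by gcongr) hVw.1) hVw.2
      linarith
    exact mul_le_mul this hu1 (huK w hwΩ).1 (by positivity)
  have htp : 0 < σ * dista Ω x := by positivity
  have ht16 : σ * dista Ω x ≤ 1/16 * dista Ω x := by gcongr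
  have hball : ∀ p, dist p x ≤ 1/64 * dista Ω x → closedBall p (2*(σ * dista Ω x)) ⊆ closedBall x (3/4*dista Ω x) := by
    intro p hp
    exact closedBall_subset_closedBall' (by linarith)
  have hAv : ∀ p, dist p x ≤ 1/64 * dista Ω x → u p ≤ Av u p (σ * dista Ω x) ∧
      Av u p (σ * dista Ω x) ≤ u p + ε/2 * K x := by
    intro p hp
    have hb := hball p hp
    have hbΩ : closedBall p (2*(σ * dista Ω x)) ⊆ Ω := fun w hw => (hfar w (mem_closedBall.1 (hb hw))).1
    refine ⟨Av_ge_of_LV hu (fun x hx => (hV.2 x hx).1) (fun x hx => (huK x hx).1) hbΩ htp (by linarith), ?_⟩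
    refine (Av_le_of_LV hu (fun w hw => (hfar w (mem_closedBall.1 (hb hw))).2.2) hbΩ htp (by linarith)).trans ?_
    have e1 : cm N * (16*a/dista Ω x^2 * (C1 * K x)) * (σ * dista Ω x)^2/2 = 8 * (cm N * a * C1) * σ^2 * K x := by
      field_simp; ring
    rw [e1]; gcongr
  have hx0 : dist x x ≤ 1/64 * dista Ω x := by rw [dist_self]; positivity
  have hdiff := Av_diff (x := x) (x' := x') (y := x) (t := σ * dista Ω x) (t' := σ * dista Ω x)
    (R := 3/4 * dista Ω x) (C := C1 * K x) (f := u) htp htp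
    ((LB.of_cont hu.1).int (by linarith)) (fun w hw => by
      obtain ⟨h1, h2, -⟩ := hfar w (mem_closedBall.1 hw)
      rw [abs_of_nonneg (huK w h1).1]; exact h2)
    ((closedBall_subset_closedBall (by linarith)).trans (hball x hx0))
    ((closedBall_subset_closedBall (by linarith)).trans (hball x' hxx2))
  have hk := hη x x' (σ * dista Ω x) (σ * dista Ω x) htp (by rw [dist_comm]; linarith) (by simp; positivity)
  have hdiff2 : |Av u x (σ * dista Ω x) - Av u x' (σ * dista Ω x)| ≤ ε/2 * K x := by
    calc _ ≤ _ := hdiff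
      _ ≤ C1 * K x * (ε/(2*C1)) := by gcongr
      _ = _ := by field_simp
  obtain ⟨a1, a2⟩ := hAv x hx0
  obtain ⟨b1, b2⟩ := hAv x' hxx2
  obtain ⟨d1, d2⟩ := abs_le.1 hdiff2
  rw [abs_le]; constructor <;> linarith

/- ### limits along filters -/
section lim
variable {ι : Type*}

def EQ (Ω : Set (ES N)) (u : ι → ES N → ℝ) : Prop :=
  ∀ x ∈ Ω, ∀ ε > 0, ∃ ρ > 0, ∀ x', dist x' x < ρ → ∀ j, |u j x' - u j x| ≤ ε

lemma EQ.cont_each (hO : IsOpen Ω) {u : ι → ES N → ℝ} (h : EQ Ω u) (j : ι) : ContinuousOn (u j) Ω := by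
  intro x hx
  refine ContinuousAt.continuousWithinAt ?_
  rw [Metric.continuousAt_iff]
  intro ε hε
  obtain ⟨ρ, hρ, h'⟩ := h x hx (ε/2) (by positivity)
  exact ⟨ρ, hρ, fun {x'} hx' => by rw [Real.dist_eq]; linarith [h' x' hx' j]⟩

variable {l : Filter ι} [l.NeBot] {u : ι → ES N → ℝ} {v : ES N → ℝ}

lemma EQ.lim_mod (h : EQ Ω u) (hO : IsOpen Ω) (hv : ∀ x ∈ Ω, Tendsto (fun j => u j x) l (𝓝 (v x))) :
    ∀ x ∈ Ω, ∀ ε > 0, ∃ ρ > 0, ∀ x', dist x' x < ρ → |v x' - v x| ≤ ε ∧ ∀ j, |u j x' - u j x| ≤ ε := by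
  intro x hx ε hε
  obtain ⟨ρ, hρ, h'⟩ := h x hx ε hε
  obtain ⟨ρ2, hρ2, h2⟩ := Metric.isOpen_iff.1 hO x hx
  refine ⟨min ρ ρ2, by positivity, fun x' hx' => ⟨?_, h' x' (hx'.trans_le (min_le_left _ _))⟩⟩
  have hx'Ω := h2 (mem_ball.2 (hx'.trans_le (min_le_right _ _)))
  refine le_of_tendsto ((hv x' hx'Ω).sub (hv x hx)).abs (Eventually.of_forall fun j => ?_)
  exact h' x' (hx'.trans_le (min_le_left _ _)) j

lemma EQ.cont (h : EQ Ω u) (hO : IsOpen Ω) (hv : ∀ x ∈ Ω, Tendsto (fun j => u j x) l (𝓝 (v x))) :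
    ContinuousOn v Ω := by
  intro x hx
  refine ContinuousAt.continuousWithinAt ?_
  rw [Metric.continuousAt_iff]
  intro ε hε
  obtain ⟨ρ, hρ, h'⟩ := h.lim_mod hO hv x hx (ε/2) (by positivity)
  exact ⟨ρ, hρ, fun {x'} hx' => by rw [Real.dist_eq]; linarith [(h' x' hx').1]⟩

lemma EQ.unif (h : EQ Ω u) (hO : IsOpen Ω) (hv : ∀ x ∈ Ω, Tendsto (fun j => u j x) l (𝓝 (v x)))
    {S : Set (ES N)} (hS : IsCompact S) (hSΩ : S ⊆ Ω) {ε : ℝ} (hε : 0 < ε) :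
    ∀ᶠ j in l, ∀ x ∈ S, |u j x - v x| ≤ ε := by
  have hm := h.lim_mod hO hv
  choose! ρ hρ hm using fun x (hx : x ∈ Ω) => hm x hx (ε/3) (by positivity)
  obtain ⟨t, htS, hcov⟩ := hS.elim_nhds_subcover (fun x => ball x (ρ x))
    (fun x hx => ball_mem_nhds x (hρ x (hSΩ hx)))
  have : ∀ᶠ j in l, ∀ x ∈ t, |u j x - v x| < ε/3 := by
    rw [Filter.eventually_all_finset]
    intro x hx
    have := (hv x (hSΩ (htS x hx)))
    rw [Metric.tendsto_nhds] at this
    exact this (ε/3) (by positivity)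
  filter_upwards [this] with j hj x hx
  obtain ⟨p, hp, hxp⟩ := mem_iUnion₂.1 (hcov hx)
  obtain ⟨h1, h2⟩ := hm p (hSΩ (htS p hp)) x (mem_ball.1 hxp)
  have h2 := abs_le.1 (h2 j)
  have h1 := abs_le.1 h1
  have h3 := abs_lt.1 (hj p hp)
  rw [abs_le]; constructor <;> linarith

lemma int_of_supp {g f : ES N → ℝ} (hg : Integrable g) {S : Set (ES N)} (hS : IsCompact S)
    (hgS : ∀ x ∉ S, g x = 0) (hf : ContinuousOn f S) : Integrable (fun x => g x * f x) := by
  have h1 := (hg.integrableOn (s := S)).mul_continuousOn hf hS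
  refine (integrableOn_iff_integrable_of_support_subset ?_).1 h1
  intro x hx
  by_contra hxS
  exact hx (by simp [hgS x hxS])

lemma EQ.tint (h : EQ Ω u) (hO : IsOpen Ω) (hv : ∀ x ∈ Ω, Tendsto (fun j => u j x) l (𝓝 (v x)))
    {S : Set (ES N)} (hS : IsCompact S) (hSΩ : S ⊆ Ω) {g : ES N → ℝ} (hg : Integrable g)
    (hgS : ∀ x ∉ S, g x = 0) :
    Tendsto (fun j => ∫ x, g x * u j x) l (𝓝 (∫ x, g x * v x)) := by
  rw [Metric.tendsto_nhds]
  intro ε hε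
  have hI : 0 ≤ ∫ x, |g x| := integral_nonneg fun x => abs_nonneg _
  filter_upwards [h.unif hO hv hS hSΩ (ε := ε/(2*((∫ x, |g x|)+1))) (by positivity)] with j hj
  have i1 := int_of_supp hg hS hgS ((h.cont_each hO j).mono hSΩ)
  have i2 := int_of_supp hg hS hgS ((h.cont hO hv).mono hSΩ)
  rw [Real.dist_eq, ← integral_sub i1 i2]
  have : |∫ x, (g x * u j x - g x * v x)| ≤ ∫ x, |g x| * (ε/(2*((∫ x, |g x|)+1))) := by
    refine abs_integral_le_integral_abs.trans (integral_mono (i1.sub i2).abs (hg.abs.mul_const _) fun x => ?_)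
    simp only
    rw [← mul_sub, abs_mul]
    by_cases hx : x ∈ S
    · exact mul_le_mul_of_nonneg_left (hj x hx) (abs_nonneg _)
    · simp [hgS x hx]
  rw [integral_mul_const] at this
  have h2 : (∫ x, |g x|) * (ε/(2*((∫ x, |g x|)+1))) ≤ ε/2 := by
    have : (∫ x, |g x|) * (ε/(2*((∫ x, |g x|)+1))) = ε/2 * ((∫ x, |g x|) / ((∫ x, |g x|)+1)) := by field_simp
    rw [this]
    have : (∫ x, |g x|) / ((∫ x, |g x|)+1) ≤ 1 := by rw [div_le_one (by positivity)]; linarith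
    nlinarith
  linarith

lemma EQ.harm (h : EQ Ω u) (hO : IsOpen Ω) (hv : ∀ x ∈ Ω, Tendsto (fun j => u j x) l (𝓝 (v x)))
    (hu : ∀ j, Harm Ω (u j)) : Harm Ω v := by
  refine ⟨h.cont hO hv, fun x hx => ge_of_tendsto (hv x hx) (Eventually.of_forall fun j => (hu j).nn x hx), ?_⟩
  intro x hx t ht htd
  have h1 := h.tint hO hv (isCompact_closedBall x t) (cball_sub htd) (kap_integrable x ht)
    (fun w hw => kap_zero ht (by simpa using (not_le.1 hw).le))
  have h2 := hv x hx
  refine tendsto_nhds_unique (h1.congr fun j => ?_) h2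
  exact (hu j).mv x hx t ht htd

lemma V_int (hD : Dom Ω) {a : ℝ} {V : ES N → ℝ} (hV : VClass Ω a V) {S : Set (ES N)} (hS : IsCompact S) (hSΩ : S ⊆ Ω) :
    IntegrableOn V S := by
  have hc : ContinuousOn (fun x => a / dista Ω x^2) S :=
    continuousOn_const.div (dista_cont.continuousOn.pow 2) fun x hx => by have := hD.dpos (hSΩ hx); positivity
  refine (hc.integrableOn_compact hS).mono' hV.1.aestronglyMeasurable ?_
  refine (ae_restrict_iff' hS.measurableSet).2 (Eventually.of_forall fun x hx => ?_)
  have hd := hD.dpos (hSΩ hx)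
  rw [Real.norm_eq_abs, abs_of_nonneg (hV.2 x (hSΩ hx)).1, le_div_iff₀ (by positivity)]
  exact (hV.2 x (hSΩ hx)).2

lemma EQ.lv (hD : Dom Ω) (h : EQ Ω u) (hv : ∀ x ∈ Ω, Tendsto (fun j => u j x) l (𝓝 (v x)))
    {a : ℝ} {V : ES N → ℝ} (hV : VClass Ω a V) (hu : ∀ j, LVHarmonic Ω V (u j)) : LVHarmonic Ω V v := by
  have hc := h.cont hD.op hv
  refine ⟨hc, hc.locallyIntegrableOn hD.op.measurableSet, ?_, ?_⟩
  · rw [locallyIntegrableOn_iff hD.op.isLocallyClosed]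
    intro S hSΩ hS
    exact (V_int hD hV hS hSΩ).mul_continuousOn (hc.mono hSΩ) hS
  · intro φ hφ
    obtain ⟨h1, h2, h3⟩ := hφ
    have hφ0 : ∀ x ∉ tsupport φ, φ x = 0 := fun x hx => image_eq_zero_of_notMem_tsupport hx
    have hl0 : ∀ x ∉ tsupport φ, lap φ x = 0 := fun x hx => lap_zero_of_notMem_tsupport hx
    have il : Integrable (lap φ) := (lap_cont h1).integrable_of_hasCompactSupport
      (HasCompactSupport.intro h2 hl0)
    have iV : Integrable (fun x => V x * φ x) := by
      have := (V_int hD hV h2 h3).mul_continuousOn h1.continuous.continuousOn h2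
      refine (integrableOn_iff_integrable_of_support_subset ?_).1 this
      intro x hx
      by_contra hxS
      exact hx (by simp [hφ0 x hxS])
    have t1 := h.tint hD.op hv h2 h3 il hl0
    have t2 := h.tint hD.op hv h2 h3 iV (fun x hx => by simp [hφ0 x hx])
    have r1 : ∀ w : ES N → ℝ, ∫ x in Ω, w x * lap φ x = ∫ x, lap φ x * w x := by
      intro w
      rw [setIntegral_eq_integral_of_forall_compl_eq_zero]
      · simp_rw [mul_comm]
      · intro x hx; rw [hl0 x fun h => hx (h3 h), mul_zero]
    have r2 : ∀ w : ES N → ℝ, ∫ x in Ω, V x * w x * φ x = ∫ x, V x * φ x * w x := by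
      intro w
      rw [setIntegral_eq_integral_of_forall_compl_eq_zero]
      · congr 1; ext x; ring
      · intro x hx; rw [hφ0 x fun h => hx (h3 h), mul_zero]
    rw [r1, r2]
    refine tendsto_nhds_unique (t1.congr fun j => ?_) t2
    rw [← r1, ← r2]
    exact (hu j).2.2.2 φ ⟨h1, h2, h3⟩

end lim

lemma Ker.bound (hD : Dom Ω) {x0 x : ES N} (hx0 : x0 ∈ Ω) (hx : x ∈ Ω) :
    ∃ C > 0, ∀ z K, Ker Ω x0 z K → K x ≤ C := by
  obtain ⟨C, hC, h⟩ := global_harnack hD hx hx0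
  exact ⟨C, hC, fun z K hK => by have := h K hK.harm; rwa [hK.one, mul_one] at this⟩

lemma ker_EQ (hD : Dom Ω) {x0 : ES N} (hx0 : x0 ∈ Ω) {ι : Type*} {z : ι → ES N} {u : ι → ES N → ℝ}
    (hu : ∀ j, Ker Ω x0 (z j) (u j)) : EQ Ω u := by
  intro x hx ε hε
  obtain ⟨C, hC, hb⟩ := Ker.bound hD hx0 hx
  obtain ⟨η, h0, h1, h⟩ := AA_modulus' hD (ε := ε/C) (by positivity)
  have hd := hD.dpos hx
  refine ⟨η * dista Ω x, by positivity, fun x' hx' j => ?_⟩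
  have hx'Ω : x' ∈ Ω := mem_of_dist_lt (by nlinarith)
  have := h (u j) (u j) 1 zero_le_one (hu j).harm (LB.of_cont (hu j).harm.cont) (fun x hx => by
    rw [abs_of_nonneg ((hu j).harm.nn x hx), one_mul]) x hx x' hx'.le
  rw [(hu j).harm.AA_eq hD hx, (hu j).harm.AA_eq hD hx'Ω, abs_sub_comm] at this
  refine this.trans ?_
  have := hb _ _ (hu j)
  calc ε/C*1*u j x ≤ ε/C*1*C := by gcongr
    _ = ε := by field_simp

lemma lv_EQ (hD : Dom Ω) {x0 : ES N} (hx0 : x0 ∈ Ω) {a : ℝ} (ha : 0 < a) {V : ES N → ℝ} (hV : VClass Ω a V)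
    {ι : Type*} {z : ι → ES N} {u v : ι → ES N → ℝ}
    (hu : ∀ j, Ker Ω x0 (z j) (u j)) (hv : ∀ j, LVHarmonic Ω V (v j))
    (huv : ∀ j, ∀ x ∈ Ω, 0 ≤ v j x ∧ v j x ≤ u j x) : EQ Ω v := by
  intro x hx ε hε
  obtain ⟨C, hC, hb⟩ := Ker.bound hD hx0 hx
  obtain ⟨η, h0, h1, h⟩ := LVmod hD ha (ε := ε/C) (by positivity)
  have hd := hD.dpos hx
  refine ⟨η * dista Ω x, by positivity, fun x' hx' j => ?_⟩
  have := h V (u j) (v j) hV (hu j).harm (hv j) (huv j) x hx x' hx'.le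
  rw [abs_sub_comm] at this
  refine this.trans ?_
  have := hb _ _ (hu j)
  calc ε/C*u j x ≤ ε/C*C := by gcongr
    _ = ε := by field_simp

/-- the ultrafilter limit of kernels -/
lemma ker_lim (hD : Dom Ω) (hΩ : IsLipschitzDomain Ω) {x0 : ES N} (hx0 : x0 ∈ Ω) {K : ES N → ES N → ℝ}
    (hK : ∀ z ∈ frontier Ω, Ker Ω x0 z (K z)) {z : ES N} (hz : z ∈ frontier Ω) (x : ES N) (hx : x ∈ Ω) :
    ∀ l : Ultrafilter (frontier Ω), Tendsto (fun y : frontier Ω => (y : ES N)) l (𝓝 z) →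
      Tendsto (fun y : frontier Ω => K y x) l (𝓝 (K z x)) := by
  intro l hl
  have hu : ∀ j : frontier Ω, Ker Ω x0 (j : ES N) (K j) := fun j => hK j j.2
  have hex : ∀ x, ∃ v : ℝ, x ∈ Ω → Tendsto (fun y : frontier Ω => K y x) l (𝓝 v) := by
    intro x
    by_cases hx : x ∈ Ω
    swap
    · exact ⟨0, fun h => absurd h hx⟩
    obtain ⟨C, hC, hb⟩ := Ker.bound hD hx0 hx
    obtain ⟨v, -, hv⟩ := (isCompact_Icc (a := (0:ℝ)) (b := C)).ultrafilter_le_nhds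
      (l.map (fun y : frontier Ω => K y x)) (by
        rw [le_principal_iff, Ultrafilter.mem_coe, Ultrafilter.mem_map]
        exact Filter.univ_mem' fun j => ⟨(hu j).harm.nn x hx, hb _ _ (hu j)⟩)
    exact ⟨v, fun _ => hv⟩
  choose v hv using hex
  have hEQ := ker_EQ hD hx0 hu
  have hh : Harm Ω v := hEQ.harm (l := (l : Filter (frontier Ω))) hD.op hv fun j => (hu j).harm
  have hone : v x0 = 1 := by
    refine tendsto_nhds_unique (hv x0 hx0) ?_
    refine tendsto_const_nhds.congr fun j => ((hu j).one).symm
  have hKv : Ker Ω x0 z v := by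
    refine ⟨hh, fun x hx => ?_, hone, ?_⟩
    · obtain ⟨C, hC, hb⟩ := global_harnack hD hx0 hx
      have := hb v hh
      rw [hone] at this
      by_contra hn
      have : C * v x ≤ 0 := mul_nonpos_of_nonneg_of_nonpos hC.le (not_lt.1 hn)
      linarith
    · intro y hy hyz ε hε
      have hd : 0 < dist z y := dist_pos.2 hyz.symm
      obtain ⟨ρ, hρ, hvan⟩ := unif_van hD hΩ hx0 hy (τ := dist z y/2) (ε := ε/2) (by positivity) (by positivity)
      have hev : ∀ᶠ j : frontier Ω in (l : Filter (frontier Ω)), dist z y/2 ≤ dist (j : ES N) y := by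
        have := (hl.dist tendsto_const_nhds : Tendsto (fun j : frontier Ω => dist (j : ES N) y) l (𝓝 (dist z y)))
        filter_upwards [this.eventually_const_lt (show dist z y/2 < dist z y by linarith)] with j hj using hj.le
      filter_upwards [self_mem_nhdsWithin, mem_nhdsWithin_of_mem_nhds (ball_mem_nhds y hρ)] with x hx hxy
      have : v x ≤ ε/2 := le_of_tendsto (hv x hx) (by
        filter_upwards [hev] with j hj using hvan j (K j) (hu j) hj x hx (mem_ball.1 hxy))
      linarith
  rw [← ker_unique hD hΩ hz hx0 hKv (hK z hz) x hx]
  exact hv x hx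

lemma ker_cont (hD : Dom Ω) (hΩ : IsLipschitzDomain Ω) {x0 : ES N} (hx0 : x0 ∈ Ω) {K : ES N → ES N → ℝ}
    (hK : ∀ z ∈ frontier Ω, Ker Ω x0 z (K z)) {x : ES N} (hx : x ∈ Ω) :
    Continuous (fun y : frontier Ω => K y x) := by
  rw [continuous_iff_ultrafilter]
  intro z l hl
  refine ker_lim hD hΩ hx0 hK z.2 x hx l ?_
  exact (continuous_subtype_val.tendsto z).mono_left hl

/-- upper semicontinuity of the greatest minorant -/
lemma tker_closed (hD : Dom Ω) (hΩ : IsLipschitzDomain Ω) {x0 : ES N} (hx0 : x0 ∈ Ω) {a : ℝ} (ha : 0 < a)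
    {V : ES N → ℝ} (hV : VClass Ω a V) {K T : ES N → ES N → ℝ}
    (hK : ∀ z ∈ frontier Ω, Ker Ω x0 z (K z)) (hT : ∀ z ∈ frontier Ω, IsGreatestLVHarmMinorant Ω V (K z) (T z))
    {x : ES N} (hx : x ∈ Ω) (t : ℝ) : IsClosed {y : frontier Ω | t ≤ T y x} := by
  rw [isClosed_iff_ultrafilter]
  intro z l hl hmem
  have hu : ∀ j : frontier Ω, Ker Ω x0 (j : ES N) (K j) := fun j => hK j j.2
  have hTT : ∀ j : frontier Ω, IsGreatestLVHarmMinorant Ω V (K j) (T j) := fun j => hT j j.2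
  have hb0 : ∀ j : frontier Ω, ∀ x ∈ Ω, 0 ≤ T j x ∧ T j x ≤ K j x := fun j => (hTT j).2.1
  have hex : ∀ x, ∃ v : ℝ, x ∈ Ω → Tendsto (fun y : frontier Ω => T y x) l (𝓝 v) := by
    intro x
    by_cases hx : x ∈ Ω
    swap
    · exact ⟨0, fun h => absurd h hx⟩
    obtain ⟨C, hC, hb⟩ := Ker.bound hD hx0 hx
    obtain ⟨v, -, hv⟩ := (isCompact_Icc (a := (0:ℝ)) (b := C)).ultrafilter_le_nhds
      (l.map (fun y : frontier Ω => T y x)) (by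
        rw [le_principal_iff, Ultrafilter.mem_coe, Ultrafilter.mem_map]
        exact Filter.univ_mem' fun j => ⟨(hb0 j x hx).1, (hb0 j x hx).2.trans (hb _ _ (hu j))⟩)
    exact ⟨v, fun _ => hv⟩
  choose v hv using hex
  have hEQ := lv_EQ hD hx0 ha hV hu (fun j => (hTT j).1) hb0
  have hlv : LVHarmonic Ω V v := hEQ.lv (l := (l : Filter (frontier Ω))) hD hv hV fun j => (hTT j).1
  have hKl : ∀ x ∈ Ω, Tendsto (fun y : frontier Ω => K y x) l (𝓝 (K z x)) := fun x hx =>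
    ker_lim hD hΩ hx0 hK z.2 x hx l ((continuous_subtype_val.tendsto z).mono_left hl)
  have h1 := (hTT z).2.2 v hlv (fun x hx => ⟨ge_of_tendsto (hv x hx) (Eventually.of_forall fun j => (hb0 j x hx).1),
    le_of_tendsto_of_tendsto (hv x hx) (hKl x hx) (Eventually.of_forall fun j => (hb0 j x hx).2)⟩) x hx
  refine le_trans (ge_of_tendsto (hv x hx) ?_) h1
  exact hmem

end

section

variable {N : ℕ} {Ω : Set (ES N)}

lemma AA_limit (hD : Dom Ω) {f : ℕ → ES N → ℝ} {g v : ES N → ℝ} (hf : ∀ n, ContinuousOn (f n) Ω)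
    (hg : ContinuousOn g Ω) (hfg : ∀ n, ∀ x ∈ Ω, |f n x| ≤ g x)
    (hv : ∀ x ∈ Ω, Tendsto (fun n => f n x) atTop (𝓝 (v x))) :
    LB Ω v ∧ ∀ x ∈ Ω, Tendsto (fun n => AA Ω (f n) x) atTop (𝓝 (AA Ω v x)) := by
  have hvg : ∀ x ∈ Ω, |v x| ≤ g x := fun x hx =>
    le_of_tendsto (hv x hx).abs (Eventually.of_forall fun n => hfg n x hx)
  have hLB : LB Ω v := by
    intro S hS hc
    refine ⟨?_, ?_⟩
    · refine ((hg.mono hS).integrableOn_compact hc).mono' ?_ ?_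
      · refine aestronglyMeasurable_of_tendsto_ae (u := atTop) (f := f)
          (fun n => ((hf n).mono hS).aestronglyMeasurable hc.measurableSet) ?_
        exact (ae_restrict_iff' hc.measurableSet).2 (Eventually.of_forall fun x hx => hv x (hS hx))
      · exact (ae_restrict_iff' hc.measurableSet).2 (Eventually.of_forall fun x hx => hvg x (hS hx))
    · obtain ⟨C, hC⟩ := (LB.of_cont hg S hS hc).2
      exact ⟨C, fun x hx => (hvg x (hS hx)).trans ((le_abs_self _).trans (hC x hx))⟩
  refine ⟨hLB, fun x hx => ?_⟩
  have hd := hD.dpos hx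
  have ht : 0 < dista Ω x / 2 := by linarith
  unfold AA Av
  refine tendsto_integral_of_dominated_convergence (fun w => kap x (dista Ω x/2) w * g w)
    (fun n => (kap_mul_integrable x ht ((LB.of_cont (hf n)).inth hD hx)).aestronglyMeasurable)
    (kap_mul_integrable x ht ((LB.of_cont hg).inth hD hx)) (fun n => Eventually.of_forall fun w => ?_)
    (Eventually.of_forall fun w => ?_)
  · by_cases hw : dist w x < dista Ω x/2
    · rw [norm_mul, Real.norm_eq_abs, abs_of_nonneg (kap_nonneg ht.le w)]
      exact mul_le_mul_of_nonneg_left (hfg n w (mem_of_dist_lt (by linarith))) (kap_nonneg ht.le w)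
    · simp [kap_zero ht (not_lt.1 hw)]
  · by_cases hw : dist w x < dista Ω x/2
    · exact (hv w (mem_of_dist_lt (by linarith))).const_mul _
    · simp [kap_zero ht (not_lt.1 hw)]

def it (Ω : Set (ES N)) (f : ES N → ℝ) : ℕ → ES N → ℝ
  | 0 => f
  | n+1 => AA Ω (it Ω f n)

lemma it_cont (hD : Dom Ω) {f : ES N → ℝ} (hf : ContinuousOn f Ω) : ∀ n, ContinuousOn (it Ω f n) Ω
  | 0 => hf
  | n+1 => AA_cont hD (LB.of_cont (it_cont hD hf n))

lemma it_mono (hD : Dom Ω) {f g : ES N → ℝ} (hf : ContinuousOn f Ω) (hg : ContinuousOn g Ω)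
    (h : ∀ x ∈ Ω, f x ≤ g x) : ∀ n, ∀ x ∈ Ω, it Ω f n x ≤ it Ω g n x
  | 0 => h
  | n+1 => fun _ hx => AA_mono hD (LB.of_cont (it_cont hD hf n)) (LB.of_cont (it_cont hD hg n)) hx
      fun w hw => it_mono hD hf hg h n w (hD.half_sub hx hw)

lemma it_nonneg (hD : Dom Ω) {f : ES N → ℝ} (h : ∀ x ∈ Ω, 0 ≤ f x) : ∀ n, ∀ x ∈ Ω, 0 ≤ it Ω f n x
  | 0 => h
  | n+1 => fun _ hx => AA_nonneg hD (it_nonneg hD h n) hx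

lemma it_inv (hD : Dom Ω) {f : ES N → ℝ} (h : ∀ x ∈ Ω, AA Ω f x = f x) : ∀ n, ∀ x ∈ Ω, it Ω f n x = f x
  | 0 => fun _ _ => rfl
  | n+1 => fun x hx => by
      show AA Ω (it Ω f n) x = _
      rw [AA_congr hD hx (fun w hw => it_inv hD h n w (hD.half_sub hx hw)), h x hx]

lemma it_anti (hD : Dom Ω) {s : ES N → ℝ} (hs : Sup Ω s) : ∀ n, ∀ x ∈ Ω, it Ω s (n+1) x ≤ it Ω s n x
  | 0 => hs.le
  | n+1 => fun _ hx => AA_mono hD (LB.of_cont (it_cont hD hs.cont (n+1))) (LB.of_cont (it_cont hD hs.cont n)) hx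
      fun w hw => it_anti hD hs n w (hD.half_sub hx hw)

lemma it_le (hD : Dom Ω) {s : ES N → ℝ} (hs : Sup Ω s) : ∀ n, ∀ x ∈ Ω, it Ω s n x ≤ s x
  | 0 => fun _ _ => le_rfl
  | n+1 => fun x hx => (it_anti hD hs n x hx).trans (it_le hD hs n x hx)

lemma it_lim (hD : Dom Ω) {s : ES N → ℝ} (hs : Sup Ω s) : ∃ q : ES N → ℝ, ContinuousOn q Ω ∧
    (∀ x ∈ Ω, 0 ≤ q x ∧ q x ≤ s x) ∧ (∀ x ∈ Ω, AA Ω q x = q x) ∧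
    ∀ x ∈ Ω, Tendsto (fun n => it Ω s n x) atTop (𝓝 (q x)) := by
  have hlim : ∀ x ∈ Ω, Tendsto (fun n => it Ω s n x) atTop (𝓝 (⨅ n, it Ω s n x)) := fun x hx =>
    tendsto_atTop_ciInf (antitone_nat_of_succ_le fun n => it_anti hD hs n x hx)
      ⟨0, by rintro _ ⟨n, rfl⟩; exact it_nonneg hD hs.nn n x hx⟩
  obtain ⟨hLB, hA⟩ := AA_limit hD (fun n => it_cont hD hs.cont n) hs.cont (fun n x hx => by
    rw [abs_of_nonneg (it_nonneg hD hs.nn n x hx)]; exact it_le hD hs n x hx) hlim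
  have heq : ∀ x ∈ Ω, AA Ω (fun x => ⨅ n, it Ω s n x) x = ⨅ n, it Ω s n x := fun x hx =>
    tendsto_nhds_unique (hA x hx) ((hlim x hx).comp (tendsto_add_atTop_nat 1))
  refine ⟨fun x => ⨅ n, it Ω s n x, (AA_cont hD hLB).congr fun x hx => (heq x hx).symm, fun x hx => ⟨?_, ?_⟩, heq, hlim⟩
  · exact ge_of_tendsto (hlim x hx) (Eventually.of_forall fun n => it_nonneg hD hs.nn n x hx)
  · exact le_of_tendsto (hlim x hx) (Eventually.of_forall fun n => it_le hD hs n x hx)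

lemma LV_smul (hD : Dom Ω) {a : ℝ} {V u : ES N → ℝ} (hV : VClass Ω a V) (hu : LVHarmonic Ω V u) (c : ℝ) :
    LVHarmonic Ω V (fun x => c * u x) := by
  have hc : ContinuousOn (fun x => c * u x) Ω := continuousOn_const.mul hu.1
  refine ⟨hc, hc.locallyIntegrableOn hD.op.measurableSet, ?_, ?_⟩
  · rw [locallyIntegrableOn_iff hD.op.isLocallyClosed]
    intro S hSΩ hS
    exact (V_int hD hV hS hSΩ).mul_continuousOn (hc.mono hSΩ) hS
  · intro φ hφ
    have := hu.2.2.2 φ hφ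
    have e1 : ∀ x, c * u x * lap φ x = c * (u x * lap φ x) := fun x => by ring
    have e2 : ∀ x, V x * (c * u x) * φ x = c * (V x * u x * φ x) := fun x => by ring
    simp_rw [e1, e2]
    rw [integral_const_mul, integral_const_mul, this]

lemma min_sub (hD : Dom Ω) {a : ℝ} {V T : ES N → ℝ} (hV : VClass Ω a V) (hT : LVHarmonic Ω V T)
    (hT0 : ∀ x ∈ Ω, 0 ≤ T x) : ∀ x ∈ Ω, T x ≤ AA Ω T x := fun x hx => by
  have hd := hD.dpos hx
  exact Av_ge_of_LV hT (fun x hx => (hV.2 x hx).1) hT0 (T := 3/4*dista Ω x) (cball_sub (by linarith)) (by linarith)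
    (by linarith)

lemma p_sup (hD : Dom Ω) {a : ℝ} {V T K : ES N → ℝ} (hV : VClass Ω a V) (hT : LVHarmonic Ω V T)
    (hT0 : ∀ x ∈ Ω, 0 ≤ T x ∧ T x ≤ K x) (hK : Harm Ω K) : Sup Ω (fun x => K x - T x) := by
  refine ⟨hK.cont.sub hT.1, fun x hx => by linarith [(hT0 x hx).2], fun x hx => ?_⟩
  rw [AA_sub hD (LB.of_cont hK.cont) (LB.of_cont hT.1) hx, hK.AA_eq hD hx]
  linarith [min_sub hD hV hT (fun x hx => (hT0 x hx).1) x hx]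

/-- `K - K̃` is a potential when `K̃ ≠ 0` -/
lemma p_pot (hD : Dom Ω) (hΩ : IsLipschitzDomain Ω) {x0 z : ES N} (hz : z ∈ frontier Ω)
    {a : ℝ} {V T K : ES N → ℝ} (hV : VClass Ω a V)
    (hK : Ker Ω x0 z K) (hT : IsGreatestLVHarmMinorant Ω V K T) {x1 : ES N} (hx1 : x1 ∈ Ω) (hT1 : 0 < T x1) :
    ∀ x ∈ Ω, Tendsto (fun n => it Ω (fun x => K x - T x) n x) atTop (𝓝 0) := by
  have hs := p_sup hD hV hT.1 hT.2.1 hK.harm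
  obtain ⟨q, hqc, hqn, hqe, hql⟩ := it_lim hD hs
  obtain ⟨c, hc, hqK⟩ := UQ hD hΩ hz one_pos hK.harm hK.pos hK.van
    ⟨hqc, fun x hx => (hqn x hx).1, hqe, fun x hx => by
      have := (hqn x hx).2; have := (hT.2.1 x hx).1; linarith⟩
  have hTc : ∀ x ∈ Ω, T x ≤ (1-c) * K x := fun x hx => by
    have := (hqn x hx).2; rw [hqK x hx] at this; linarith
  have hc0 : c = 0 := by
    by_contra hne
    have hcp : 0 < c := lt_of_le_of_ne hc (Ne.symm hne)
    have hK1 := hK.pos x1 hx1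
    have h1c : 0 < 1 - c := by
      have := hTc x1 hx1
      by_contra hn
      have : (1-c) * K x1 ≤ 0 := mul_nonpos_of_nonpos_of_nonneg (not_lt.1 hn) hK1.le
      linarith
    have := hT.2.2 (fun x => (1-c)⁻¹ * T x) (LV_smul hD hV hT.1 _) (fun x hx => ⟨by
      have := (hT.2.1 x hx).1; positivity, by
      rw [inv_mul_le_iff₀ h1c]; exact hTc x hx⟩) x1 hx1
    rw [inv_mul_le_iff₀ h1c] at this
    nlinarith
  intro x hx
  have := hql x hx
  rwa [hqK x hx, hc0, zero_mul] at this

end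

section

variable {N : ℕ} {Ω : Set (ES N)}

/-- measurable families of harmonic functions -/
structure KF (Ω : Set (ES N)) (k : ES N → ES N → ℝ) : Prop where
  meas : ∀ x ∈ Ω, Measurable (fun z => k z x)
  harm : ∀ z, Harm Ω (k z)
  bd : ∀ d > 0, ∃ C, ∀ z x, d ≤ dista Ω x → k z x ≤ C

structure MF (Ω : Set (ES N)) (k g : ES N → ES N → ℝ) : Prop where
  meas : ∀ x ∈ Ω, Measurable (fun z => g z x)
  cont : ∀ z, ContinuousOn (g z) Ω
  le : ∀ z, ∀ x ∈ Ω, |g z x| ≤ k z x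

def II (μ : Measure (ES N)) (g : ES N → ES N → ℝ) (x : ES N) : ℝ := ∫ z, g z x ∂μ

variable {k g : ES N → ES N → ℝ} {μ : Measure (ES N)} [IsFiniteMeasure μ]

lemma KF.mf (hk : KF Ω k) : MF Ω k k :=
  ⟨hk.meas, fun z => (hk.harm z).cont, fun z x hx => by rw [abs_of_nonneg ((hk.harm z).nn x hx)]⟩

lemma MF.int (hD : Dom Ω) (hk : KF Ω k) (hg : MF Ω k g) {x : ES N} (hx : x ∈ Ω) :
    Integrable (fun z => g z x) μ := by
  obtain ⟨C, hC⟩ := hk.bd (dista Ω x) (hD.dpos hx)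
  exact (integrable_const C).mono' (hg.meas x hx).aestronglyMeasurable
    (Eventually.of_forall fun z => (hg.le z x hx).trans (hC z x le_rfl))

lemma MF.I_cont (hD : Dom Ω) (hk : KF Ω k) (hg : MF Ω k g) : ContinuousOn (II μ g) Ω := by
  intro x hx
  have hd := hD.dpos hx
  obtain ⟨C, hC⟩ := hk.bd (dista Ω x/2) (by positivity)
  refine continuousWithinAt_of_dominated (bound := fun _ => C) ?_ ?_ (integrable_const C)
    (Eventually.of_forall fun z => hg.cont z x hx)
  · filter_upwards [self_mem_nhdsWithin] with w hw using (hg.meas w hw).aestronglyMeasurable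
  · have : ∀ᶠ w in 𝓝[Ω] x, dista Ω x/2 < dista Ω w :=
      nhdsWithin_le_nhds (dista_cont.continuousAt.eventually_const_lt (by linarith))
    filter_upwards [self_mem_nhdsWithin, this] with w hw hw2
    exact Eventually.of_forall fun z => (hg.le z w hw).trans (hC z w hw2.le)

lemma kap_ext_cont (hD : Dom Ω) {f : ES N → ℝ} (hf : ContinuousOn f Ω) {x : ES N} {t : ℝ} (ht : 0 < t)
    (htd : t < dista Ω x) : Continuous (fun w => kap x t w * f w) := by
  rw [continuous_iff_continuousAt]
  intro w
  by_cases hw : w ∈ closedBall x t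
  · exact (kap_cont x t).continuousAt.mul (hf.continuousAt (hD.op.mem_nhds (cball_sub htd hw)))
  · have : (fun w => kap x t w * f w) =ᶠ[𝓝 w] fun _ => 0 := by
      filter_upwards [isClosed_closedBall.isOpen_compl.mem_nhds hw] with v hv
      rw [kap_zero ht (by have := hv; simp only [mem_compl_iff, mem_closedBall, not_le] at this; exact this.le), zero_mul]
    exact continuousAt_const.congr this.symm

lemma MF.joint (hD : Dom Ω) (hg : MF Ω k g) {x : ES N} {t : ℝ} (ht : 0 < t) (htd : t < dista Ω x) :
    Measurable (fun p : ES N × ES N => kap x t p.1 * g p.2 p.1) := by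
  have := measurable_uncurry_of_continuous_of_measurable (u := fun (w z : ES N) => kap x t w * g z w)
    (fun z => kap_ext_cont hD (hg.cont z) ht htd) (fun w => by
      by_cases hw : w ∈ closedBall x t
      · exact (hg.meas w (cball_sub htd hw)).const_mul _
      · simp_rw [kap_zero ht (show t ≤ dist w x by simpa using (not_le.1 hw).le), zero_mul]
        exact measurable_const)
  exact this

lemma MF.I_Av (hD : Dom Ω) (hk : KF Ω k) (hg : MF Ω k g) {x : ES N} {t : ℝ} (ht : 0 < t) (htd : t < dista Ω x) :
    Av (II μ g) x t = ∫ z, Av (g z) x t ∂μ := by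
  unfold Av II
  simp_rw [← integral_const_mul]
  obtain ⟨C, hC⟩ := hk.bd (dista Ω x - t) (by linarith)
  refine integral_integral_swap ?_
  have hi : Integrable (fun p : ES N × ES N => kap x t p.1 * C) ((volume : Measure (ES N)).prod μ) :=
    (kap_integrable x ht).mul_prod (integrable_const C)
  refine hi.mono' (hg.joint hD ht htd).aestronglyMeasurable (Eventually.of_forall fun p => ?_)
  simp only [Function.uncurry]
  by_cases hw : dist p.1 x < t
  · rw [norm_mul, Real.norm_eq_abs, abs_of_nonneg (kap_nonneg ht.le _)]
    refine mul_le_mul_of_nonneg_left ?_ (kap_nonneg ht.le _)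
    exact (hg.le _ _ (mem_of_dist_lt (hw.trans htd))).trans (hC _ _ (by
      linarith [dista_lip' (Ω := Ω) x p.1]))
  · simp [kap_zero ht (not_lt.1 hw)]

lemma MF.I_AA (hD : Dom Ω) (hk : KF Ω k) (hg : MF Ω k g) {x : ES N} (hx : x ∈ Ω) :
    AA Ω (II μ g) x = II μ (fun z => AA Ω (g z)) x := by
  have hd := hD.dpos hx
  exact hg.I_Av hD hk (by linarith) (by linarith)

lemma KF.I_harm (hD : Dom Ω) (hk : KF Ω k) : Harm Ω (II μ k) := by
  refine ⟨hk.mf.I_cont hD hk, fun x hx => integral_nonneg fun z => (hk.harm z).nn x hx, fun x hx t ht htd => ?_⟩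
  rw [hk.mf.I_Av hD hk ht htd]
  unfold II
  congr 1; ext z; exact (hk.harm z).mv x hx t ht htd

lemma MF.AAf (hD : Dom Ω) (hk : KF Ω k) (hg : MF Ω k g) : MF Ω k (fun z => AA Ω (g z)) := by
  refine ⟨fun x hx => ?_, fun z => AA_cont hD (LB.of_cont (hg.cont z)), fun z x hx => ?_⟩
  · have hd := hD.dpos hx
    have h0 := (hg.joint hD (x := x) (t := dista Ω x/2) (by linarith) (by linarith)).comp
      (measurable_swap (α := ES N) (β := ES N))
    have : Measurable (Function.uncurry fun (z w : ES N) => kap x (dista Ω x/2) w * g z w) := by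
      convert h0 using 1
      funext p; cases p; rfl
    exact (this.stronglyMeasurable.integral_prod_right (ν := (volume : Measure (ES N)))).measurable
  · rw [← (hk.harm z).AA_eq hD hx, abs_le]
    have h1 := LB.of_cont (hg.cont z)
    have h2 := LB.of_cont (hk.harm z).cont
    refine ⟨?_, AA_mono hD h1 h2 hx fun w hw => (abs_le.1 (hg.le z w (hD.half_sub hx hw))).2⟩
    have h3 : AA Ω (fun w => -1 * k z w) x ≤ AA Ω (g z) x :=
      AA_mono hD (LB.of_cont ((hk.harm z).cont.const_mul _ |>.congr fun _ _ => rfl)) h1 hx fun w hw => by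
        linarith [(abs_le.1 (hg.le z w (hD.half_sub hx hw))).1]
    rw [AA_smul] at h3; linarith

lemma MF.itf (hD : Dom Ω) (hk : KF Ω k) (hg : MF Ω k g) : ∀ n, MF Ω k (fun z => it Ω (g z) n)
  | 0 => hg
  | n+1 => (MF.itf hD hk hg n).AAf hD hk

lemma MF.I_it (hD : Dom Ω) (hk : KF Ω k) (hg : MF Ω k g) : ∀ n, ∀ x ∈ Ω, 
    Anc.it Ω (II μ g) n x = II μ (fun z => Anc.it Ω (g z) n) x
  | 0 => fun _ _ => rfl
  | n+1 => fun x hx => by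
      show Anc.AA Ω (Anc.it Ω (II μ g) n) x = _
      rw [AA_congr hD hx (fun w hw => MF.I_it hD hk hg n w (hD.half_sub hx hw)), (hg.itf hD hk n).I_AA hD hk hx]
      rfl

/-- the family of kernels, cut off outside the boundary -/
def cut (Ω : Set (ES N)) (K : ES N → ES N → ℝ) (z x : ES N) : ℝ := (frontier Ω).indicator (fun z => K z x) z

lemma cut_eq {K : ES N → ES N → ℝ} {z : ES N} (hz : z ∈ frontier Ω) : cut Ω K z = K z := by
  ext x; simp [cut, hz]
lemma cut_ne {K : ES N → ES N → ℝ} {z : ES N} (hz : z ∉ frontier Ω) : cut Ω K z = fun _ => 0 := by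
  ext x; simp [cut, hz]

lemma cut_meas {f : ES N → ℝ} (h : Measurable (fun y : frontier Ω => f y)) :
    Measurable ((frontier Ω).indicator f) := by
  refine measurable_of_restrict_of_restrict_compl (s := frontier Ω) isClosed_frontier.measurableSet ?_ ?_
  · convert h using 1
    ext y; simp [y.2]
  · convert (measurable_const : Measurable (fun _ : ((frontier Ω)ᶜ : Set (ES N)) => (0:ℝ))) using 1
    ext y; simp [show (y : ES N) ∉ frontier Ω from y.2]


lemma ker_bd (hD : Dom Ω) {x0 : ES N} (hx0 : x0 ∈ Ω) {d : ℝ} (hd : 0 < d) :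
    ∃ C > 0, ∀ z K, Ker Ω x0 z K → ∀ x, d ≤ dista Ω x → K x ≤ C := by
  have hcomp : IsCompact {x : ES N | d ≤ dista Ω x} := by
    refine Metric.isCompact_of_isClosed_isBounded (isClosed_le continuous_const dista_cont) (hD.bd.subset ?_)
    intro x hx
    exact mem_of_dista (hd.trans_le hx)
  choose! C hC0 hC using fun x (hx : x ∈ Ω) => Ker.bound hD hx0 hx
  obtain ⟨t, ht, hcov⟩ := hcomp.elim_nhds_subcover (fun x => closedBall x (3/4 * dista Ω x))
    (fun x hx => closedBall_mem_nhds x (by have : d ≤ dista Ω x := hx; linarith))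
  have hcH := cH_pos (N := N)
  have htΩ : ∀ x ∈ t, x ∈ Ω := fun x hx => mem_of_dista (hd.trans_le (ht x hx))
  have hnn : ∀ x ∈ t, 0 ≤ (cH N^25)⁻¹ * C x := fun x hx => by have := hC0 x (htΩ x hx); positivity
  refine ⟨∑ x ∈ t, (cH N^25)⁻¹ * C x + 1, by have := Finset.sum_nonneg hnn; linarith, ?_⟩
  intro z K hK x hx
  obtain ⟨p, hp, hxp⟩ := mem_iUnion₂.1 (hcov hx)
  have h1 := harnack34 hD hK.harm (htΩ p hp) (mem_closedBall.1 hxp)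
  have h2 := hC p (htΩ p hp) z K hK
  have h3 := Finset.single_le_sum hnn hp
  have h4 : (cH N^25)⁻¹ * K p ≤ (cH N^25)⁻¹ * C p := by gcongr
  linarith

lemma harm_zero : Harm Ω (fun _ => (0:ℝ)) :=
  ⟨continuousOn_const, fun _ _ => le_rfl, fun x _ t _ _ => by simp [Av]⟩

lemma ker_KF (hD : Dom Ω) (hΩ : IsLipschitzDomain Ω) {x0 : ES N} (hx0 : x0 ∈ Ω) {K : ES N → ES N → ℝ}
    (hK : ∀ z ∈ frontier Ω, Ker Ω x0 z (K z)) : KF Ω (cut Ω K) := by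
  refine ⟨fun x hx => cut_meas (ker_cont hD hΩ hx0 hK hx).measurable, fun z => ?_, fun d hd => ?_⟩
  · by_cases hz : z ∈ frontier Ω
    · rw [cut_eq hz]; exact (hK z hz).harm
    · rw [cut_ne hz]; exact harm_zero
  · obtain ⟨C, hC, h⟩ := ker_bd hD hx0 hd
    refine ⟨C, fun z x hx => ?_⟩
    by_cases hz : z ∈ frontier Ω
    · rw [cut_eq hz]; exact h z _ (hK z hz) x hx
    · rw [cut_ne hz]; exact hC.le

lemma tker_MF (hD : Dom Ω) (hΩ : IsLipschitzDomain Ω) {x0 : ES N} (hx0 : x0 ∈ Ω) {a : ℝ} (ha : 0 < a)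
    {V : ES N → ℝ} (hV : VClass Ω a V) {K T : ES N → ES N → ℝ}
    (hK : ∀ z ∈ frontier Ω, Ker Ω x0 z (K z)) (hT : ∀ z ∈ frontier Ω, IsGreatestLVHarmMinorant Ω V (K z) (T z)) :
    MF Ω (cut Ω K) (cut Ω T) := by
  refine ⟨fun x hx => cut_meas (measurable_of_Ici fun t => ?_), fun z => ?_, fun z x hx => ?_⟩
  · exact (tker_closed hD hΩ hx0 ha hV hK hT hx t).measurableSet
  · by_cases hz : z ∈ frontier Ω
    · rw [cut_eq hz]; exact (hT z hz).1.1
    · rw [cut_ne hz]; exact continuousOn_const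
  · by_cases hz : z ∈ frontier Ω
    · rw [cut_eq hz, cut_eq hz]
      have := (hT z hz).2.1 x hx
      rw [abs_of_nonneg this.1]; exact this.2
    · rw [cut_ne hz, cut_ne hz]; simp

end

section

variable {N : ℕ} {Ω : Set (ES N)}

lemma AA_sum (hD : Dom Ω) {ι : Type*} (J : Finset ι) {f : ι → ES N → ℝ} (hf : ∀ i ∈ J, ContinuousOn (f i) Ω)
    {x : ES N} (hx : x ∈ Ω) : AA Ω (fun w => ∑ i ∈ J, f i w) x = ∑ i ∈ J, AA Ω (f i) x := by
  classical
  induction J using Finset.induction_on with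
  | empty => simp only [Finset.sum_empty]; exact AA_const hD hx 0
  | insert a J ha ih =>
    simp only [Finset.sum_insert ha]
    have h1 : ∀ i ∈ J, ContinuousOn (f i) Ω := fun i hi => hf i (Finset.mem_insert_of_mem hi)
    rw [AA_add hD (LB.of_cont (hf a (Finset.mem_insert_self _ _)))
      (LB.of_cont (continuousOn_finset_sum _ h1)) hx, ih h1]

/-- approximations of the reduced function of `h` over the set where the weight is positive -/
def bal (Ω : Set (ES N)) (χ h : ES N → ℝ) : ℕ → ES N → ℝ
  | 0 => fun x => χ x * h x
  | n+1 => fun x => χ x * h x + (1 - χ x) * AA Ω (bal Ω χ h n) x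

variable {χ h : ES N → ℝ}

lemma bal_basic (hD : Dom Ω) (hh : Harm Ω h) (hc : Continuous χ) (h0 : ∀ x, 0 ≤ χ x) (h1 : ∀ x, χ x ≤ 1) (n : ℕ) :
    ContinuousOn (bal Ω χ h n) Ω ∧ ∀ x ∈ Ω, 0 ≤ bal Ω χ h n x ∧ bal Ω χ h n x ≤ h x := by
  induction n with
  | zero =>
    refine ⟨hc.continuousOn.mul hh.cont, fun x hx => ⟨mul_nonneg (h0 x) (hh.nn x hx), ?_⟩⟩
    exact mul_le_of_le_one_left (hh.nn x hx) (h1 x)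
  | succ n ih =>
    have hLB := LB.of_cont ih.1
    refine ⟨(hc.continuousOn.mul hh.cont).add ((continuousOn_const.sub hc.continuousOn).mul (AA_cont hD hLB)), fun x hx => ?_⟩
    have a1 : 0 ≤ AA Ω (bal Ω χ h n) x := AA_nonneg hD (fun x hx => (ih.2 x hx).1) hx
    have a2 : AA Ω (bal Ω χ h n) x ≤ h x := by
      rw [← hh.AA_eq hD hx]
      exact AA_mono hD hLB (LB.of_cont hh.cont) hx fun w hw => (ih.2 w (hD.half_sub hx hw)).2
    have b0 := h0 x; have b1 := h1 x; have b2 := hh.nn x hx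
    simp only [bal]
    constructor
    · have := mul_nonneg b0 b2; have := mul_nonneg (sub_nonneg.2 b1) a1; linarith
    · have := mul_le_mul_of_nonneg_left a2 (sub_nonneg.2 b1); linarith

lemma bal_mono (hD : Dom Ω) (hh : Harm Ω h) (hc : Continuous χ) (h0 : ∀ x, 0 ≤ χ x) (h1 : ∀ x, χ x ≤ 1) (n : ℕ) :
    ∀ x ∈ Ω, bal Ω χ h n x ≤ bal Ω χ h (n+1) x := by
  induction n with
  | zero =>
    intro x hx
    have b := bal_basic hD hh hc h0 h1 0
    have a1 : 0 ≤ AA Ω (bal Ω χ h 0) x := AA_nonneg hD (fun x hx => (b.2 x hx).1) hx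
    have := mul_nonneg (sub_nonneg.2 (h1 x)) a1
    show χ x * h x ≤ χ x * h x + (1 - χ x) * AA Ω (bal Ω χ h 0) x
    linarith
  | succ n ih =>
    intro x hx
    have b := bal_basic hD hh hc h0 h1 n
    have b' := bal_basic hD hh hc h0 h1 (n+1)
    have := mul_le_mul_of_nonneg_left (AA_mono hD (LB.of_cont b.1) (LB.of_cont b'.1) hx
      fun w hw => ih w (hD.half_sub hx hw)) (sub_nonneg.2 (h1 x))
    show χ x * h x + (1 - χ x) * AA Ω (bal Ω χ h n) x ≤ χ x * h x + (1 - χ x) * AA Ω (bal Ω χ h (n+1)) x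
    linarith

lemma bal_lim (hD : Dom Ω) (hh : Harm Ω h) (hc : Continuous χ) (h0 : ∀ x, 0 ≤ χ x) (h1 : ∀ x, χ x ≤ 1) :
    ∃ f : ES N → ℝ, Sup Ω f ∧ (∀ x ∈ Ω, χ x * h x ≤ f x ∧ f x ≤ h x) ∧
      ∀ x ∈ Ω, Tendsto (fun n => bal Ω χ h n x) atTop (𝓝 (f x)) := by
  have hb := bal_basic hD hh hc h0 h1
  have hmono : ∀ x ∈ Ω, Monotone (fun n => bal Ω χ h n x) := fun x hx =>
    monotone_nat_of_le_succ fun n => bal_mono hD hh hc h0 h1 n x hx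
  have hT : ∀ x ∈ Ω, Tendsto (fun n => bal Ω χ h n x) atTop (𝓝 (⨆ n, bal Ω χ h n x)) := fun x hx =>
    tendsto_atTop_ciSup (hmono x hx) ⟨h x, by rintro _ ⟨n, rfl⟩; exact ((hb n).2 x hx).2⟩
  set f : ES N → ℝ := fun x => ⨆ n, bal Ω χ h n x with hf
  have hle : ∀ x ∈ Ω, f x ≤ h x := fun x hx => le_of_tendsto (hT x hx) (Eventually.of_forall fun n => ((hb n).2 x hx).2)
  have hge : ∀ x ∈ Ω, χ x * h x ≤ f x := fun x hx =>
    ge_of_tendsto (hT x hx) (Eventually.of_forall fun n => hmono x hx (Nat.zero_le n))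
  have hA := AA_limit hD (f := fun n => bal Ω χ h n) (g := h) (v := f) (fun n => (hb n).1) hh.cont
    (fun n x hx => by rw [abs_of_nonneg ((hb n).2 x hx).1]; exact ((hb n).2 x hx).2) hT
  have hAle : ∀ x ∈ Ω, AA Ω f x ≤ h x := fun x hx => by
    rw [← hh.AA_eq hD hx]
    exact AA_mono hD hA.1 (LB.of_cont hh.cont) hx fun w hw => hle w (hD.half_sub hx hw)
  have heq : ∀ x ∈ Ω, f x = χ x * h x + (1 - χ x) * AA Ω f x := fun x hx => by
    refine tendsto_nhds_unique ((tendsto_add_atTop_iff_nat 1).2 (hT x hx)) ?_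
    exact ((hA.2 x hx).const_mul _).const_add _
  refine ⟨f, ⟨?_, ?_, ?_⟩, fun x hx => ⟨hge x hx, hle x hx⟩, hT⟩
  · exact ((hc.continuousOn.mul hh.cont).add ((continuousOn_const.sub hc.continuousOn).mul (AA_cont hD hA.1))).congr heq
  · exact fun x hx => (mul_nonneg (h0 x) (hh.nn x hx)).trans (hge x hx)
  · intro x hx
    have := mul_le_mul_of_nonneg_left (hAle x hx) (h0 x)
    rw [heq x hx]; linarith

/-- the balayage lemma -/
lemma balayage (hD : Dom Ω) {ι : Type*} (J : Finset ι) {χ h : ι → ES N → ℝ} (hh : ∀ i ∈ J, Harm Ω (h i))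
    (hc : ∀ i ∈ J, Continuous (χ i)) (h0 : ∀ i ∈ J, ∀ x, 0 ≤ χ i x) (h1 : ∀ i ∈ J, ∀ x, χ i x ≤ 1)
    {s : ES N → ℝ} (hs : Sup Ω s) (hdom : ∀ x ∈ Ω, (∃ i ∈ J, χ i x ≠ 0) → ∑ i ∈ J, h i x ≤ s x) :
    ∃ f : ι → ES N → ℝ, (∀ i ∈ J, Sup Ω (f i) ∧ (∀ x ∈ Ω, χ i x * h i x ≤ f i x ∧ f i x ≤ h i x)) ∧
      ∀ x ∈ Ω, ∑ i ∈ J, f i x ≤ s x := by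
  choose! f hf1 hf2 hf3 using fun i (hi : i ∈ J) => bal_lim hD (hh i hi) (hc i hi) (h0 i hi) (h1 i hi)
  refine ⟨f, fun i hi => ⟨hf1 i hi, hf2 i hi⟩, ?_⟩
  have hb := fun i (hi : i ∈ J) => bal_basic hD (hh i hi) (hc i hi) (h0 i hi) (h1 i hi)
  have key : ∀ n, ∀ x ∈ Ω, ∑ i ∈ J, bal Ω (χ i) (h i) n x ≤ s x := by
    intro n
    induction n with
    | zero =>
      intro x hx
      by_cases he : ∃ i ∈ J, χ i x ≠ 0
      · exact (Finset.sum_le_sum fun i hi => ((hb i hi 0).2 x hx).2).trans (hdom x hx he)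
      · push Not at he
        rw [Finset.sum_eq_zero fun i hi => by show χ i x * h i x = 0; rw [he i hi, zero_mul]]
        exact hs.nn x hx
    | succ n ih =>
      intro x hx
      by_cases he : ∃ i ∈ J, χ i x ≠ 0
      · exact (Finset.sum_le_sum fun i hi => ((hb i hi (n+1)).2 x hx).2).trans (hdom x hx he)
      · push Not at he
        have : ∑ i ∈ J, bal Ω (χ i) (h i) (n+1) x = ∑ i ∈ J, AA Ω (bal Ω (χ i) (h i) n) x :=
          Finset.sum_congr rfl fun i hi => by
            show χ i x * h i x + (1 - χ i x) * AA Ω (bal Ω (χ i) (h i) n) x = _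
            rw [he i hi]; ring
        rw [this, ← AA_sum hD J (fun i hi => (hb i hi n).1) hx]
        refine le_trans ?_ (hs.le x hx)
        exact AA_mono hD (LB.of_cont (continuousOn_finset_sum _ fun i hi => (hb i hi n).1)) (LB.of_cont hs.cont) hx
          fun w hw => ih w (hD.half_sub hx hw)
  intro x hx
  exact le_of_tendsto (tendsto_finset_sum _ fun i hi => hf3 i hi x hx) (Eventually.of_forall fun n => key n x hx)

end

section

variable {N : ℕ} {Ω : Set (ES N)} {z0 e : ES N} {H : ES N → ℝ} {Λ R : ℝ}

lemma van_int (hD : Dom Ω) (hΩ : IsLipschitzDomain Ω) {x0 : ES N} (hx0 : x0 ∈ Ω) {K : ES N → ES N → ℝ}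
    (hK : ∀ z ∈ frontier Ω, Ker Ω x0 z (K z)) {ν : Measure (ES N)} [IsFiniteMeasure ν] {y : ES N}
    (hy : y ∈ frontier Ω) {τ : ℝ} (hτ : 0 < τ) (hν : ∀ᵐ z ∂ν, τ ≤ dist z y) : Van Ω (II ν (cut Ω K)) y := by
  intro ε hε
  have hkf := ker_KF hD hΩ hx0 hK
  set M := ν.real univ with hM
  have hM0 : 0 ≤ M := measureReal_nonneg
  obtain ⟨ρ, hρ, h⟩ := unif_van hD hΩ hx0 hy hτ (ε := ε/(2*(M+1))) (by positivity)
  filter_upwards [self_mem_nhdsWithin, nhdsWithin_le_nhds (ball_mem_nhds y hρ)] with x hx hxy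
  have h1 : II ν (cut Ω K) x ≤ ∫ _, ε/(2*(M+1)) ∂ν := by
    refine integral_mono_ae (hkf.mf.int hD hkf hx) (integrable_const _) ?_
    filter_upwards [hν] with z hz
    by_cases hzf : z ∈ frontier Ω
    · simp only [cut_eq hzf]
      exact h z _ (hK z hzf) hz x hx hxy
    · simp only [cut_ne hzf]; positivity
  rw [integral_const, smul_eq_mul, ← hM] at h1
  have h2 : M * (ε/(2*(M+1))) < ε := by
    rw [mul_div_assoc', div_lt_iff₀ (by positivity)]; nlinarith
  linarith

set_option maxHeartbeats 1000000 in
lemma bhball (hD : Dom Ω) (hΩ : IsLipschitzDomain Ω) {x0 : ES N} (hx0 : x0 ∈ Ω) {K : ES N → ES N → ℝ}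
    (hK : ∀ z ∈ frontier Ω, Ker Ω x0 z (K z)) (hC : Chart Ω z0 e H Λ R) {κ η : ℝ} (hκ : 1 ≤ κ) (hη : 0 < η)
    (hη1 : η ≤ 1/16) : ∃ C : ℝ, 0 < C ∧ ∀ (μ : Measure (ES N)) (_ : IsFiniteMeasure μ) (y x1 : ES N) (r : ℝ)
      (f : ES N → ℝ), y ∈ frontier Ω → dist y z0 < R/2 → x1 ∈ Ω → 0 < r → dist x1 y ≤ r → r ≤ κ * dista Ω x1 →
      (32*Λ+400)*r ≤ R → Sup Ω f →
      (∀ w, dist w x1 ≤ η * dista Ω x1 → II (μ.restrict (closedBall y r)) (cut Ω K) w ≤ f w) →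
      ∀ x ∈ Ω, 4*r ≤ dist x y → II (μ.restrict (closedBall y r)) (cut Ω K) x ≤ C * f x := by
  obtain ⟨C1, hC1, hsh⟩ := shellbd hD hC
  obtain ⟨C3, hC3, hbh⟩ := bhshell' hD hC
  obtain ⟨c, hc, hc1, hch⟩ := chain hD hC (τ := 1/κ) (C := 10) (by positivity) (by norm_num)
  have hcH := cH_pos (N := N)
  have hL := hC.L0
  have hL1 := hC.L1
  have hR0 := hC.R0
  have hkf := ker_KF hD hΩ hx0 hK
  set C2 := C1/(c*cH N) with hC2
  have hC20 : 0 < C2 := by positivity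
  set c4 := c*(cH N*η^N*cH N) with hc4
  have hc40 : 0 < c4 := by positivity
  refine ⟨C3*(C2/c4), by positivity, ?_⟩
  intro μ hμ y x1 r f hy hyz hx1 hr hx1y hrκ hrR hf hfw x hx hxr
  have hΛr : 0 < Λ*r := by positivity
  set h := II (μ.restrict (closedBall y r)) (cut Ω K) with hh
  have hharm : Harm Ω h := hkf.I_harm hD
  have hτr : 1/κ*r ≤ dista Ω x1 := by
    rw [one_div, inv_mul_le_iff₀ (by positivity)]; exact hrκ
  have hτr2 : 1/κ*r ≤ 2*r := by
    have : 1/κ ≤ 1 := by rw [div_le_one (by positivity)]; exact hκ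
    nlinarith
  have hHx1 : 1/κ*r ≤ H x1 := by
    refine hτr.trans (hC.du x1 ?_ hx1)
    rw [mem_ball]; linarith [dist_triangle x1 y z0]
  have hyR : dist y z0 < R := by linarith
  have hHy : H y = 0 := hC.frontier_zero hD hy hyR
  have hx1z0 : dist x1 z0 < R/2 + r := by linarith [dist_triangle x1 y z0]
  -- shell estimate
  have hshell : ∀ x ∈ Ω, 2*r ≤ dist x y → dist x y ≤ 10*r → h x ≤ C2 * h x1 := by
    intro x hx hx2 hx10
    show II _ _ x ≤ C2 * II _ _ x1
    unfold II
    rw [← integral_const_mul]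
    refine integral_mono_ae (hkf.mf.int hD hkf hx) ((hkf.mf.int hD hkf hx1).const_mul _) ?_
    filter_upwards [ae_restrict_mem isClosed_closedBall.measurableSet] with z hz
    rw [mem_closedBall] at hz
    by_cases hzf : z ∈ frontier Ω
    · simp only [cut_eq hzf]
      have hkz := hK z hzf
      have hzz0 : dist z z0 < R/2 + r := by linarith [dist_triangle z y z0]
      have hHz : H z = 0 := hC.frontier_zero hD hzf (by linarith)
      have hHu : H (z + (2*r)•e) = 2*r := by rw [hC.up, hHz, zero_add]
      have hdu : dist (z + (2*r)•e) z = 2*r := by rw [hC.dist_up, abs_of_pos (by linarith)]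
      have hdu0 : dist (z + (2*r)•e) z0 < R/2 + 3*r := by linarith [dist_triangle (z + (2*r)•e) z z0]
      have huΩ : z + (2*r)•e ∈ Ω := (hC.mem _ (by rw [mem_ball]; linarith)).2 (by rw [hHu]; linarith)
      have a1 := hsh (K z) z (2*r) hkz.harm hHz (by linarith) (by linarith) (fun y' hy' hne => hkz.van y' hy' hne)
        x hx (by linarith [dist_triangle x z y]) (by linarith [dist_triangle x y z, dist_comm y z])
      have a2 := PP_harm hD hkz.harm huΩ
      have a3 := hch (K z) (z + (2*r)•e) x1 r _ (hkz.harm.sup hD) (mul_nonneg hcH.le (hkz.harm.nn _ huΩ)) hr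
        (by rw [hHu]; exact hτr2) hHx1
        (by linarith [dist_triangle (z + (2*r)•e) z x1, dist_triangle z y x1, dist_comm y x1])
        (by linarith) a2
      have a4 := a3.at
      calc K z x ≤ C1 * K z (z + (2*r)•e) := a1
        _ = C2 * (c * (cH N * K z (z + (2*r)•e))) := by rw [hC2]; field_simp
        _ ≤ C2 * K z x1 := by gcongr
    · simp only [cut_ne hzf]; simp
  rcases (hharm.nn x1 hx1).eq_or_lt with h0 | hpos
  · obtain ⟨C, hC0, hgl⟩ := global_harnack hD hx hx1
    have := hgl h hharm
    rw [← h0, mul_zero] at this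
    have h2 := hf.nn x hx
    have : 0 ≤ C3*(C2/c4) * f x := by positivity
    linarith
  · have hPPf : PP Ω f x1 (cH N * η^N * (cH N * h x1)) := by
      refine PP_small hD hf hx1 (by positivity) hη hη1 fun w hw => ?_
      refine le_trans ?_ (hfw w hw)
      refine PP_harm hD hharm hx1 w (hw.trans ?_)
      have := hD.dpos hx1
      nlinarith
    have hHu : H (y + (2*r)•e) = 2*r := by rw [hC.up, hHy, zero_add]
    have hdu : dist (y + (2*r)•e) y = 2*r := by rw [hC.dist_up, abs_of_pos (by linarith)]
    have hPP2 := hch f x1 (y + (2*r)•e) r _ hf (by positivity) hr hHx1 (by rw [hHu]; exact hτr2)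
      (by linarith [dist_triangle x1 y (y + (2*r)•e), dist_comm y (y + (2*r)•e)]) (by linarith) hPPf
    have hm' : c * (cH N * η^N * (cH N * h x1)) = c4 * h x1 := by rw [hc4]; ring
    rw [hm'] at hPP2
    have := hbh y (2*r) (C2 * h x1) (c4 * h x1) h f hHy (by linarith) (by linarith) (by positivity) (by positivity)
      hharm.cont (fun x hx _ => (hharm.AA_eq hD hx).ge) (fun x hx h1 h2 => hshell x hx h1 (by linarith)) ?_ hf hPP2
      x hx (by linarith)
    · rwa [mul_div_mul_right _ _ hpos.ne'] at this
    · intro y' hy' hd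
      refine van_int hD hΩ hx0 hK hy' (τ := r) hr ?_
      filter_upwards [ae_restrict_mem isClosed_closedBall.measurableSet] with z hz
      rw [mem_closedBall] at hz
      linarith [dist_triangle y' z y, dist_comm y' z]

end

section

variable {N : ℕ} {Ω : Set (ES N)} {z0 e : ES N} {H : ES N → ℝ} {Λ R : ℝ}

/-- the standing assumptions -/
structure ST (Ω : Set (ES N)) (x0 : ES N) (a : ℝ) (V : ES N → ℝ) (K T : ES N → ES N → ℝ) : Prop where
  D : Dom Ω
  L : IsLipschitzDomain Ω
  hx0 : x0 ∈ Ω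
  ha : 0 < a
  hV : VClass Ω a V
  hK : ∀ z ∈ frontier Ω, Ker Ω x0 z (K z)
  hT : ∀ z ∈ frontier Ω, IsGreatestLVHarmMinorant Ω V (K z) (T z)

variable {x0 : ES N} {a : ℝ} {V : ES N → ℝ} {K T : ES N → ES N → ℝ} 

def pp (Ω : Set (ES N)) (K T : ES N → ES N → ℝ) (z x : ES N) : ℝ := cut Ω K z x - cut Ω T z x

lemma ST.kf (S : ST Ω x0 a V K T) : KF Ω (cut Ω K) := ker_KF S.D S.L S.hx0 S.hK
lemma ST.tf (S : ST Ω x0 a V K T) : MF Ω (cut Ω K) (cut Ω T) := tker_MF S.D S.L S.hx0 S.ha S.hV S.hK S.hT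

lemma ST.pp_sup (S : ST Ω x0 a V K T) (z : ES N) : Sup Ω (pp Ω K T z) := by
  unfold pp
  by_cases hz : z ∈ frontier Ω
  · rw [cut_eq hz, cut_eq hz]
    exact p_sup S.D S.hV (S.hT z hz).1 (S.hT z hz).2.1 (S.hK z hz).harm
  · rw [cut_ne hz, cut_ne hz]
    simpa using harm_zero.sup S.D

lemma ST.tnn (S : ST Ω x0 a V K T) (z : ES N) {x : ES N} (hx : x ∈ Ω) : 0 ≤ cut Ω T z x := by
  by_cases hz : z ∈ frontier Ω
  · rw [cut_eq hz]; exact ((S.hT z hz).2.1 x hx).1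
  · rw [cut_ne hz]

lemma ST.pf (S : ST Ω x0 a V K T) : MF Ω (cut Ω K) (pp Ω K T) := by
  refine ⟨fun x hx => (S.kf.meas x hx).sub (S.tf.meas x hx), fun z => (S.pp_sup z).cont, fun z x hx => ?_⟩
  rw [abs_of_nonneg ((S.pp_sup z).nn x hx)]
  have := S.tnn z hx
  unfold pp; linarith

lemma ST.P_sup (S : ST Ω x0 a V K T) (μ : Measure (ES N)) [IsFiniteMeasure μ] : Sup Ω (II μ (pp Ω K T)) := by
  refine ⟨S.pf.I_cont S.D S.kf, fun x hx => integral_nonneg fun z => (S.pp_sup z).nn x hx, fun x hx => ?_⟩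
  rw [S.pf.I_AA S.D S.kf hx]
  exact integral_mono ((S.pf.AAf S.D S.kf).int S.D S.kf hx) (S.pf.int S.D S.kf hx) fun z => (S.pp_sup z).le x hx

lemma ST.mod (S : ST Ω x0 a V K T) {ε : ℝ} (hε : 0 < ε) : ∃ η : ℝ, 0 < η ∧ η ≤ 1/16 ∧
    ∀ (μ : Measure (ES N)) (_ : IsFiniteMeasure μ), ∀ x ∈ Ω, ∀ x', dist x' x ≤ η * dista Ω x →
      ε * II μ (cut Ω K) x ≤ II μ (pp Ω K T) x → ε/4 * II μ (cut Ω K) x' ≤ II μ (pp Ω K T) x' := by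
  set ε' := min (ε/4) 1 with hε'
  have h0 : 0 < ε' := lt_min (by positivity) one_pos
  have h1 : ε' ≤ ε/4 := min_le_left _ _
  have h2 : ε' ≤ 1 := min_le_right _ _
  obtain ⟨η1, a1, a2, a3⟩ := LVmod S.D S.ha h0
  obtain ⟨η2, b1, b2, b3⟩ := AA_modulus' S.D h0
  refine ⟨min η1 η2, lt_min a1 b1, (min_le_left _ _).trans a2, ?_⟩
  intro μ hμ x hx x' hd hp
  have hdx := S.D.dpos hx
  have d1 : dist x' x ≤ η1 * dista Ω x := hd.trans (by gcongr; exact min_le_left _ _)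
  have d2 : dist x' x ≤ η2 * dista Ω x := hd.trans (by gcongr; exact min_le_right _ _)
  have hx' : x' ∈ Ω := mem_of_dist_lt (x := x) (by nlinarith)
  have hT : ∀ z, cut Ω T z x' ≤ cut Ω T z x + ε' * cut Ω K z x := fun z => by
    by_cases hz : z ∈ frontier Ω
    · rw [cut_eq hz, cut_eq hz]
      have := abs_le.1 (a3 V (K z) (T z) S.hV (S.hK z hz).harm (S.hT z hz).1 (S.hT z hz).2.1 x hx x' d1)
      linarith
    · rw [cut_ne hz, cut_ne hz]; simp
  have hK : ∀ z, cut Ω K z x' ≤ cut Ω K z x + ε' * cut Ω K z x ∧ cut Ω K z x ≤ cut Ω K z x' + ε' * cut Ω K z x := fun z => by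
    have hh := S.kf.harm z
    have := b3 _ _ 1 zero_le_one hh (LB.of_cont hh.cont) (fun w hw => by rw [abs_of_nonneg (hh.nn w hw), one_mul]) x hx x' d2
    rw [hh.AA_eq S.D hx, hh.AA_eq S.D hx', mul_one] at this
    have := abs_le.1 this
    constructor <;> linarith
  have ik := S.kf.mf.int (μ := μ) S.D S.kf hx
  have ik' := S.kf.mf.int (μ := μ) S.D S.kf hx'
  have ip := S.pf.int (μ := μ) S.D S.kf hx
  have ip' := S.pf.int (μ := μ) S.D S.kf hx'
  have e1 : II μ (cut Ω K) x' ≤ (1+ε') * II μ (cut Ω K) x := by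
    unfold II; rw [← integral_const_mul]
    exact integral_mono ik' (ik.const_mul _) fun z => by have := (hK z).1; simp only; linarith
  have e2 : II μ (pp Ω K T) x ≤ II μ (pp Ω K T) x' + 2*ε' * II μ (cut Ω K) x := by
    unfold II; rw [← integral_const_mul, ← integral_add ip' (ik.const_mul _)]
    exact integral_mono ip (ip'.add (ik.const_mul _)) fun z => by
      have := (hK z).2; have := hT z; simp only [pp]; linarith
  have hh0 : 0 ≤ II μ (cut Ω K) x := (S.kf.I_harm S.D).nn x hx
  have e3 : ε/4 * II μ (cut Ω K) x' ≤ ε/4 * (2 * II μ (cut Ω K) x) := by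
    have : (1+ε') * II μ (cut Ω K) x ≤ 2 * II μ (cut Ω K) x := by gcongr; linarith
    have := e1.trans this
    gcongr
  have e4 : 2*ε' * II μ (cut Ω K) x ≤ ε/2 * II μ (cut Ω K) x := by gcongr; linarith
  linarith

def bump (y : ES N) (d : ℝ) (w : ES N) : ℝ := max 0 (min 1 (2 - 2 * dist w y / d))

lemma bump_cont (y : ES N) (d : ℝ) : Continuous (bump y d) := by
  unfold bump; fun_prop
lemma bump_nonneg (y : ES N) (d : ℝ) (w : ES N) : 0 ≤ bump y d w := le_max_left _ _
lemma bump_le (y : ES N) (d : ℝ) (w : ES N) : bump y d w ≤ 1 := max_le zero_le_one (min_le_left _ _)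
lemma bump_one {y : ES N} {d : ℝ} (hd : 0 < d) {w : ES N} (h : dist w y ≤ d/2) : bump y d w = 1 := by
  have : 1 ≤ 2 - 2 * dist w y / d := by
    have : 2 * dist w y / d ≤ 1 := by rw [div_le_one hd]; linarith
    linarith
  rw [bump, min_eq_left this]; exact max_eq_right zero_le_one
lemma bump_ne {y : ES N} {d : ℝ} (hd : 0 < d) {w : ES N} (h : bump y d w ≠ 0) : dist w y ≤ d := by
  by_contra hc
  push Not at hc
  apply h
  have : 2 - 2 * dist w y / d ≤ 0 := by
    have : 2 ≤ 2 * dist w y / d := by rw [le_div_iff₀ hd]; linarith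
    linarith
  rw [bump]; exact max_eq_left ((min_le_right _ _).trans this)

/-- the exceptional set -/
def bad (Ω : Set (ES N)) (K T : ES N → ES N → ℝ) (μ : Measure (ES N)) (κ ε : ℝ) : Set (ES N) :=
  {y | y ∈ frontier Ω ∧ ∀ ρ > 0, ∃ x ∈ Ω, dist x y < ρ ∧ dist x y ≤ κ * dista Ω x ∧
    ε * II μ (cut Ω K) x ≤ II μ (pp Ω K T) x}

set_option maxHeartbeats 2000000 in
lemma ST.cover (S : ST Ω x0 a V K T) (hC : Chart Ω z0 e H Λ R) (μ : Measure (ES N)) [IsFiniteMeasure μ]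
    {κ ε : ℝ} (hκ : 1 ≤ κ) (hε : 0 < ε) : ∃ C > 0, ∀ F ⊆ bad Ω K T μ κ ε ∩ ball z0 (R/2), ∀ x ∈ Ω,
      II (μ.restrict (toMeasurable μ F)) (cut Ω K) x ≤ C * II μ (pp Ω K T) x := by
  obtain ⟨η, hη0, hη1, hmod⟩ := S.mod hε
  obtain ⟨C, hC0, hbh⟩ := bhball S.D S.L S.hx0 S.hK hC hκ (η := η/2) (by positivity) (by linarith)
  have hL := hC.L0
  have hR0 := hC.R0
  refine ⟨C*(4/ε), by positivity, ?_⟩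
  intro F hF x hx
  have hdx := S.D.dpos hx
  set ρ0 := min (R/(32*Λ+400)) (dista Ω x/4) with hρ0
  have hρpos : 0 < ρ0 := lt_min (by positivity) (by positivity)
  obtain ⟨t, r, htc, htF, hr, hcov, hdisj⟩ := Besicovitch.exists_disjoint_closedBall_covering_ae μ
    (fun y => {r | ∃ x1 ∈ Ω, dist x1 y = r ∧ r ≤ κ * dista Ω x1 ∧ ε * II μ (cut Ω K) x1 ≤ II μ (pp Ω K T) x1}) F
    (fun y hy δ hδ => by
      obtain ⟨x1, h1, h2, h3, h4⟩ := (hF hy).1.2 δ hδ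
      exact ⟨dist x1 y, ⟨x1, h1, rfl, h3, h4⟩, dist_pos_of_frontier S.D h1 (hF hy).1.1, h2⟩)
    (fun _ => ρ0) (fun _ _ => hρpos)
  have hrx : ∀ y : t, ∃ x1 ∈ Ω, dist x1 (y : ES N) = r y ∧ r y ≤ κ * dista Ω x1 ∧
      ε * II μ (cut Ω K) x1 ≤ II μ (pp Ω K T) x1 := fun y => (hr y y.2).1
  choose X hXΩ hXr hXκ hXp using hrx
  have hr0 : ∀ y : t, 0 < r y := fun y => (hr y y.2).2.1
  have hrρ : ∀ y : t, r y < ρ0 := fun y => (hr y y.2).2.2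
  have hrR : ∀ y : t, (32*Λ+400) * r y ≤ R := fun y => by
    have := (hrρ y).le.trans (min_le_left _ _)
    rw [le_div_iff₀ (by positivity)] at this; linarith
  have hyf : ∀ y : t, (y:ES N) ∈ frontier Ω := fun y => (hF (htF y.2)).1.1
  have hyx : ∀ y : t, 4 * r y ≤ dist x y := fun y => by
    have h1 := (hrρ y).le.trans (min_le_right _ _)
    have h2 := dista_lip (Ω := Ω) x y
    have h3 : (y : ES N) ∉ Ω := by
      have := hyf y
      rw [S.D.op.frontier_eq] at this; exact this.2
    rw [dista_zero h3] at h2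
    linarith
  have hXd : ∀ y : t, 0 < η * dista Ω (X y) := fun y => mul_pos hη0 (S.D.dpos (hXΩ y))
  set B : t → Set (ES N) := fun y => closedBall (y : ES N) (r y) with hB
  have hBm : ∀ y, MeasurableSet (B y) := fun y => isClosed_closedBall.measurableSet
  have hBd : Pairwise (Function.onFun Disjoint B) := fun y y' hne =>
    hdisj y.2 y'.2 (fun h => hne (Subtype.ext h))
  have hinteg : ∀ w ∈ Ω, Integrable (fun z => cut Ω K z w) μ := fun w hw => S.kf.mf.int S.D S.kf hw
  have hknn : ∀ w ∈ Ω, ∀ z, 0 ≤ cut Ω K z w := fun w hw z => (S.kf.harm z).nn w hw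
  -- finite sums
  have hfin : ∀ J : Finset t, ∑ y ∈ J, II (μ.restrict (B y)) (cut Ω K) x ≤ C * (4/ε) * II μ (pp Ω K T) x := by
    intro J
    obtain ⟨f, hf1, hf2⟩ := balayage S.D J (χ := fun y => bump (X y) (η * dista Ω (X y)))
      (h := fun y => II (μ.restrict (B y)) (cut Ω K)) (fun y _ => S.kf.I_harm S.D) (fun y _ => bump_cont _ _)
      (fun y _ => bump_nonneg _ _) (fun y _ => bump_le _ _)
      (s := fun w => 4/ε * II μ (pp Ω K T) w) ((S.P_sup μ).smul (by positivity))
      (by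
        rintro w hw ⟨y, hy, hne⟩
        have h1 := hmod μ inferInstance (X y) (hXΩ y) w (bump_ne (hXd y) hne) (hXp y)
        have h2 : ∑ y ∈ J, II (μ.restrict (B y)) (cut Ω K) w ≤ II μ (cut Ω K) w := by
          unfold II
          rw [← integral_biUnion_finset J (fun y _ => hBm y) (fun y _ y' _ hne => hBd hne)
            (fun y _ => (hinteg w hw).integrableOn)]
          exact setIntegral_le_integral (hinteg w hw) (Eventually.of_forall (hknn w hw))
        calc _ ≤ II μ (cut Ω K) w := h2
          _ = 4/ε * (ε/4 * II μ (cut Ω K) w) := by field_simp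
          _ ≤ _ := by gcongr)
    calc ∑ y ∈ J, II (μ.restrict (B y)) (cut Ω K) x ≤ ∑ y ∈ J, C * f y x := by
          refine Finset.sum_le_sum fun y hy => ?_
          refine hbh μ inferInstance y (X y) (r y) (f y) (hyf y) (mem_ball.1 (hF (htF y.2)).2) (hXΩ y) (hr0 y)
            (hXr y).le (hXκ y) (hrR y) (hf1 y hy).1 (fun w hw => ?_) x hx (hyx y)
          have hwΩ : w ∈ Ω := mem_of_dist_lt (x := X y) (by have := S.D.dpos (hXΩ y); nlinarith)
          have := ((hf1 y hy).2 w hwΩ).1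
          rw [bump_one (hXd y) (by linarith), one_mul] at this
          exact this
      _ = C * ∑ y ∈ J, f y x := by rw [Finset.mul_sum]
      _ ≤ C * (4/ε * II μ (pp Ω K T) x) := by gcongr; exact hf2 x hx
      _ = _ := by ring
  have : Countable t := htc.to_subtype
  have hs := hasSum_integral_iUnion hBm hBd ((hinteg x hx).integrableOn)
  have hU := hasSum_le_of_sum_le hs hfin
  refine le_trans ?_ hU
  refine setIntegral_mono_set (hinteg x hx).integrableOn (Eventually.of_forall (hknn x hx)) ?_
  have hUm : MeasurableSet (⋃ y, B y) := MeasurableSet.iUnion hBm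
  have h0 : μ (toMeasurable μ F \ ⋃ y, B y) = 0 := by
    rw [diff_eq, Measure.measure_toMeasurable_inter hUm.compl (measure_ne_top _ _), ← diff_eq]
    have : ⋃ y, B y = ⋃ y ∈ t, closedBall y (r y) := by rw [biUnion_eq_iUnion]
    rw [this]; exact hcov
  exact ae_le_set.2 h0

end

section

variable {N : ℕ} {Ω : Set (ES N)} {z0 e : ES N} {H : ES N → ℝ} {Λ R : ℝ}
variable {x0 : ES N} {a : ℝ} {V : ES N → ℝ} {K T : ES N → ES N → ℝ} 

lemma ST.one (S : ST Ω x0 a V K T) {z : ES N} (hz : z ∈ frontier Ω) : cut Ω K z x0 = 1 := by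
  rw [cut_eq hz]; exact (S.hK z hz).one

lemma ST.le_one (S : ST Ω x0 a V K T) (z : ES N) : cut Ω K z x0 ≤ 1 := by
  by_cases hz : z ∈ frontier Ω
  · exact (S.one hz).le
  · rw [cut_ne hz]; exact zero_le_one

lemma ST.van_compact (S : ST Ω x0 a V K T) (μ : Measure (ES N)) [IsFiniteMeasure μ] {Q : Set (ES N)} (hQ : IsCompact Q)
    {y : ES N} (hy : y ∈ frontier Ω) (hyQ : y ∉ Q) : Van Ω (II (μ.restrict Q) (cut Ω K)) y := by
  obtain ⟨τ, hτ, hb⟩ := Metric.isOpen_iff.1 hQ.isClosed.isOpen_compl y hyQ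
  refine van_int S.D S.L S.hx0 S.hK hy hτ ?_
  filter_upwards [ae_restrict_mem hQ.measurableSet] with z hz
  by_contra hc
  exact hb (mem_ball.2 (not_le.1 hc)) hz

set_option maxHeartbeats 1000000 in
lemma ST.sing (S : ST Ω x0 a V K T) (μ : Measure (ES N)) [IsFiniteMeasure μ] {W : Set (ES N)} (hW : MeasurableSet W)
    (hWf : W ⊆ frontier Ω) {c : ℝ} (hc : 0 < c)
    (h : ∀ x ∈ Ω, c * II (μ.restrict W) (cut Ω K) x ≤ II (μ.restrict Wᶜ) (cut Ω K) x) : μ W = 0 := by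
  by_contra hne
  obtain ⟨W1, hW1, hW1c, hW1p⟩ := hW.exists_lt_isCompact (μ := μ) (r := 0) (pos_iff_ne_zero.2 hne)
  have hm1 : 0 < μ.real W1 := ENNReal.toReal_pos hW1p.ne' (measure_ne_top _ _)
  set τ := c * μ.real W1 / 2 with hτ
  have hτ0 : 0 < τ := by positivity
  obtain ⟨Q, hQ, hQc, hQm⟩ := hW.compl.exists_isCompact_sdiff_lt (μ := μ) (measure_ne_top _ _) (ε := ENNReal.ofReal τ)
    (by simpa using hτ0)
  have hinteg : ∀ w ∈ Ω, Integrable (fun z => cut Ω K z w) μ := fun w hw => S.kf.mf.int S.D S.kf hw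
  have hknn : ∀ w ∈ Ω, ∀ z, 0 ≤ cut Ω K z w := fun w hw z => (S.kf.harm z).nn w hw
  have H1 : Harm Ω (II (μ.restrict W1) (cut Ω K)) := S.kf.I_harm S.D
  have H2 : Harm Ω (II (μ.restrict (Wᶜ \ Q)) (cut Ω K)) := S.kf.I_harm S.D
  have c1 : ContinuousOn (fun x => c * II (μ.restrict W1) (cut Ω K) x) Ω := (H1.cont.const_mul c |>.congr fun _ _ => rfl)
  have key := maxPrinciple S.D (g := fun x => c * II (μ.restrict W1) (cut Ω K) x - II (μ.restrict (Wᶜ \ Q)) (cut Ω K) x)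
    (c1.sub H2.cont) (D := Ω) subset_rfl ?_ ?_ ?_ x0 S.hx0
  · have e1 : II (μ.restrict W1) (cut Ω K) x0 = μ.real W1 := by
      unfold II
      rw [setIntegral_congr_fun hW1c.measurableSet (g := fun _ => (1:ℝ)) (fun z hz => S.one (hWf (hW1 hz)))]
      simp
    have e2 : II (μ.restrict (Wᶜ \ Q)) (cut Ω K) x0 ≤ τ := by
      have : II (μ.restrict (Wᶜ \ Q)) (cut Ω K) x0 ≤ ∫ z in Wᶜ \ Q, (1:ℝ) ∂μ :=
        integral_mono (hinteg x0 S.hx0).integrableOn (integrable_const _) S.le_one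
      refine this.trans ?_
      simp only [integral_const, smul_eq_mul, mul_one, measureReal_restrict_apply_univ]
      exact ENNReal.toReal_le_of_le_ofReal hτ0.le hQm.le
    rw [e1] at key
    have : c * μ.real W1 = 2 * τ := by rw [hτ]; ring
    linarith
  · intro x hx
    rw [AA_sub S.D (LB.of_cont c1) (LB.of_cont H2.cont) hx, AA_smul, H1.AA_eq S.D hx, H2.AA_eq S.D hx]
  · intro x hx w hw hn
    exact absurd (S.D.half_sub hx hw) hn
  · intro y hy ε hε
    by_cases hyW : y ∈ W1
    · have hyQ : y ∉ Q := fun hq => hQ hq (hW1 hyW)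
      filter_upwards [S.van_compact μ hQc hy hyQ ε hε, self_mem_nhdsWithin] with x hx hxΩ
      have h1 := h x hxΩ
      have h2 : II (μ.restrict (Wᶜ \ Q)) (cut Ω K) x = II (μ.restrict Wᶜ) (cut Ω K) x - II (μ.restrict Q) (cut Ω K) x :=
        setIntegral_sdiff hQc.measurableSet (hinteg x hxΩ).integrableOn hQ
      have h3 : II (μ.restrict W1) (cut Ω K) x ≤ II (μ.restrict W) (cut Ω K) x :=
        setIntegral_mono_set (hinteg x hxΩ).integrableOn (Eventually.of_forall (hknn x hxΩ)) (HasSubset.Subset.eventuallyLE hW1)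
      have h4 := mul_le_mul_of_nonneg_left h3 hc.le
      linarith
    · filter_upwards [S.van_compact μ hW1c hy hyW (ε/c) (by positivity), self_mem_nhdsWithin] with x hx hxΩ
      have := H2.nn x hxΩ
      rw [lt_div_iff₀ hc] at hx
      linarith

set_option maxHeartbeats 1000000 in
lemma ST.null (S : ST Ω x0 a V K T) (hC : Chart Ω z0 e H Λ R) (μ : Measure (ES N)) [IsFiniteMeasure μ]
    {κ ε : ℝ} (hκ : 1 ≤ κ) (hε : 0 < ε) :
    μ (bad Ω K T μ κ ε ∩ {z | 0 < cut Ω T z x0} ∩ ball z0 (R/2)) = 0 := by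
  classical
  obtain ⟨C, hC0, hcov⟩ := S.cover hC μ hκ hε
  set F := bad Ω K T μ κ ε ∩ {z | 0 < cut Ω T z x0} ∩ ball z0 (R/2) with hF
  have hRm : MeasurableSet {z | 0 < cut Ω T z x0} := measurableSet_lt measurable_const (S.tf.meas x0 S.hx0)
  set W := toMeasurable μ F ∩ {z | 0 < cut Ω T z x0} with hW
  have hWm : MeasurableSet W := (measurableSet_toMeasurable _ _).inter hRm
  have hFW : F ⊆ W := fun z hz => ⟨subset_toMeasurable _ _ hz, hz.1.2⟩
  have hWf : W ⊆ frontier Ω := fun z hz => by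
    by_contra hn
    have : 0 < cut Ω T z x0 := hz.2
    rw [cut_ne hn] at this; exact lt_irrefl _ this
  have hinteg : ∀ w ∈ Ω, Integrable (fun z => cut Ω K z w) μ := fun w hw => S.kf.mf.int S.D S.kf hw
  have hknn : ∀ w ∈ Ω, ∀ z, 0 ≤ cut Ω K z w := fun w hw z => (S.kf.harm z).nn w hw
  set G : ES N → ES N → ℝ := fun z => if z ∈ W then pp Ω K T z else cut Ω K z with hG
  have hGm : MF Ω (cut Ω K) G := by
    refine ⟨fun x hx => ?_, fun z => ?_, fun z x hx => ?_⟩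
    · have : (fun z => G z x) = fun z => if z ∈ W then pp Ω K T z x else cut Ω K z x := by
        funext z; simp only [hG]; split_ifs <;> rfl
      rw [this]
      exact Measurable.ite hWm (S.pf.meas x hx) (S.kf.meas x hx)
    · simp only [hG]; split_ifs
      · exact S.pf.cont z
      · exact (S.kf.harm z).cont
    · simp only [hG]; split_ifs
      · exact S.pf.le z x hx
      · exact S.kf.mf.le z x hx
  have hppG : ∀ z, ∀ x ∈ Ω, pp Ω K T z x ≤ G z x := fun z x hx => by
    simp only [hG]; split_ifs
    · exact le_rfl
    · exact (le_abs_self _).trans (S.pf.le z x hx)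
  have HW : Harm Ω (II (μ.restrict W) (cut Ω K)) := S.kf.I_harm S.D
  have cW : ContinuousOn (fun x => C⁻¹ * II (μ.restrict W) (cut Ω K) x) Ω := (HW.cont.const_mul _ |>.congr fun _ _ => rfl)
  have h0 : ∀ x ∈ Ω, C⁻¹ * II (μ.restrict W) (cut Ω K) x ≤ II μ G x := fun x hx => by
    rw [inv_mul_le_iff₀ hC0]
    have h1 := hcov F (fun z hz => ⟨hz.1.1, hz.2⟩) x hx
    have h2 : II (μ.restrict W) (cut Ω K) x ≤ II (μ.restrict (toMeasurable μ F)) (cut Ω K) x :=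
      setIntegral_mono_set (hinteg x hx).integrableOn (Eventually.of_forall (hknn x hx))
        (HasSubset.Subset.eventuallyLE inter_subset_left)
    have h3 : II μ (pp Ω K T) x ≤ II μ G x :=
      integral_mono (S.pf.int S.D S.kf hx) (hGm.int S.D S.kf hx) fun z => hppG z x hx
    have h4 := mul_le_mul_of_nonneg_left h3 hC0.le
    linarith
  have hfin : μ W = 0 := by
    refine S.sing μ hWm hWf (c := C⁻¹) (by positivity) fun x hx => ?_
    have hlim : Tendsto (fun n => II μ (fun z => it Ω (G z) n) x) atTop (𝓝 (∫ z, Wᶜ.indicator (fun z => cut Ω K z x) z ∂μ)) := by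
      refine tendsto_integral_of_dominated_convergence (fun z => cut Ω K z x)
        (fun n => ((hGm.itf S.D S.kf n).meas x hx).aestronglyMeasurable) (hinteg x hx)
        (fun n => Eventually.of_forall fun z => (hGm.itf S.D S.kf n).le z x hx) (Eventually.of_forall fun z => ?_)
      show Tendsto (fun n => it Ω (G z) n x) atTop _
      by_cases hz : z ∈ W
      · have hzf := hWf hz
        have e1 : G z = fun x => K z x - T z x := by
          simp only [hG, if_pos hz]; unfold pp; rw [cut_eq hzf, cut_eq hzf]
        have hT0 : 0 < T z x0 := by
          have : 0 < cut Ω T z x0 := hz.2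
          rwa [cut_eq hzf] at this
        rw [e1, indicator_of_notMem (by simpa using hz)]
        exact p_pot S.D S.L hzf S.hV (S.hK z hzf) (S.hT z hzf) S.hx0 hT0 x hx
      · have e1 : G z = cut Ω K z := by simp only [hG, if_neg hz]
        rw [e1, indicator_of_mem (by simpa using hz)]
        refine tendsto_const_nhds.congr fun n => ?_
        exact (it_inv S.D (fun x hx => (S.kf.harm z).AA_eq S.D hx) n x hx).symm
    rw [integral_indicator hWm.compl] at hlim
    refine ge_of_tendsto hlim (Eventually.of_forall fun n => ?_)
    rw [← hGm.I_it S.D S.kf n x hx]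
    have := it_mono S.D cW (hGm.I_cont S.D S.kf) h0 n x hx
    rwa [it_inv S.D (fun x hx => by rw [AA_smul, HW.AA_eq S.D hx]) n x hx] at this
  exact measure_mono_null hFW hfin

lemma ST.nullAll (S : ST Ω x0 a V K T) (μ : Measure (ES N)) [IsFiniteMeasure μ]
    {κ ε : ℝ} (hκ : 1 ≤ κ) (hε : 0 < ε) : μ (bad Ω K T μ κ ε ∩ {z | 0 < cut Ω T z x0}) = 0 := by
  refine measure_null_of_locally_null _ fun z hz => ?_
  obtain ⟨e, H, Λ, R, hC⟩ := exists_chart S.D S.L hz.1.1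
  refine ⟨_, inter_mem_nhdsWithin _ (ball_mem_nhds z (half_pos hC.R0)), S.null hC μ hκ hε⟩

lemma ST.final (S : ST Ω x0 a V K T) (μ : Measure (ES N)) [IsFiniteMeasure μ] (hμ : μ (frontier Ω)ᶜ = 0) :
    ∀ᵐ y ∂μ, 0 < T y x0 → TendstoNT Ω (fun x => (∫ z, T z x ∂μ) / ∫ z, K z x ∂μ) y (𝓝 1) := by
  have hfr : ∀ᵐ y ∂μ, y ∈ frontier Ω := hμ
  have hb : ∀ᵐ y ∂μ, ∀ n m : ℕ, y ∉ bad Ω K T μ (n+1) (1/((m:ℝ)+1)) ∩ {z | 0 < cut Ω T z x0} := by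
    rw [ae_all_iff]; intro n
    rw [ae_all_iff]; intro m
    exact measure_eq_zero_iff_ae_notMem.1 (S.nullAll μ (by have : (0:ℝ) ≤ n := n.cast_nonneg; linarith) (by positivity))
  filter_upwards [hfr, hb] with y hy hyb hTy κ hκ
  have eT : ∀ x, ∫ z, T z x ∂μ = II μ (cut Ω T) x := fun x => integral_congr_ae (by
    filter_upwards [hfr] with z hz; rw [cut_eq hz])
  have eK : ∀ x, ∫ z, K z x ∂μ = II μ (cut Ω K) x := fun x => integral_congr_ae (by
    filter_upwards [hfr] with z hz; rw [cut_eq hz])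
  simp_rw [eT, eK]
  rw [Metric.tendsto_nhds]
  intro ε hε
  obtain ⟨n, hn⟩ := exists_nat_ge κ
  obtain ⟨m, hm⟩ := exists_nat_one_div_lt hε
  have h1 : y ∉ bad Ω K T μ (n+1) (1/((m:ℝ)+1)) := fun h => hyb n m ⟨h, by
    show 0 < cut Ω T y x0
    rw [cut_eq hy]; exact hTy⟩
  have h2 : ∃ ρ > 0, ∀ x ∈ Ω, dist x y < ρ → dist x y ≤ (n+1) * dista Ω x →
      II μ (pp Ω K T) x < 1/((m:ℝ)+1) * II μ (cut Ω K) x := by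
    by_contra hcon
    push Not at hcon
    exact h1 ⟨hy, fun ρ hρ => hcon ρ hρ⟩
  obtain ⟨ρ, hρ, hgood⟩ := h2
  filter_upwards [self_mem_nhdsWithin, nhdsWithin_le_nhds (ball_mem_nhds y hρ)] with x hx hxρ
  have hdx := S.D.dpos hx.1
  have hg := hgood x hx.1 hxρ (hx.2.trans (by gcongr; linarith))
  have hp0 := (S.P_sup μ).nn x hx.1
  have hh0 : 0 < II μ (cut Ω K) x := by
    rcases ((S.kf.I_harm (μ := μ) S.D).nn x hx.1).eq_or_lt with h | h
    · rw [← h, mul_zero] at hg; linarith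
    · exact h
  have hsub : II μ (pp Ω K T) x = II μ (cut Ω K) x - II μ (cut Ω T) x :=
    integral_sub (S.kf.mf.int S.D S.kf hx.1) (S.tf.int S.D S.kf hx.1)
  have : II μ (cut Ω T) x / II μ (cut Ω K) x - 1 = - (II μ (pp Ω K T) x / II μ (cut Ω K) x) := by
    rw [hsub]; field_simp; ring
  rw [Real.dist_eq, this, abs_neg, abs_of_nonneg (by positivity), div_lt_iff₀ hh0]
  calc _ < 1/((m:ℝ)+1) * II μ (cut Ω K) x := hg
    _ ≤ ε * II μ (cut Ω K) x := by gcongr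

lemma dom_of (hN : 2 ≤ N) (hΩ : IsLipschitzDomain Ω) (hbd : Bornology.IsBounded Ω) : Dom Ω := by
  refine ⟨hΩ.1, hΩ.2.1, hbd, ?_⟩
  by_contra hne
  rw [not_nonempty_iff_eq_empty, compl_empty_iff] at hne
  have : Nontrivial (ES N) := by
    have : Nonempty (Fin N) := ⟨⟨0, by omega⟩⟩
    exact inferInstance
  rw [hne] at hbd
  exact NormedSpace.unbounded_univ ℝ (ES N) hbd

lemma main_result {N : ℕ} (hN : 2 ≤ N) (Ω : Set (ES N)) (hΩ : IsLipschitzDomain Ω) (hbd : Bornology.IsBounded Ω)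
    (x₀ : ES N) (hx₀ : x₀ ∈ Ω) (a : ℝ) (ha : 0 < a) (V : ES N → ℝ) (hV : VClass Ω a V) (K KV : ES N → ES N → ℝ)
    (c : ES N → ℝ) (hK : ∀ y ∈ frontier Ω, IsMartinKernel Ω (fun _ => 0) x₀ y (K y))
    (hKV : ∀ y ∈ frontier Ω, IsMartinKernel Ω V x₀ y (KV y))
    (hc : ∀ y ∈ frontier Ω, 0 ≤ c y ∧ c y ≤ 1 ∧ IsGreatestLVHarmMinorant Ω V (K y) (fun x => c y * KV y x)) :
    (∀ y₀ ∈ frontier Ω, 0 < c y₀ → TendstoNT Ω (fun x => c y₀ * KV y₀ x / K y₀ x) y₀ (𝓝 1)) ∧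
    ∀ μ : Measure (ES N), IsFiniteMeasure μ → μ (frontier Ω)ᶜ = 0 →
      ∀ᵐ y ∂μ, 0 < c y → TendstoNT Ω (fun x => (∫ z, c z * KV z x ∂μ) / ∫ z, K z x ∂μ) y (𝓝 1) := by
  have hD := dom_of hN hΩ hbd
  have S : ST Ω x₀ a V K (fun z x => c z * KV z x) :=
    ⟨hD, hΩ, hx₀, ha, hV, fun z hz => Ker.of_martin hD (hK z hz), fun z hz => (hc z hz).2.2⟩
  have part2 : ∀ μ : Measure (ES N), IsFiniteMeasure μ → μ (frontier Ω)ᶜ = 0 →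
      ∀ᵐ y ∂μ, 0 < c y → TendstoNT Ω (fun x => (∫ z, c z * KV z x ∂μ) / ∫ z, K z x ∂μ) y (𝓝 1) := by
    intro μ hμ hμf
    have hfr : ∀ᵐ y ∂μ, y ∈ frontier Ω := hμf
    filter_upwards [S.final μ hμf, hfr] with y hy hyf hcy
    refine hy ?_
    show 0 < c y * KV y x₀
    rw [(hKV y hyf).2.2.1, mul_one]; exact hcy
  refine ⟨fun y₀ hy₀ hcy => ?_, part2⟩
  have := part2 (Measure.dirac y₀) inferInstance (by simp [hy₀])
  rw [ae_dirac_eq] at this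
  have := this hcy
  simpa only [integral_dirac] using this

end

/-- Proposition `propA5`. If `y₀ ∈ ∂Ω` is finely regular
(`c(y₀) > 0`, where `K̃_y^V = c(y)·K_y^V` is the greatest `L_V`-harmonic minorant of
`K_y`), then `K̃_{y₀}^V/K_{y₀} → 1` nontangentially at `y₀`; more generally, for any
finite positive measure `μ` on `∂Ω` and `μ`-a.e. `y ∈ Reg_V(Ω)`, the ratio
`K̃_μ^V/K_μ → 1` nontangentially at `y`. -/
theorem statement8 {N : ℕ} (hN : 2 ≤ N) (Ω : Set (ES N))
    (hΩ : IsLipschitzDomain Ω) (hbd : Bornology.IsBounded Ω)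
    (x₀ : ES N) (hx₀ : x₀ ∈ Ω) (a : ℝ) (ha : 0 < a)
    (V : ES N → ℝ) (hV : VClass Ω a V)
    (K KV : ES N → ES N → ℝ) (c : ES N → ℝ)
    (hK : ∀ y ∈ frontier Ω, IsMartinKernel Ω (fun _ => 0) x₀ y (K y))
    (hKV : ∀ y ∈ frontier Ω, IsMartinKernel Ω V x₀ y (KV y))
    (hc : ∀ y ∈ frontier Ω, 0 ≤ c y ∧ c y ≤ 1 ∧
      IsGreatestLVHarmMinorant Ω V (K y) (fun x => c y * KV y x)) :
    (∀ y₀ ∈ frontier Ω, 0 < c y₀ →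
      TendstoNT Ω (fun x => c y₀ * KV y₀ x / K y₀ x) y₀ (𝓝 1)) ∧
    ∀ μ : Measure (ES N), IsFiniteMeasure μ → μ (frontier Ω)ᶜ = 0 →
      ∀ᵐ y ∂μ, 0 < c y →
        TendstoNT Ω (fun x => (∫ z, c z * KV z x ∂μ) / ∫ z, K z x ∂μ) y (𝓝 1) := by
  exact main_result hN Ω hΩ hbd x₀ hx₀ a ha V hV K KV c hK hKV hc
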